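/- Let p < q be odd prime numbers with q ≤ 2p + 1. Then every Hopf algebra H over ℂ whose dimension as a ℂ-vector space equals p·q is semisimple as a ring. -/

import Mathlib

namespace HopfPQ
open Coalgebra HopfAlgebra TensorProduct

/-! ### Sweedler notation -/

section

/-- Unbundled `ℂ`-linearity, set up so that `fun_prop` can discharge it. -/
@[fun_prop]
structure IsLin {M N : Type*} [AddCommGroup M] [Module ℂ M] [AddCommGroup N] [Module ℂ N]
    (f : M → N) : Prop where
  map_add : ∀ x y, f (x + y) = f x + f y
  map_smul : ∀ (c : ℂ) x, f (c • x) = c • f x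

section Linear

variable {M N P : Type*} [AddCommGroup M] [Module ℂ M] [AddCommGroup N] [Module ℂ N]
  [AddCommGroup P] [Module ℂ P] {A B : Type*} [Ring A] [Algebra ℂ A] [Ring B] [Algebra ℂ B]

@[fun_prop]
theorem IsLin.id' : IsLin (fun x : M => x) := ⟨by simp, by simp⟩

@[fun_prop]
theorem IsLin.comp' {f : N → P} {g : M → N} (hf : IsLin f) (hg : IsLin g) :
    IsLin (fun x => f (g x)) :=
  ⟨by simp [hf.map_add, hg.map_add], by simp [hf.map_smul, hg.map_smul]⟩

@[fun_prop]
theorem IsLin.linearMap (f : N →ₗ[ℂ] P) {g : M → N} (hg : IsLin g) : IsLin (fun x => f (g x)) :=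
  ⟨by simp [hg.map_add], by simp [hg.map_smul]⟩

@[fun_prop]
theorem IsLin.algHom (f : A →ₐ[ℂ] B) {g : M → A} (hg : IsLin g) : IsLin (fun x => f (g x)) :=
  ⟨by simp [hg.map_add], by simp [hg.map_smul]⟩

@[fun_prop]
theorem IsLin.mul_const {f : M → A} (hf : IsLin f) (c : A) : IsLin (fun x => f x * c) :=
  ⟨by simp [hf.map_add, add_mul], by simp [hf.map_smul]⟩

@[fun_prop]
theorem IsLin.const_mul {f : M → A} (hf : IsLin f) (c : A) : IsLin (fun x => c * f x) :=
  ⟨by simp [hf.map_add, mul_add], by simp [hf.map_smul]⟩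

@[fun_prop]
theorem IsLin.smul_const {f : M → ℂ} (hf : IsLin f) (c : P) : IsLin (fun x => f x • c) :=
  ⟨by simp [hf.map_add, add_smul], by simp [hf.map_smul, mul_smul]⟩

@[fun_prop]
theorem IsLin.const_smul {f : M → P} (hf : IsLin f) (c : ℂ) : IsLin (fun x => c • f x) :=
  ⟨by simp [hf.map_add], by intros; simp [hf.map_smul, smul_comm c]⟩

@[fun_prop]
theorem IsLin.tmul_const {f : M → N} (hf : IsLin f) (c : P) : IsLin (fun x => f x ⊗ₜ[ℂ] c) :=
  ⟨by simp [hf.map_add, add_tmul], by intros; simp [hf.map_smul, smul_tmul']⟩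

@[fun_prop]
theorem IsLin.const_tmul {f : M → N} (hf : IsLin f) (c : P) : IsLin (fun x => c ⊗ₜ[ℂ] f x) :=
  ⟨by simp [hf.map_add, tmul_add], by intros; simp [hf.map_smul]⟩

@[fun_prop]
theorem IsLin.sum {ι : Type*} (s : Finset ι) {f : ι → M → P} (hf : ∀ i, IsLin (f i)) :
    IsLin (fun x => ∑ i ∈ s, f i x) :=
  ⟨by simp [(hf _).map_add, Finset.sum_add_distrib],
    by intros; simp [(hf _).map_smul, Finset.smul_sum]⟩

/-- The bundled linear map attached to a linear function. -/
def IsLin.mk' {f : M → N} (hf : IsLin f) : M →ₗ[ℂ] N := ⟨⟨f, hf.map_add⟩, hf.map_smul⟩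

@[simp]
theorem IsLin.mk'_apply {f : M → N} (hf : IsLin f) (x : M) : hf.mk' x = f x := rfl

theorem IsLin.map_sum {f : M → N} (hf : IsLin f) {ι : Type*} (s : Finset ι) (g : ι → M) :
    f (∑ i ∈ s, g i) = ∑ i ∈ s, f (g i) :=
  _root_.map_sum hf.mk' g s

theorem IsLin.map_zero {f : M → N} (hf : IsLin f) : f 0 = 0 := _root_.map_zero hf.mk'

/-- Bilinearity of an unbundled function. -/
structure IsBilin (f : M → N → P) : Prop where
  left : ∀ b, IsLin (fun a => f a b)
  right : ∀ a, IsLin (fun b => f a b)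

/-- The linear map on the tensor product attached to a bilinear function. -/
noncomputable def IsBilin.lift {f : M → N → P} (hf : IsBilin f) : M ⊗[ℂ] N →ₗ[ℂ] P :=
  TensorProduct.lift (LinearMap.mk₂ ℂ f (fun a b c => (hf.left c).map_add a b)
    (fun c a b => (hf.left b).map_smul c a) (fun a => (hf.right a).map_add)
    (fun c a => (hf.right a).map_smul c))

@[simp]
theorem IsBilin.lift_tmul {f : M → N → P} (hf : IsBilin f) (a : M) (b : N) :
    hf.lift (a ⊗ₜ b) = f a b := by
  simp [IsBilin.lift]

end Linear

section Sweedler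

variable {A M N : Type*} [Ring A] [HopfAlgebra ℂ A] [AddCommGroup M] [Module ℂ M]
  [AddCommGroup N] [Module ℂ N]

/-- Sweedler notation: `sw f x` is `∑ f x₁ x₂`. -/
noncomputable def sw (f : A → A → M) (x : A) : M :=
  ∑ i ∈ (ℛ ℂ x).index, f ((ℛ ℂ x).left i) ((ℛ ℂ x).right i)

theorem sw_eq_lift {f : A → A → M} (hf : IsBilin f) (x : A) : sw f x = hf.lift (comul x) := by
  conv_rhs => rw [← (ℛ ℂ x).eq]
  simp [sw]

theorem comul_eq_sw (x : A) : comul (R := ℂ) x = sw (fun a b => a ⊗ₜ[ℂ] b) x :=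
  ((ℛ ℂ x).eq).symm

@[fun_prop]
theorem IsLin.sw {f : N → A → A → M} (hf : ∀ a b, IsLin (fun x => f x a b)) (y : A) :
    IsLin (fun x => sw (f x) y) := by
  constructor
  · intro x z; simp [HopfPQ.sw, (hf _ _).map_add, Finset.sum_add_distrib]
  · intro x z; simp [HopfPQ.sw, (hf _ _).map_smul, Finset.smul_sum]

@[fun_prop]
theorem IsLin.sw_arg {f : A → A → M} (hl : ∀ b, IsLin (fun a => f a b))
    (hr : ∀ a, IsLin (fun b => f a b)) {g : N → A} (hg : IsLin g) :
    IsLin (fun x => HopfPQ.sw f (g x)) := by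
  have h : IsBilin f := ⟨hl, hr⟩
  constructor
  · intro x y; simp [sw_eq_lift h, hg.map_add]
  · intro x y; simp [sw_eq_lift h, hg.map_smul]

theorem map_sw {L : M → N} (f : A → A → M) (x : A) (hL : IsLin L := by fun_prop) :
    L (sw f x) = sw (fun a b => L (f a b)) x := by
  simp [sw, hL.map_sum]

omit [Module ℂ M] in
theorem sum_sw {ι : Type*} (s : Finset ι) (f : ι → A → A → M) (x : A) :
    ∑ i ∈ s, sw (f i) x = sw (fun a b => ∑ i ∈ s, f i a b) x :=
  Finset.sum_comm

theorem sw_smul (f : A → A → M) (c : ℂ) (x : A) : c • sw f x = sw (fun a b => c • f a b) x :=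
  Finset.smul_sum

theorem sw_smul_const (f : A → A → ℂ) (c : M) (x : A) : sw f x • c = sw (fun a b => f a b • c) x :=
  Finset.sum_smul

theorem sw_mul_const (f : A → A → ℂ) (c : ℂ) (x : A) : sw f x * c = sw (fun a b => f a b * c) x :=
  Finset.sum_mul ..

theorem sw_const_mul (f : A → A → ℂ) (c : ℂ) (x : A) : c * sw f x = sw (fun a b => c * f a b) x :=
  Finset.mul_sum ..

omit [Module ℂ M] in
theorem sw_comm {B : Type*} [Ring B] [HopfAlgebra ℂ B] (f : A → A → B → B → M) (x : A) (y : B) :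
    sw (fun a b => sw (fun c d => f a b c d) y) x =
      sw (fun c d => sw (fun a b => f a b c d) x) y :=
  Finset.sum_comm

omit [Module ℂ M] in
theorem sw_congr {f g : A → A → M} (h : ∀ a b, f a b = g a b) (x : A) : sw f x = sw g x := by
  simp [sw, h]

theorem sw_counit_left {f : A → M} (x : A) (hf : IsLin f := by fun_prop) :
    sw (fun a b => counit (R := ℂ) a • f b) x = f x := by
  conv_rhs => rw [← sum_counit_smul (R := ℂ) (ℛ ℂ x)]
  simp [sw, hf.map_sum, hf.map_smul]

theorem sw_counit_right {f : A → M} (x : A) (hf : IsLin f := by fun_prop) :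
    sw (fun a b => counit (R := ℂ) b • f a) x = f x := by
  have h := sum_tmul_counit_eq (R := ℂ) (ℛ ℂ x)
  have h2 := congrArg (TensorProduct.lift ((LinearMap.lsmul ℂ A).flip)) h
  simp only [_root_.map_sum, TensorProduct.lift.tmul] at h2
  conv_rhs => rw [show x = ∑ i ∈ (ℛ ℂ x).index, counit (R := ℂ) ((ℛ ℂ x).right i) •
    (ℛ ℂ x).left i by simpa using h2.symm]
  simp [sw, hf.map_sum, hf.map_smul]

theorem sw_coassoc {T : A → A → A → M} (x : A)
    (h1 : ∀ b c, IsLin (fun a => T a b c) := by fun_prop)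
    (h2 : ∀ a c, IsLin (fun b => T a b c) := by fun_prop)
    (h3 : ∀ a b, IsLin (fun c => T a b c) := by fun_prop) :
    sw (fun a b => sw (fun c d => T c d b) a) x = sw (fun a b => sw (fun c d => T a c d) b) x := by
  have hb : ∀ a, IsBilin (T a) := fun a => ⟨fun c => h2 a c, fun b => h3 a b⟩
  have ht : IsBilin (fun a (t : A ⊗[ℂ] A) => (hb a).lift t) := by
    refine ⟨fun t => ?_, fun a => by fun_prop⟩
    constructor
    · intro a a'
      induction t with
      | zero => simp
      | tmul b c => simp [(h1 b c).map_add]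
      | add s t hs ht => rw [_root_.map_add, hs, ht, _root_.map_add, _root_.map_add]; abel
    · intro c a
      induction t with
      | zero => simp
      | tmul b d => simp [(h1 b d).map_smul]
      | add s t hs ht => rw [_root_.map_add, hs, ht, _root_.map_add, smul_add]
  have key := congrArg ht.lift (sum_tmul_tmul_eq (R := ℂ) (ℛ ℂ x)
    (fun i => ℛ ℂ ((ℛ ℂ x).left i)) (fun i => ℛ ℂ ((ℛ ℂ x).right i)))
  simpa [sw] using key

theorem sw_mul {f : A → A → M} (x y : A) (hl : ∀ b, IsLin (fun a => f a b) := by fun_prop)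
    (hr : ∀ a, IsLin (fun b => f a b) := by fun_prop) :
    sw f (x * y) = sw (fun a b => sw (fun c d => f (a * c) (b * d)) y) x := by
  rw [sw_eq_lift ⟨hl, hr⟩, Bialgebra.comul_mul, ← (ℛ ℂ x).eq, ← (ℛ ℂ y).eq]
  simp [sw, Finset.sum_mul_sum]

theorem sw_one {f : A → A → M} (hl : ∀ b, IsLin (fun a => f a b) := by fun_prop)
    (hr : ∀ a, IsLin (fun b => f a b) := by fun_prop) :
    sw f 1 = f 1 1 := by
  rw [sw_eq_lift ⟨hl, hr⟩, Bialgebra.comul_one, Algebra.TensorProduct.one_def]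
  simp

theorem sw_groupLike {f : A → A → M} {g : A} (hg : IsGroupLikeElem ℂ g)
    (hl : ∀ b, IsLin (fun a => f a b) := by fun_prop)
    (hr : ∀ a, IsLin (fun b => f a b) := by fun_prop) :
    sw f g = f g g := by
  rw [sw_eq_lift ⟨hl, hr⟩, hg.comul_eq_tmul_self]
  simp

/-- The antipode. -/
noncomputable abbrev S : A →ₗ[ℂ] A := antipode ℂ

theorem sw_antipode_left {f : A → M} (x : A) (hf : IsLin f := by fun_prop) :
    sw (fun a b => f (S a * b)) x = counit (R := ℂ) x • f 1 := by
  rw [← map_sw (fun a b => S a * b) x hf, sw, sum_antipode_mul_eq_smul, hf.map_smul]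

theorem sw_antipode_right {f : A → M} (x : A) (hf : IsLin f := by fun_prop) :
    sw (fun a b => f (a * S b)) x = counit (R := ℂ) x • f 1 := by
  rw [← map_sw (fun a b => a * S b) x hf, sw, sum_mul_antipode_eq_smul, hf.map_smul]

theorem sw_antipode_comul (x : A) :
    sw (fun c d => sw (fun u v => sw (fun s t => (S v * s) ⊗ₜ[ℂ] (S u * t)) d) c) x =
      counit (R := ℂ) x • ((1 : A) ⊗ₜ[ℂ] (1 : A)) := by
  rw [sw_coassoc (T := fun u v d => sw (fun s t => (S v * s) ⊗ₜ[ℂ] (S u * t)) d)]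
  rw [← sw_antipode_left (f := fun y => (1 : A) ⊗ₜ[ℂ] y)]
  refine sw_congr (fun u w => ?_) x
  rw [← sw_coassoc (T := fun v s t => (S v * s) ⊗ₜ[ℂ] (S u * t))]
  rw [sw_congr (fun y t => sw_antipode_left (f := fun z => z ⊗ₜ[ℂ] (S u * t)) y),
    sw_counit_left (f := fun t => (1 : A) ⊗ₜ[ℂ] (S u * t))]

theorem comul_S (x : A) : comul (R := ℂ) (S x) = sw (fun a b => S b ⊗ₜ[ℂ] S a) x := by
  have key := sw_coassoc (T := fun a b c => (sw (fun u v => S v ⊗ₜ[ℂ] S u) a : A ⊗[ℂ] A) *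
    (comul (R := ℂ) b * comul (R := ℂ) (S c))) x
  have h1 : ∀ a b : A, sw (fun c d => (sw (fun u v => S v ⊗ₜ[ℂ] S u) c : A ⊗[ℂ] A) *
      (comul (R := ℂ) d * comul (R := ℂ) (S b))) a = counit (R := ℂ) a • comul (R := ℂ) (S b) := by
    intro a b
    have := congrArg (fun t => t * comul (R := ℂ) (S b)) (sw_antipode_comul a)
    simp only [← Algebra.TensorProduct.one_def, smul_mul_assoc, one_mul] at this
    rw [← this, map_sw (L := fun t : A ⊗[ℂ] A => t * comul (R := ℂ) (S b))]
    refine sw_congr (fun c d => ?_) a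
    rw [← mul_assoc, comul_eq_sw d, map_sw (L := fun t : A ⊗[ℂ] A => t * _) _ c]
    congr 1
    refine sw_congr (fun u v => ?_) c
    rw [map_sw (L := fun t : A ⊗[ℂ] A => _ * t)]
    simp
  have h2 : ∀ a b : A, sw (fun c d => (sw (fun u v => S v ⊗ₜ[ℂ] S u) a : A ⊗[ℂ] A) *
      (comul (R := ℂ) c * comul (R := ℂ) (S d))) b =
      counit (R := ℂ) b • (sw (fun u v => S v ⊗ₜ[ℂ] S u) a : A ⊗[ℂ] A) := by
    intro a b
    simp_rw [← Bialgebra.comul_mul]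
    rw [sw_antipode_right (f := fun y => _ * comul (R := ℂ) y), Bialgebra.comul_one, mul_one]
  rw [sw_congr (fun a b => h1 a b), sw_congr (fun a b => h2 a b),
    sw_counit_left (f := fun b => comul (R := ℂ) (S b)),
    sw_counit_right (f := fun a => (sw (fun u v => S v ⊗ₜ[ℂ] S u) a : A ⊗[ℂ] A))] at key
  exact key

theorem sw_S {f : A → A → M} (x : A) (hl : ∀ b, IsLin (fun a => f a b) := by fun_prop)
    (hr : ∀ a, IsLin (fun b => f a b) := by fun_prop) :
    sw f (S x) = sw (fun a b => f (S b) (S a)) x := by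
  rw [sw_eq_lift ⟨hl, hr⟩, comul_S, map_sw (L := (IsBilin.mk hl hr).lift)]
  simp

theorem S_mul (x y : A) : S (x * y) = S y * S x := antipode_mul_antidistrib x y

theorem S_one : S (1 : A) = 1 := antipode_one

theorem counit_S (x : A) : counit (R := ℂ) (S x) = counit (R := ℂ) x := counit_antipode ..

end Sweedler

end

/-! ### Basic identities -/

section

section Integrals

variable {A M : Type*} [Ring A] [HopfAlgebra ℂ A] [AddCommGroup M] [Module ℂ M]

/-- The counit. -/
noncomputable abbrev ε : A →ₐ[ℂ] ℂ := Bialgebra.counitAlgHom ℂ A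

theorem sw_counit_left' {f : A → M} (x : A) (hf : IsLin f := by fun_prop) :
    sw (fun a b => (ε a : ℂ) • f b) x = f x := sw_counit_left x hf

theorem sw_counit_right' {f : A → M} (x : A) (hf : IsLin f := by fun_prop) :
    sw (fun a b => (ε b : ℂ) • f a) x = f x := sw_counit_right x hf

theorem sw_antipode_left' {f : A → M} (x : A) (hf : IsLin f := by fun_prop) :
    sw (fun a b => f (S a * b)) x = (ε x : ℂ) • f 1 := sw_antipode_left x hf

theorem sw_antipode_right' {f : A → M} (x : A) (hf : IsLin f := by fun_prop) :
    sw (fun a b => f (a * S b)) x = (ε x : ℂ) • f 1 := sw_antipode_right x hf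

theorem ε_S (x : A) : (ε (S x) : ℂ) = ε x := counit_S x

section Existence

variable {ι : Type*} [Fintype ι] (b : Module.Basis ι ℂ A)

theorem sum_dual_basis {f : A → M} (hf : IsLin f) (x : A) : ∑ i, b.coord i x • f (b i) = f x := by
  conv_rhs => rw [← b.sum_repr x, hf.map_sum]
  simp [hf.map_smul]

/-- Candidates for left integrals. -/
noncomputable def preIntegral (x : A) : A :=
  ∑ i, sw (fun a c => b.coord i (S (S c) * x) • a) (b i)

theorem mul_preIntegral (h x : A) :
    h * preIntegral b x = (ε h : ℂ) • preIntegral b x := by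
  classical
  have hcoev : ∀ (T : A →ₗ[ℂ] A) (u : A), ∑ i, sw (fun a c => b.coord i (T (S (S c) * x)) • a) (u * b i)
      = ∑ i, sw (fun a c => b.coord i (S (S c) * x) • a) (u * T (b i)) := by
    intro T u
    have h1 : ∀ i, T (b i) = ∑ j, b.coord j (T (b i)) • b j := fun i => (b.sum_repr _).symm
    have h2 : ∀ i y, b.coord i (T y) = ∑ j, b.coord i (T (b j)) * b.coord j y := by
      intro i y
      rw [← sum_dual_basis b (f := fun y => b.coord i (T y)) (by fun_prop) y]
      simp [mul_comm]
    have h3 : ∀ i, sw (fun a c => b.coord i (S (S c) * x) • a) (u * T (b i)) =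
        ∑ j, b.coord j (T (b i)) • sw (fun a c => b.coord i (S (S c) * x) • a) (u * b j) := by
      intro i
      rw [h1 i, Finset.mul_sum, IsLin.map_sum (f := fun y =>
        sw (fun a c => b.coord i (S (S c) * x) • a) y) (by fun_prop)]
      refine Finset.sum_congr rfl fun j _ => ?_
      rw [mul_smul_comm, IsLin.map_smul (f := fun y =>
        sw (fun a c => b.coord i (S (S c) * x) • a) y) (by fun_prop)]
      simp
    simp_rw [h3]
    rw [Finset.sum_comm]
    refine Finset.sum_congr rfl fun i _ => ?_
    simp_rw [sw_smul]
    simp only [sw]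
    rw [Finset.sum_comm]
    refine Finset.sum_congr rfl fun j _ => ?_
    rw [h2, Finset.sum_smul]
    simp [mul_smul]
  have e1 : sw (fun u v => ∑ i, sw (fun a c => b.coord i (S v * (S (S c) * x)) • a) (u * b i)) h =
      (ε h : ℂ) • preIntegral b x := by
    have : ∀ u v : A, ∑ i, sw (fun a c => b.coord i (S v * (S (S c) * x)) • a) (u * b i) =
        ∑ i, sw (fun a c => b.coord i (S (S c) * x) • a) ((u * S v) * b i) := by
      intro u v
      have := hcoev (LinearMap.mulLeft ℂ (S v)) u
      simpa [mul_assoc] using this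
    rw [sw_congr this]
    rw [sw_antipode_right' (f := fun y => ∑ i, sw (fun a c => b.coord i (S (S c) * x) • a) (y * b i))]
    simp [preIntegral]
  rw [← e1]
  have e2 : ∀ u v : A, ∑ i, sw (fun a c => b.coord i (S v * (S (S c) * x)) • a) (u * b i) =
      sw (fun s t => ∑ i, sw (fun a c => b.coord i (S (S t * v) * (S (S c) * x)) • (s * a)) (b i)) u := by
    intro u v
    rw [← sum_sw]
    refine Finset.sum_congr rfl fun i _ => ?_
    rw [sw_mul]
    refine sw_congr (fun s t => sw_congr (fun a c => ?_) _) _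
    simp [S_mul, mul_assoc]
  rw [sw_congr e2]
  rw [sw_coassoc (T := fun s t v => ∑ i, sw (fun a c => b.coord i (S (S t * v) * (S (S c) * x)) • (s * a)) (b i))]
  have e3 : ∀ s w : A, sw (fun t v => ∑ i, sw (fun a c => b.coord i (S (S t * v) * (S (S c) * x)) • (s * a)) (b i)) w
    = (ε w : ℂ) • (s * preIntegral b x) := by
    intro s w
    rw [sw_antipode_left' (f := fun y => ∑ i, sw (fun a c => b.coord i (S y * (S (S c) * x)) • (s * a)) (b i))]
    congr 1
    rw [preIntegral, Finset.mul_sum]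
    refine Finset.sum_congr rfl fun i _ => ?_
    rw [map_sw (L := fun y : A => s * y)]
    simp
  rw [sw_congr e3, sw_counit_right' (f := fun s => s * preIntegral b x)]

theorem exists_preIntegral_ne_zero [Nontrivial A] : ∃ x, preIntegral b x ≠ 0 := by
  classical
  by_contra! hz
  have key : ∀ x : A, ∑ k, sw (fun a c => b.coord k (S c * x) • a) (preIntegral b (b k)) = x := by
    intro x
    have h1 : ∀ k, sw (fun a c => b.coord k (S c * x) • a) (preIntegral b (b k)) =
        ∑ i, sw (fun a d => sw (fun u v => (b.coord i (S (S d) * b k) * b.coord k (S v * x)) • u) a) (b i) := by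
      intro k
      rw [preIntegral, IsLin.map_sum (f := fun y =>
        sw (fun a c => b.coord k (S c * x) • a) y) (by fun_prop)]
      refine Finset.sum_congr rfl fun i _ => ?_
      rw [map_sw (L := fun y => sw (fun a c => b.coord k (S c * x) • a) y)]
      refine sw_congr (fun a d => ?_) _
      rw [IsLin.map_smul (f := fun y => sw (fun a c => b.coord k (S c * x) • a) y) (by fun_prop),
        sw_smul]
      simp [mul_smul]
    simp_rw [h1]
    rw [Finset.sum_comm]
    have h2 : ∀ i, ∑ k, sw (fun a d => sw (fun u v => (b.coord i (S (S d) * b k) * b.coord k (S v * x)) • u) a) (b i)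
        = b.coord i x • b i := by
      intro i
      have : ∑ k, sw (fun a d => sw (fun u v => (b.coord i (S (S d) * b k) * b.coord k (S v * x)) • u) a) (b i)
          = sw (fun a d => sw (fun u v => b.coord i (S (v * S d) * x) • u) a) (b i) := by
        rw [sum_sw]
        refine sw_congr (fun a d => ?_) _
        rw [sum_sw]
        refine sw_congr (fun u v => ?_) _
        rw [← Finset.sum_smul]
        congr 1
        rw [S_mul, mul_assoc, ← sum_dual_basis b (f := fun y => b.coord i (S (S _) * y)) (by fun_prop) (_ * x)]
        simp [mul_comm]
      rw [this, sw_coassoc (T := fun u v d => b.coord i (S (v * S d) * x) • u)]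
      have h3 : ∀ u w : A, sw (fun v d => b.coord i (S (v * S d) * x) • u) w =
          (ε w : ℂ) • (b.coord i x • u) := by
        intro u w
        rw [sw_antipode_right' (f := fun y => b.coord i (S y * x) • u)]
        simp
      rw [sw_congr h3, sw_counit_right' (f := fun u => b.coord i x • u)]
    simp_rw [h2]
    exact b.sum_repr x
  have h0 : ∀ k, sw (fun a c => b.coord k (S c * (1 : A)) • a) (preIntegral b (b k)) = 0 := by
    intro k
    rw [hz]
    exact IsLin.map_zero (f := fun y => sw (fun a c => b.coord k (S c * (1 : A)) • a) y) (by fun_prop)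
  have := key 1
  simp only [h0] at this
  simp at this

end Existence

end Integrals

end

/-! ### Integrals and Frobenius structures -/

section

section Frobenius

variable {A M : Type*} [Ring A] [HopfAlgebra ℂ A] [AddCommGroup M] [Module ℂ M]

theorem exists_leftIntegral (A : Type*) [Ring A] [HopfAlgebra ℂ A] [Module.Finite ℂ A]
    [Nontrivial A] : ∃ Λ : A, Λ ≠ 0 ∧ ∀ h, h * Λ = (ε h : ℂ) • Λ := by
  obtain ⟨x, hx⟩ := exists_preIntegral_ne_zero (Module.finBasis ℂ A)
  exact ⟨_, hx, fun h => mul_preIntegral _ h x⟩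

theorem sw_S_mul_leftIntegral {Λ : A} (hΛ : ∀ h, h * Λ = (ε h : ℂ) • Λ) {f : A → A → M} (h : A)
    (hl : ∀ b, IsLin (fun a => f a b) := by fun_prop)
    (hr : ∀ a, IsLin (fun b => f a b) := by fun_prop) :
    sw (fun a b => f (S h * a) b) Λ = sw (fun a b => f a (h * b)) Λ := by
  have e1 : sw (fun u v => sw (fun a b => f (S u * a) b) (v * Λ)) h =
      sw (fun a b => f (S h * a) b) Λ := by
    simp_rw [hΛ]
    rw [← sw_counit_right' (f := fun u => sw (fun a b => f (S u * a) b) Λ)]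
    refine sw_congr (fun u v => ?_) _
    rw [IsLin.map_smul (f := fun y => sw (fun a b => f (S u * a) b) y) (by fun_prop)]
  rw [← e1]
  have e2 : ∀ u v, sw (fun a b => f (S u * a) b) (v * Λ) =
      sw (fun s t => sw (fun a b => f (S u * s * a) (t * b)) Λ) v := by
    intro u v
    rw [sw_mul]
    simp only [mul_assoc]
  rw [sw_congr e2, ← sw_coassoc (T := fun u s t => sw (fun a b => f (S u * s * a) (t * b)) Λ)]
  rw [← sw_counit_left' (f := fun t => sw (fun a b => f a (t * b)) Λ)]
  refine sw_congr (fun y t => ?_) _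
  rw [sw_antipode_left' (f := fun z => sw (fun a b => f (z * a) (t * b)) Λ)]
  simp

theorem sw_leftIntegral_surjective [Module.Finite ℂ A] {Λ : A} (h0 : Λ ≠ 0)
    (hΛ : ∀ h, h * Λ = (ε h : ℂ) • Λ) (x : A) :
    ∃ f : A →ₗ[ℂ] ℂ, sw (fun a b => f a • b) Λ = x := by
  let b := Module.finBasis ℂ A
  have hmul : ∀ (f : A →ₗ[ℂ] ℂ) (h : A),
      h * sw (fun a b => f a • b) Λ = sw (fun a b => (f ∘ₗ LinearMap.mulLeft ℂ (S h)) a • b) Λ := by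
    intro f h
    rw [map_sw (L := fun y : A => h * y)]
    have := sw_S_mul_leftIntegral hΛ (f := fun a b => f a • b) h
    simpa using this.symm
  have hadd : ∀ (s : Finset (Fin (Module.finrank ℂ A))) (F : Fin (Module.finrank ℂ A) → A →ₗ[ℂ] ℂ),
      sw (fun a c => (∑ i ∈ s, F i) a • c) Λ = ∑ i ∈ s, sw (fun a c => F i a • c) Λ := by
    intro s F
    rw [sum_sw]
    simp [Finset.sum_smul]
  obtain ⟨f, hf⟩ := Module.Projective.exists_dual_eq_one ℂ h0
  have hone : ∃ f : A →ₗ[ℂ] ℂ, sw (fun a b => f a • b) Λ = 1 := by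
    let G : A →ₗ[ℂ] A := IsLin.mk' (f := fun y : A => sw (fun a c => f a • c) y) (by fun_prop)
    refine ⟨∑ i, ((b.coord i) ∘ₗ G) ∘ₗ LinearMap.mulLeft ℂ (S (S (b i))), ?_⟩
    rw [hadd]
    simp_rw [← hmul]
    have e1 : ∑ i, S (b i) * sw (fun a c => (b.coord i ∘ₗ G) a • c) Λ =
        sw (fun y c => S (G y) * c) Λ := by
      have : ∀ i, S (b i) * sw (fun a c => (b.coord i ∘ₗ G) a • c) Λ =
          sw (fun a c => S ((b.coord i (G a)) • b i) * c) Λ := by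
        intro i
        rw [map_sw (L := fun y : A => S (b i) * y)]
        simp
      simp_rw [this]
      rw [sum_sw]
      refine sw_congr (fun a c => ?_) _
      rw [← Finset.sum_mul, ← map_sum]
      congr 2
      exact b.sum_repr _
    rw [e1]
    have e2 : ∀ y c : A, S (G y) * c = sw (fun u v => f u • (S v * c)) y := by
      intro y c
      simp only [G, IsLin.mk'_apply]
      rw [map_sw (L := fun z : A => S z * c)]
      simp
    rw [sw_congr e2, sw_coassoc (T := fun u v c => f u • (S v * c))]
    have e3 : ∀ u w : A, sw (fun v c => f u • (S v * c)) w = (ε w : ℂ) • (f u • (1 : A)) :=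
      fun u w => sw_antipode_left' (f := fun z => f u • z) w
    rw [sw_congr e3, sw_counit_right' (f := fun u => f u • (1 : A)), hf, one_smul]
  obtain ⟨f1, hf1⟩ := hone
  exact ⟨_, by rw [← hmul f1 x, hf1, mul_one]⟩

/-- A left integral `Λ` and a functional `lam` with `lam(Λ₁) Λ₂ = 1`. -/
structure Frob (A : Type*) [Ring A] [HopfAlgebra ℂ A] where
  Λ : A
  lam : A →ₗ[ℂ] ℂ
  mul_Λ : ∀ h, h * Λ = (ε h : ℂ) • Λ
  sw_Λ : sw (fun a b => lam a • b) Λ = 1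

theorem nonempty_frob (A : Type*) [Ring A] [HopfAlgebra ℂ A] [Module.Finite ℂ A] [Nontrivial A] :
    Nonempty (Frob A) := by
  obtain ⟨Λ, h0, hΛ⟩ := exists_leftIntegral A
  obtain ⟨f, hf⟩ := sw_leftIntegral_surjective h0 hΛ 1
  exact ⟨⟨Λ, f, hΛ, hf⟩⟩

namespace Frob

variable (F : Frob A)

theorem lam_Λ : F.lam F.Λ = 1 := by
  have := congrArg (ε : A →ₐ[ℂ] ℂ) F.sw_Λ
  rw [map_sw (L := fun y => (ε y : ℂ)), map_one] at this
  rw [← this, ← sw_counit_right' (f := fun a => F.lam a)]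
  refine sw_congr (fun a b => ?_) _
  simp [mul_comm]

theorem sw_lam_S (h : A) : sw (fun a b => F.lam (S h * a) • b) F.Λ = h := by
  rw [sw_S_mul_leftIntegral F.mul_Λ (f := fun a b => F.lam a • b)]
  have := congrArg (fun y => h * y) F.sw_Λ
  rw [map_sw (L := fun y : A => h * y)] at this
  simpa using this

theorem S_injective (F : Frob A) : Function.Injective (S : A →ₗ[ℂ] A) := by
  intro x y h
  rw [← F.sw_lam_S x, h, F.sw_lam_S]

variable [Module.Finite ℂ A]

theorem S_surjective (F : Frob A) : Function.Surjective (S : A →ₗ[ℂ] A) :=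
  LinearMap.injective_iff_surjective.mp F.S_injective

theorem lam_mul_surjective (f : A →ₗ[ℂ] ℂ) : ∃ c, ∀ x, f x = F.lam (c * x) := by
  let Φ : A →ₗ[ℂ] (A →ₗ[ℂ] ℂ) := (LinearMap.mul ℂ A).compr₂ F.lam ∘ₗ S
  have hi : Function.Injective Φ := by
    intro x y h
    rw [← F.sw_lam_S x, ← F.sw_lam_S y]
    refine sw_congr (fun a b => ?_) _
    have := LinearMap.congr_fun h a
    simp only [Φ, LinearMap.comp_apply, LinearMap.compr₂_apply, LinearMap.mul_apply'] at this
    rw [this]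
  have hs := (LinearMap.injective_iff_surjective_of_finrank_eq_finrank
    (Subspace.dual_finrank_eq (K := ℂ) (V := A)).symm).mp hi
  obtain ⟨c, hc⟩ := hs f
  exact ⟨S c, fun x => by rw [← hc]; rfl⟩

theorem eq_zero_of_lam_mul_left (F : Frob A) {z : A} (h : ∀ c, F.lam (c * z) = 0) : z = 0 := by
  rw [← Module.forall_dual_apply_eq_zero_iff ℂ]
  intro f
  obtain ⟨c, hc⟩ := F.lam_mul_surjective f
  rw [hc, h]

theorem lam_mul_surjective' (f : A →ₗ[ℂ] ℂ) : ∃ c, ∀ x, f x = F.lam (x * c) := by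
  let Φ : A →ₗ[ℂ] (A →ₗ[ℂ] ℂ) := (LinearMap.mul ℂ A).flip.compr₂ F.lam
  have hi : Function.Injective Φ := by
    rw [← LinearMap.ker_eq_bot, LinearMap.ker_eq_bot']
    intro z hz
    exact F.eq_zero_of_lam_mul_left fun c => LinearMap.congr_fun hz c
  have hs := (LinearMap.injective_iff_surjective_of_finrank_eq_finrank
    (Subspace.dual_finrank_eq (K := ℂ) (V := A)).symm).mp hi
  obtain ⟨c, hc⟩ := hs f
  exact ⟨c, fun x => by rw [← hc]; rfl⟩

theorem leftIntegral_eq {y : A} (hy : ∀ h, h * y = (ε h : ℂ) • y) : y = F.lam y • F.Λ := by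
  rw [← sub_eq_zero]
  refine F.eq_zero_of_lam_mul_left fun c => ?_
  rw [mul_sub, hy, mul_smul_comm, F.mul_Λ]
  simp [F.lam_Λ, mul_comm]

theorem phi_injective {f f' : A →ₗ[ℂ] ℂ}
    (h : sw (fun a b => f a • b) F.Λ = sw (fun a b => f' a • b) F.Λ) : f = f' := by
  have h0 : F.Λ ≠ 0 := fun h => by simpa [h] using F.lam_Λ
  let Φ : (A →ₗ[ℂ] ℂ) →ₗ[ℂ] A :=
    IsLin.mk' (f := fun f : A →ₗ[ℂ] ℂ => sw (fun a b => f a • b) F.Λ)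
      ⟨fun f g => by simp [sw, add_smul, Finset.sum_add_distrib],
        fun c f => by simp [sw, mul_smul, Finset.smul_sum]⟩
  have hs : Function.Surjective Φ := fun x => sw_leftIntegral_surjective h0 F.mul_Λ x
  exact (LinearMap.injective_iff_surjective_of_finrank_eq_finrank
    (Subspace.dual_finrank_eq (K := ℂ) (V := A))).mpr hs h

/-- `lam` is a right integral in the dual. -/
theorem sw_lam (x : A) : sw (fun a b => F.lam a • b) x = F.lam x • (1 : A) := by
  rw [← sub_eq_zero, ← Module.forall_dual_apply_eq_zero_iff ℂ]
  intro f
  rw [map_sub, sub_eq_zero, map_sw (L := fun y => f y)]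
  let f1 : A →ₗ[ℂ] ℂ := IsLin.mk' (f := fun x : A => sw (fun a b => F.lam a • f b) x) (by fun_prop)
  have : f1 = f 1 • F.lam := by
    apply F.phi_injective
    have e : ∀ a b : A, f1 a • b = sw (fun u v => F.lam u • (f v • b)) a := by
      intro a b
      simp only [f1, IsLin.mk'_apply, sw_smul_const, smul_eq_mul, mul_smul]
    rw [sw_congr e, sw_coassoc (T := fun u v b => F.lam u • (f v • b))]
    have e2 : ∀ u w : A, sw (fun v b => F.lam u • (f v • b)) w = sw (fun v b => f v • b) (F.lam u • w) := by
      intro u w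
      rw [← sw_smul, IsLin.map_smul (f := fun w => sw (fun v b => f v • b) w) (by fun_prop)]
    rw [sw_congr e2, ← map_sw (L := fun w => sw (fun v b => f v • b) w), F.sw_Λ, sw_one]
    simp only [LinearMap.smul_apply, smul_eq_mul, mul_smul]
    rw [← sw_smul, F.sw_Λ]
  have := LinearMap.congr_fun this x
  simp only [f1, IsLin.mk'_apply] at this
  simpa [mul_comm] using this

theorem rightIntegral_eq {f : A →ₗ[ℂ] ℂ} (hf : ∀ x, sw (fun a b => f a • b) x = f x • (1 : A)) :
    f = f F.Λ • F.lam := by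
  apply F.phi_injective
  rw [hf]
  simp only [LinearMap.smul_apply, smul_eq_mul, mul_smul]
  rw [← sw_smul, F.sw_Λ]

end Frob
end Frobenius

end

/-! ### One-dimensional representations -/

section

section Radford

variable {A M : Type*} [Ring A] [HopfAlgebra ℂ A] [AddCommGroup M] [Module ℂ M]

/-- Right translation `x ↦ x₁ χ(x₂)` by a character. -/
noncomputable def tau (χ : A →ₐ[ℂ] ℂ) : A →ₐ[ℂ] A :=
  AlgHom.ofLinearMap (IsLin.mk' (f := fun x : A => sw (fun a b => χ b • a) x) (by fun_prop))
    (by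
      simp only [IsLin.mk'_apply]
      rw [sw_one (f := fun a b : A => χ b • a)]; simp)
    (by
      intro x y
      simp only [IsLin.mk'_apply]
      rw [sw_mul (f := fun a b : A => χ b • a), map_sw (L := fun z : A => z * _)]
      refine sw_congr (fun a b => ?_) _
      rw [map_sw (L := fun z : A => _ * z)]
      refine sw_congr (fun c d => ?_) _
      simp [smul_smul, mul_comm])

/-- Left translation `x ↦ χ(x₁) x₂` by a character. -/
noncomputable def ell (χ : A →ₐ[ℂ] ℂ) : A →ₐ[ℂ] A :=
  AlgHom.ofLinearMap (IsLin.mk' (f := fun x : A => sw (fun a b => χ a • b) x) (by fun_prop))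
    (by
      simp only [IsLin.mk'_apply]
      rw [sw_one (f := fun a b : A => χ a • b)]; simp)
    (by
      intro x y
      simp only [IsLin.mk'_apply]
      rw [sw_mul (f := fun a b : A => χ a • b), map_sw (L := fun z : A => z * _)]
      refine sw_congr (fun a b => ?_) _
      rw [map_sw (L := fun z : A => _ * z)]
      refine sw_congr (fun c d => ?_) _
      simp [smul_smul, mul_comm])

theorem tau_apply (χ : A →ₐ[ℂ] ℂ) (x : A) : tau χ x = sw (fun a b => χ b • a) x := rfl

theorem ell_apply (χ : A →ₐ[ℂ] ℂ) (x : A) : ell χ x = sw (fun a b => χ a • b) x := rfl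

/-- The convolution inverse of a character. -/
noncomputable def charInv (χ : A →ₐ[ℂ] ℂ) : A →ₐ[ℂ] ℂ :=
  AlgHom.ofLinearMap (χ.toLinearMap ∘ₗ S) (by simp)
    (fun x y => by simp [S_mul, mul_comm])

theorem charInv_apply (χ : A →ₐ[ℂ] ℂ) (x : A) : charInv χ x = χ (S x) := rfl

theorem sw_charInv_left (χ : A →ₐ[ℂ] ℂ) (m : M) (x : A) :
    sw (fun a b => charInv χ a • χ b • m) x = (ε x : ℂ) • m := by
  have := sw_antipode_left' (f := fun z : A => χ z • m) x
  rw [map_one, one_smul] at this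
  rw [← this]
  exact sw_congr (fun a b => by rw [map_mul, smul_smul, charInv_apply]) x

theorem sw_charInv_right (χ : A →ₐ[ℂ] ℂ) (m : M) (x : A) :
    sw (fun a b => χ a • charInv χ b • m) x = (ε x : ℂ) • m := by
  have := sw_antipode_right' (f := fun z : A => χ z • m) x
  rw [map_one, one_smul] at this
  rw [← this]
  exact sw_congr (fun a b => by rw [map_mul, smul_smul, charInv_apply]) x

theorem char_S_S (χ : A →ₐ[ℂ] ℂ) (x : A) : χ (S (S x)) = χ x := by
  have key := sw_coassoc (T := fun a b c : A => charInv (charInv χ) a • charInv χ b • χ c) x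
  have h2 : ∀ a w : A, sw (fun b c => charInv (charInv χ) a • charInv χ b • χ c) w =
      (ε w : ℂ) • charInv (charInv χ) a := by
    intro a w
    rw [← sw_charInv_left χ]
    exact sw_congr (fun b c => by simp only [smul_eq_mul]; ring) w
  rw [sw_congr fun a b => sw_charInv_left _ _ _, sw_counit_left' (f := fun b => χ b),
    sw_congr h2, sw_counit_right' (f := fun z => charInv (charInv χ) z) x] at key
  exact key.symm

theorem charInv_charInv (χ : A →ₐ[ℂ] ℂ) : charInv (charInv χ) = χ :=
  AlgHom.ext fun x => char_S_S χ x

theorem tau_tau_charInv (χ : A →ₐ[ℂ] ℂ) (x : A) : tau χ (tau (charInv χ) x) = x := by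
  rw [tau_apply (charInv χ), map_sw (L := fun y => tau χ y)]
  have : ∀ a b : A, tau χ (charInv χ b • a) = sw (fun u v => χ v • charInv χ b • u) a := by
    intro a b
    rw [map_smul, tau_apply, sw_smul]
    exact sw_congr (fun u v => smul_comm _ _ _) _
  rw [sw_congr this, sw_coassoc (T := fun u v b => χ v • charInv χ b • u),
    sw_congr fun u w => sw_charInv_right χ u w, sw_counit_right' (f := fun u => u)]

theorem tau_charInv_tau (χ : A →ₐ[ℂ] ℂ) (x : A) : tau (charInv χ) (tau χ x) = x := by
  simpa [charInv_charInv] using tau_tau_charInv (charInv χ) x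

theorem ell_ell_charInv (χ : A →ₐ[ℂ] ℂ) (x : A) : ell χ (ell (charInv χ) x) = x := by
  rw [ell_apply (charInv χ), map_sw (L := fun y => ell χ y)]
  have : ∀ a b : A, ell χ (charInv χ a • b) = sw (fun u v => charInv χ a • χ u • v) b := by
    intro a b
    rw [map_smul, ell_apply, sw_smul]
  rw [sw_congr this, ← sw_coassoc (T := fun u v b => charInv χ u • χ v • b),
    sw_congr fun u w => sw_charInv_left χ w u, sw_counit_left' (f := fun u => u)]

theorem ell_charInv_ell (χ : A →ₐ[ℂ] ℂ) (x : A) : ell (charInv χ) (ell χ x) = x := by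
  simpa [charInv_charInv] using ell_ell_charInv (charInv χ) x

theorem tau_ell (χ ψ : A →ₐ[ℂ] ℂ) (x : A) : tau χ (ell ψ x) = ell ψ (tau χ x) := by
  rw [tau_apply χ x, ell_apply ψ x, map_sw (L := fun y => tau χ y), map_sw (L := fun y => ell ψ y)]
  have h1 : ∀ a b : A, tau χ (ψ a • b) = sw (fun u v => ψ a • χ v • u) b := by
    intro a b
    rw [map_smul, tau_apply, sw_smul]
  have h2 : ∀ a b : A, ell ψ (χ b • a) = sw (fun u v => ψ u • χ b • v) a := by
    intro a b
    rw [map_smul, ell_apply, sw_smul]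
    exact sw_congr (fun u v => smul_comm _ _ _) _
  rw [sw_congr h1, sw_congr h2, sw_coassoc (T := fun u v b => ψ u • χ b • v)]

theorem tau_S_S (χ : A →ₐ[ℂ] ℂ) (x : A) : tau χ (S (S x)) = S (S (tau χ x)) := by
  rw [tau_apply, sw_S, sw_S, tau_apply, map_sw (L := fun y : A => S (S y))]
  exact sw_congr (fun a b => by rw [map_smul, map_smul, char_S_S]) x

theorem ell_S_S (χ : A →ₐ[ℂ] ℂ) (x : A) : ell χ (S (S x)) = S (S (ell χ x)) := by
  rw [ell_apply, sw_S, sw_S, ell_apply, map_sw (L := fun y : A => S (S y))]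
  exact sw_congr (fun a b => by rw [map_smul, map_smul, char_S_S]) x

theorem ε_tau (χ : A →ₐ[ℂ] ℂ) (x : A) : (ε (tau χ x) : ℂ) = χ x := by
  rw [tau_apply, map_sw (L := fun y => (ε y : ℂ)), ← sw_counit_left' (f := fun y => χ y)]
  exact sw_congr (fun a b => by simp [mul_comm]) x

theorem ε_ell (χ : A →ₐ[ℂ] ℂ) (x : A) : (ε (ell χ x) : ℂ) = χ x := by
  rw [ell_apply, map_sw (L := fun y => (ε y : ℂ)), ← sw_counit_right' (f := fun y => χ y)]
  exact sw_congr (fun a b => by simp [mul_comm]) x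

theorem tau_groupLike (χ : A →ₐ[ℂ] ℂ) {g : A} (hg : IsGroupLikeElem ℂ g) :
    tau χ g = χ g • g := by
  rw [tau_apply, sw_groupLike hg]

theorem ell_groupLike (χ : A →ₐ[ℂ] ℂ) {g : A} (hg : IsGroupLikeElem ℂ g) :
    ell χ g = χ g • g := by
  rw [ell_apply, sw_groupLike hg]

namespace Frob

variable (F : Frob A)

theorem lam_rightIntegral_left [Module.Finite ℂ A] (x : A) :
    sw (fun a b => F.lam b • a) x = F.lam x • sw (fun a b => F.lam b • a) F.Λ := by
  rw [← sub_eq_zero, ← Module.forall_dual_apply_eq_zero_iff ℂ]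
  intro f
  rw [map_sub, sub_eq_zero]
  let f1 : A →ₗ[ℂ] ℂ :=
    IsLin.mk' (f := fun x : A => f (sw (fun a b => F.lam b • a) x)) (by fun_prop)
  have : f1 = f1 F.Λ • F.lam := by
    apply F.rightIntegral_eq
    intro x
    have e : ∀ y b : A, f1 y • b = sw (fun u v => F.lam v • f u • b) y := by
      intro y b
      simp only [f1, IsLin.mk'_apply]
      rw [map_sw (L := fun y => f y), sw_smul_const]
      exact sw_congr (fun u v => by simp [mul_smul]) _
    rw [sw_congr e, sw_coassoc (T := fun u v b => F.lam v • f u • b)]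
    have e2 : ∀ u w : A, sw (fun v b => F.lam v • f u • b) w = F.lam w • f u • (1 : A) := by
      intro u w
      rw [smul_comm, ← F.sw_lam, sw_smul]
      exact sw_congr (fun _ _ => smul_comm _ _ _) _
    rw [sw_congr e2]
    simp only [f1, IsLin.mk'_apply]
    rw [map_sw (L := fun y => f y), sw_smul_const]
    exact sw_congr (fun u v => by simp [mul_smul]) _
  have := LinearMap.congr_fun this x
  simp only [f1, IsLin.mk'_apply, LinearMap.smul_apply, smul_eq_mul] at this
  rw [this, map_smul, smul_eq_mul, mul_comm]

/-- The distinguished grouplike element. -/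
noncomputable def g : A := sw (fun a b => F.lam b • a) F.Λ

variable [Module.Finite ℂ A]

theorem sw_lam_right (x : A) : sw (fun a b => F.lam b • a) x = F.lam x • F.g :=
  F.lam_rightIntegral_left x

theorem isGroupLikeElem_g : IsGroupLikeElem ℂ F.g where
  counit_eq_one := by
    have := F.lam_Λ
    rw [← sw_counit_left' (f := fun y => F.lam y)] at this
    rw [g, map_sw (L := fun y => counit (R := ℂ) y), ← this]
    exact sw_congr (fun a b => by simp [mul_comm]) _
  comul_eq_tmul_self := by
    rw [comul_eq_sw]
    conv_lhs => rw [g]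
    rw [map_sw (L := fun y => sw (fun a b => a ⊗ₜ[ℂ] b) y)]
    have e : ∀ y b : A, sw (fun c d => c ⊗ₜ[ℂ] d) (F.lam b • y) =
        sw (fun c d => F.lam b • (c ⊗ₜ[ℂ] d)) y := by
      intro y b
      rw [IsLin.map_smul (f := fun y => sw (fun c d => c ⊗ₜ[ℂ] d) y) (by fun_prop), sw_smul]
    rw [sw_congr e, sw_coassoc (T := fun c d b => F.lam b • (c ⊗ₜ[ℂ] d))]
    have e2 : ∀ u w : A, sw (fun d b => F.lam b • (u ⊗ₜ[ℂ] d)) w = (F.lam w • u) ⊗ₜ[ℂ] F.g := by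
      intro u w
      rw [TensorProduct.smul_tmul, ← F.sw_lam_right, map_sw (L := fun y => u ⊗ₜ[ℂ] y)]
      simp
    rw [sw_congr e2, ← map_sw (L := fun y => y ⊗ₜ[ℂ] F.g)]
    rfl

theorem Λ_mul (h : A) : F.Λ * h = F.lam (F.Λ * h) • F.Λ :=
  F.leftIntegral_eq fun k => by rw [← mul_assoc, F.mul_Λ, smul_mul_assoc]

/-- The distinguished character. -/
noncomputable def α : A →ₐ[ℂ] ℂ :=
  AlgHom.ofLinearMap (F.lam ∘ₗ LinearMap.mulLeft ℂ F.Λ) (by simp [F.lam_Λ])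
    (fun x y => by
      simp only [LinearMap.comp_apply, LinearMap.mulLeft_apply]
      rw [← mul_assoc]
      conv_lhs => rw [F.Λ_mul x]
      rw [smul_mul_assoc, map_smul, smul_eq_mul])

theorem Λ_mul_eq (h : A) : F.Λ * h = F.α h • F.Λ := F.Λ_mul h

end Frob

end Radford

end

/-! ### Radford's formula for the fourth power of the antipode -/

section

section GroupLike

variable {A : Type*} [Ring A] [HopfAlgebra ℂ A]

theorem S_mul_groupLike {g : A} (hg : IsGroupLikeElem ℂ g) : S g * g = 1 := by
  have := sw_antipode_left' (f := fun z : A => z) g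
  rwa [sw_groupLike hg, Bialgebra.counitAlgHom_apply, hg.counit_eq_one, one_smul] at this

theorem groupLike_mul_S {g : A} (hg : IsGroupLikeElem ℂ g) : g * S g = 1 := by
  have := sw_antipode_right' (f := fun z : A => z) g
  rwa [sw_groupLike hg, Bialgebra.counitAlgHom_apply, hg.counit_eq_one, one_smul] at this

theorem S_S_groupLike {g : A} (hg : IsGroupLikeElem ℂ g) : S (S g) = g := by
  have h := congrArg S (S_mul_groupLike hg)
  rw [S_mul, S_one] at h
  calc S (S g) = (g * S g) * S (S g) := by rw [groupLike_mul_S hg, one_mul]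
    _ = g := by rw [mul_assoc, h, mul_one]

end GroupLike

section Radford

variable {A : Type*} [Ring A] [HopfAlgebra ℂ A]

namespace Frob

variable (F : Frob A)

variable [Module.Finite ℂ A]

theorem exists_nakayama (a : A) : ∃ c, ∀ b, F.lam (a * b) = F.lam (b * c) := by
  simpa using F.lam_mul_surjective' (F.lam ∘ₗ LinearMap.mulLeft ℂ a)

/-- The Nakayama automorphism of `lam`. -/
noncomputable def nu : A →ₗ[ℂ] A where
  toFun a := (F.exists_nakayama a).choose
  map_add' a b := by
    rw [← sub_eq_zero]
    refine F.eq_zero_of_lam_mul_left fun c => ?_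
    rw [mul_sub, mul_add, map_sub, map_add, ← (F.exists_nakayama a).choose_spec,
      ← (F.exists_nakayama b).choose_spec, ← (F.exists_nakayama (a + b)).choose_spec, add_mul,
      map_add, sub_self]
  map_smul' r a := by
    rw [← sub_eq_zero]
    refine F.eq_zero_of_lam_mul_left fun c => ?_
    rw [mul_sub, map_sub, RingHom.id_apply, mul_smul_comm, map_smul,
      ← (F.exists_nakayama a).choose_spec, ← (F.exists_nakayama (r • a)).choose_spec,
      smul_mul_assoc, map_smul, sub_self]

theorem lam_mul_comm (a b : A) : F.lam (a * b) = F.lam (b * F.nu a) :=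
  (F.exists_nakayama a).choose_spec b

theorem sw_Λ_mul (h : A) :
    sw (fun a b => F.lam (a * h) • b) F.Λ = S (ell F.α h) := by
  have key := sw_coassoc (T := fun u v w : A => sw (fun a b => F.lam (a * u) • (b * v * S w)) F.Λ) h
  have h1 : ∀ u x : A, sw (fun v w => sw (fun a b => F.lam (a * u) • (b * v * S w)) F.Λ) x =
      (ε x : ℂ) • sw (fun a b => F.lam (a * u) • b) F.Λ := by
    intro u x
    have := sw_antipode_right' (f := fun z : A => sw (fun a b => F.lam (a * u) • (b * z)) F.Λ) x
    simp only [mul_one, ← mul_assoc] at this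
    exact this
  have h2 : ∀ x w : A, sw (fun u v => sw (fun a b => F.lam (a * u) • (b * v * S w)) F.Λ) x =
      F.α x • S w := by
    intro x w
    rw [← sw_comm (fun a b u v => F.lam (a * u) • (b * v * S w)),
      ← sw_mul (f := fun a b : A => F.lam a • (b * S w)), F.Λ_mul_eq,
      IsLin.map_smul (f := fun y => sw (fun a b : A => F.lam a • (b * S w)) y) (by fun_prop)]
    congr 1
    have := congrArg (fun z => z * S w) F.sw_Λ
    simp only [one_mul] at this
    rw [map_sw (L := fun z => z * S w)] at this
    simpa using this
  rw [sw_congr h1, sw_counit_right' (f := fun u => sw (fun a b => F.lam (a * u) • b) F.Λ),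
    sw_congr h2] at key
  rw [← key, ell_apply, map_sw (L := fun z => S z)]
  simp

theorem S_S_ell_nu (k : A) : S (S (ell F.α (F.nu k))) = k := by
  obtain ⟨h, rfl⟩ := F.S_surjective k
  have := F.sw_lam_S h
  rw [sw_congr fun a b => by rw [F.lam_mul_comm (S h) a], F.sw_Λ_mul] at this
  rw [this]

theorem alpha_nu (a : A) : F.α (F.nu a) = ε a := by
  have h1 := F.lam_mul_comm a F.Λ
  rw [F.mul_Λ, F.Λ_mul_eq, map_smul, map_smul, F.lam_Λ] at h1
  simpa using h1.symm

theorem sw_lam_mul_S (b c : A) :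
    sw (fun u v => F.lam (b * v) • (u * S F.g)) c = S (sw (fun x y => F.lam (y * c) • x) b) := by
  have key := sw_coassoc (T := fun u v w : A =>
    sw (fun x y => F.lam (y * w) • (u * S v * S x)) b) c
  have h1 : ∀ x w : A, sw (fun u v => sw (fun x y => F.lam (y * w) • (u * S v * S x)) b) x =
      (ε x : ℂ) • sw (fun x y => F.lam (y * w) • S x) b := by
    intro x w
    have := sw_antipode_right' (f := fun z : A => sw (fun x y => F.lam (y * w) • (z * S x)) b) x
    simp only [one_mul] at this
    exact this
  have h2 : ∀ u z : A, sw (fun v w => sw (fun x y => F.lam (y * w) • (u * S v * S x)) b) z =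
      F.lam (b * z) • (u * S F.g) := by
    intro u z
    rw [← sw_comm (fun x y v w => F.lam (y * w) • (u * S v * S x))]
    have := congrArg (fun y => u * S y) (F.sw_lam_right (b * z))
    rw [map_sw (L := fun y => u * S y), sw_mul] at this
    simpa [mul_assoc, S_mul] using this
  rw [sw_congr h1, sw_counit_left' (f := fun w => sw (fun x y => F.lam (y * w) • S x) b),
    sw_congr h2] at key
  rw [← key, map_sw (L := fun z => S z)]
  simp

theorem S_sw_lam_mul (a b : A) :
    S (sw (fun x y => F.lam (a * y) • x) b) =
      sw (fun u v => F.lam (v * b) • (S F.g * S (S u))) a := by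
  have key := sw_coassoc (T := fun u v w : A =>
    sw (fun x y => F.lam (w * y) • (S u * v * x)) b) a
  have h1 : ∀ x w : A, sw (fun u v => sw (fun x y => F.lam (w * y) • (S u * v * x)) b) x =
      (ε x : ℂ) • sw (fun x y => F.lam (w * y) • x) b := by
    intro x w
    have := sw_antipode_left' (f := fun z : A => sw (fun x y => F.lam (w * y) • (z * x)) b) x
    simp only [one_mul] at this
    exact this
  have h2 : ∀ u z : A, sw (fun v w => sw (fun x y => F.lam (w * y) • (S u * v * x)) b) z =
      F.lam (z * b) • (S u * F.g) := by
    intro u z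
    have := congrArg (fun y => S u * y) (F.sw_lam_right (z * b))
    rw [map_sw (L := fun y => S u * y), sw_mul] at this
    simpa [mul_assoc] using this
  rw [sw_congr h1, sw_counit_left' (f := fun w => sw (fun x y => F.lam (w * y) • x) b),
    sw_congr h2] at key
  rw [key, map_sw (L := fun z => S z)]
  simp [S_mul]

theorem nu_mul_S_g (a : A) :
    F.nu a * S F.g = S F.g * S (S (tau (charInv F.α) a)) := by
  obtain ⟨b, hb⟩ := F.lam_mul_surjective (ε : A →ₐ[ℂ] ℂ).toLinearMap
  have h0 : ∀ x, F.lam (b * x) = (ε x : ℂ) := fun x => (hb x).symm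
  have hh : ∀ a : A, F.nu a * S F.g =
      sw (fun u v => (ε (F.nu v) : ℂ) • (S F.g * S (S u))) a := by
    intro a
    have h1 := F.sw_lam_mul_S b (F.nu a)
    have h2 : sw (fun x y => F.lam (y * F.nu a) • x) b = sw (fun x y => F.lam (a * y) • x) b :=
      sw_congr (fun x y => by rw [F.lam_mul_comm a y]) b
    rw [h2, F.S_sw_lam_mul, sw_congr fun u v => by rw [h0 v],
      sw_counit_right' (f := fun u => u * S F.g)] at h1
    rw [h1]
    exact sw_congr (fun u v => by rw [F.lam_mul_comm, h0]) a
  have gg := F.isGroupLikeElem_g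
  have hα : ∀ x : A, sw (fun u v => F.α u • (ε (F.nu v) : ℂ)) x = ε x := by
    intro x
    have h3 := congrArg (fun z => F.α (z * F.g)) (hh x)
    simp only [mul_assoc] at h3
    rw [S_mul_groupLike gg, mul_one, alpha_nu, map_sw (L := fun z => F.α (z * F.g))] at h3
    rw [h3]
    refine sw_congr (fun u v => ?_) x
    have : F.α (S F.g) * F.α F.g = 1 := by rw [← map_mul, S_mul_groupLike gg, map_one]
    simp only [map_smul, map_mul, smul_mul_assoc, char_S_S, smul_eq_mul]
    linear_combination -(F.α u * ε (F.nu v)) * this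
  have hε : ∀ x : A, (ε (F.nu x) : ℂ) = charInv F.α x := by
    intro x
    have key := sw_coassoc (T := fun u v w : A => charInv F.α u • F.α v • (ε (F.nu w) : ℂ)) x
    have h1 : ∀ u z : A, sw (fun v w => charInv F.α u • F.α v • (ε (F.nu w) : ℂ)) z =
        (ε z : ℂ) • charInv F.α u := by
      intro u z
      rw [← sw_smul, hα, smul_eq_mul, smul_eq_mul, mul_comm]
    rw [sw_congr fun z w => sw_charInv_left _ _ _, sw_counit_left' (f := fun w => (ε (F.nu w) : ℂ)),
      sw_congr h1, sw_counit_right' (f := fun u => charInv F.α u)] at key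
    exact key
  rw [hh a, tau_apply, map_sw (L := fun z => S F.g * S (S z))]
  exact sw_congr (fun u v => by rw [hε]; simp) a

/-- Radford's formula for the fourth power of the antipode. -/
theorem radford (k : A) :
    S (S (S (S (ell F.α k)))) = F.g * tau F.α k * S F.g := by
  have gg := F.isGroupLikeElem_g
  have h1 : F.nu (tau F.α k) = S F.g * S (S k) * F.g := by
    have := congrArg (fun z => z * F.g) (F.nu_mul_S_g (tau F.α k))
    simpa [mul_assoc, S_mul_groupLike gg, tau_charInv_tau] using this
  have h2 := F.S_S_ell_nu (tau F.α k)
  rw [h1, map_mul (ell F.α), map_mul (ell F.α), ell_S_S] at h2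
  have hSg : ell F.α (S F.g) * ell F.α F.g = 1 := by
    rw [← map_mul, S_mul_groupLike gg, map_one]
  have hc : F.α F.g ≠ 0 := by
    intro h
    have := congrArg F.α (S_mul_groupLike gg)
    rw [map_mul, h, mul_zero, map_one] at this
    exact zero_ne_one this
  rw [ell_groupLike _ gg, mul_smul_comm] at hSg
  have h3 : ell F.α (S F.g) = (F.α F.g)⁻¹ • S F.g := by
    have := congrArg (fun z => (F.α F.g)⁻¹ • (z * S F.g)) hSg
    simpa [mul_assoc, groupLike_mul_S gg, smul_smul, hc] using this
  rw [h3, ell_groupLike _ gg] at h2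
  simp only [smul_mul_assoc, mul_smul_comm, smul_smul, mul_inv_cancel₀ hc, one_smul, S_mul, S_S_groupLike gg] at h2
  rw [← h2]
  simp only [← mul_assoc, groupLike_mul_S gg, one_mul]
  rw [mul_assoc, groupLike_mul_S gg, mul_one]

end Frob

end Radford

end

/-! ### Traces of operators of finite order -/

section

section Spectral

variable {V : Type*} [AddCommGroup V] [Module ℂ V] [Module.Finite ℂ V]

theorem sum_primitiveRoot_pow {N : ℕ} {ω : ℂ} (hω : IsPrimitiveRoot ω N) (a : ℕ) :
    ∑ k ∈ Finset.range N, ω ^ (k * a) = if N ∣ a then (N : ℂ) else 0 := by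
  simp_rw [mul_comm _ a, pow_mul ω a]
  split_ifs with h
  · simp [(hω.pow_eq_one_iff_dvd a).2 h]
  · have h1 : ω ^ a ≠ 1 := fun e => h ((hω.pow_eq_one_iff_dvd a).1 e)
    rw [geom_sum_eq h1, ← pow_mul, mul_comm, pow_mul, hω.pow_eq_one]
    simp

omit [Module.Finite ℂ V] in
/-- Spectral decomposition of an operator of finite order. -/
theorem exists_spectral {N : ℕ} (hN : N ≠ 0) {ω : ℂ} (hω : IsPrimitiveRoot ω N)
    {σ : Module.End ℂ V} (hσ : σ ^ N = 1) :
    ∃ P : ℕ → Module.End ℂ V, (∀ k, IsIdempotentElem (P k)) ∧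
      ∀ j, σ ^ j = ∑ k ∈ Finset.range N, ω ^ (k * j) • P k := by
  have hN' : (N : ℂ) ≠ 0 := by exact_mod_cast hN
  have hω0 : ω ≠ 0 := hω.ne_zero hN
  let P : ℕ → Module.End ℂ V := fun k =>
    (N : ℂ)⁻¹ • ∑ j ∈ Finset.range N, (ω⁻¹ ^ (j * k)) • σ ^ j
  have h1 : ∀ k, σ * P k = ω ^ k • P k := by
    intro k
    simp only [P, mul_smul_comm, Finset.mul_sum]
    rw [smul_comm, Finset.smul_sum]
    have e : ∀ j, ω⁻¹ ^ (j * k) • (σ * σ ^ j) =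
        ω ^ k • (ω⁻¹ ^ ((j + 1) * k) • σ ^ (j + 1)) := by
      intro j
      rw [smul_smul, pow_succ' σ, add_mul, one_mul, pow_add, mul_comm (ω⁻¹ ^ (j * k)), ← mul_assoc,
        ← mul_pow, mul_inv_cancel₀ hω0, one_pow, one_mul]
    simp_rw [e, ← Finset.smul_sum]
    congr 1
    have := Finset.sum_range_succ' (fun j => ω⁻¹ ^ (j * k) • σ ^ j) N
    have hN1 : ω⁻¹ ^ (N * k) • σ ^ N = 1 := by rw [hσ, pow_mul, inv_pow, hω.pow_eq_one]; simp
    rw [Finset.sum_range_succ, hN1] at this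
    have h0 : ω⁻¹ ^ (0 * k) • σ ^ 0 = 1 := by simp
    rw [h0] at this
    exact congrArg _ (add_right_cancel this).symm
  have h2 : ∀ k j, σ ^ j * P k = ω ^ (k * j) • P k := by
    intro k j
    induction j with
    | zero => simp
    | succ j ih => rw [pow_succ, mul_assoc, h1, mul_smul_comm, ih, smul_smul, ← pow_add]; ring_nf
  have h3 : ∑ k ∈ Finset.range N, P k = 1 := by
    simp only [P]
    rw [← Finset.smul_sum, Finset.sum_comm]
    simp_rw [← Finset.sum_smul]
    have : ∀ j ∈ Finset.range N, (∑ k ∈ Finset.range N, ω⁻¹ ^ (j * k)) • σ ^ j =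
        if j = 0 then (N : ℂ) • (1 : Module.End ℂ V) else 0 := by
      intro j hj
      simp_rw [mul_comm j]
      rw [sum_primitiveRoot_pow hω.inv]
      have hj' := Finset.mem_range.1 hj
      by_cases h : j = 0
      · simp [h]
      · rw [if_neg (fun hd => absurd (Nat.le_of_dvd (Nat.pos_of_ne_zero h) hd) (by omega)),
          if_neg h, zero_smul]
    rw [Finset.sum_congr rfl this]
    simp [Nat.pos_of_ne_zero hN, smul_smul, hN']
  refine ⟨P, fun k => ?_, fun j => ?_⟩
  · change P k * P k = P k
    conv_lhs => enter [1]; simp only [P]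
    rw [smul_mul_assoc, Finset.sum_mul]
    simp_rw [smul_mul_assoc, h2, smul_smul, mul_comm k, inv_pow]
    simp [hω0, ← Nat.cast_smul_eq_nsmul ℂ, smul_smul, hN']
  · calc σ ^ j = σ ^ j * ∑ k ∈ Finset.range N, P k := by rw [h3, mul_one]
      _ = _ := by rw [Finset.mul_sum]; exact Finset.sum_congr rfl fun k _ => h2 k j

theorem trace_idempotent {P : Module.End ℂ V} (hP : IsIdempotentElem P) :
    LinearMap.trace ℂ V P = Module.finrank ℂ (LinearMap.range P) :=
  (LinearMap.IsIdempotentElem.isProj_range P hP).trace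

theorem exists_mult {N : ℕ} (hN : N ≠ 0) {ω : ℂ} (hω : IsPrimitiveRoot ω N)
    {σ : Module.End ℂ V} (hσ : σ ^ N = 1) :
    ∃ m : ℕ → ℕ, ∀ j, LinearMap.trace ℂ V (σ ^ j) =
      ∑ k ∈ Finset.range N, (m k : ℂ) * ω ^ (k * j) := by
  obtain ⟨P, hP, h⟩ := exists_spectral hN hω hσ
  refine ⟨fun k => Module.finrank ℂ (LinearMap.range (P k)), fun j => ?_⟩
  rw [h, map_sum]
  refine Finset.sum_congr rfl fun k _ => ?_
  rw [map_smul, trace_idempotent (hP k), smul_eq_mul, mul_comm]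

theorem eq_one_of_trace_eq {N : ℕ} (hN : N ≠ 0) {σ : Module.End ℂ V} (hσ : σ ^ N = 1)
    (ht : LinearMap.trace ℂ V σ = Module.finrank ℂ V) : σ = 1 := by
  have hω := Complex.isPrimitiveRoot_exp N hN
  set ω := Complex.exp (2 * Real.pi * Complex.I / N)
  obtain ⟨P, hP, h⟩ := exists_spectral hN hω hσ
  have hn : ∀ k, ‖ω ^ k‖ = 1 := fun k => by
    rw [norm_pow, hω.norm'_eq_one hN, one_pow]
  have hle : ∀ k, (ω ^ k).re ≤ 1 := fun k => (Complex.re_le_norm _).trans (hn k).le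
  have h1 := h 1
  have h0 := h 0
  simp only [pow_one, mul_one] at h1
  simp only [pow_zero, mul_zero, one_smul] at h0
  have t1 := congrArg (LinearMap.trace ℂ V) h1
  have t0 := congrArg (LinearMap.trace ℂ V) h0
  rw [ht] at t1
  rw [LinearMap.trace_one, t1, map_sum, map_sum] at t0
  simp only [map_smul, trace_idempotent (hP _), smul_eq_mul] at t0
  have hs : ∑ k ∈ Finset.range N,
      (Module.finrank ℂ (LinearMap.range (P k)) : ℝ) * (1 - (ω ^ k).re) = 0 := by
    have := congrArg Complex.re t0
    simp only [Complex.re_sum, Complex.mul_re, Complex.natCast_re, Complex.natCast_im, mul_zero,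
      sub_zero] at this
    simp only [mul_sub, mul_one, Finset.sum_sub_distrib]
    rw [← this, sub_eq_zero]
    exact Finset.sum_congr rfl fun k _ => mul_comm _ _
  rw [Finset.sum_eq_zero_iff_of_nonneg
    (fun k _ => mul_nonneg (Nat.cast_nonneg _) (sub_nonneg.2 (hle k)))] at hs
  rw [h1, h0]
  refine Finset.sum_congr rfl fun k hk => ?_
  rcases mul_eq_zero.1 (hs k hk) with h | h
  · rw [Nat.cast_eq_zero, Submodule.finrank_eq_zero, LinearMap.range_eq_bot] at h
    simp [h]
  · have hre : (ω ^ k).re = 1 := by linarith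
    have him : (ω ^ k).im = 0 := by
      have := hn k
      rw [← sq_eq_sq₀ (norm_nonneg _) zero_le_one, ← Complex.normSq_eq_norm_sq,
        Complex.normSq_apply, hre] at this
      nlinarith
    rw [show ω ^ k = 1 from Complex.ext hre him, one_smul]

theorem prime_dvd_of_sum_eq_zero {r : ℕ} (hr : r.Prime) {ξ : ℂ} (hξ : IsPrimitiveRoot ξ r)
    {ι : Type*} (s : Finset ι) (a : ι → ℤ) (e : ι → ℕ)
    (h : ∑ i ∈ s, (a i : ℂ) * ξ ^ e i = 0) : (r : ℤ) ∣ ∑ i ∈ s, a i := by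
  have := Fact.mk hr
  let F : Polynomial ℤ := ∑ i ∈ s, Polynomial.C (a i) * Polynomial.X ^ e i
  have h1 : Polynomial.aeval ξ F = 0 := by
    simpa [F, map_sum] using h
  have h2 : Polynomial.cyclotomic r ℤ ∣ F := by
    rw [Polynomial.cyclotomic_eq_minpoly hξ hr.pos]
    exact minpoly.isIntegrallyClosed_dvd (hξ.isIntegral hr.pos) h1
  have h3 := Polynomial.eval_dvd (x := (1 : ℤ)) h2
  rw [Polynomial.eval_one_cyclotomic_prime] at h3
  simpa [F, Polynomial.eval_finsetSum] using h3

/-- If `σ ^ (2 * r) = 1` and `σ` has trace zero then the trace of `σ ^ r` is divisible by `r`. -/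
theorem exists_trace_pow_eq {r : ℕ} (hr : r.Prime) (hodd : Odd r) {σ : Module.End ℂ V}
    (hσ : σ ^ (2 * r) = 1) (ht : LinearMap.trace ℂ V σ = 0) :
    ∃ c : ℤ, LinearMap.trace ℂ V (σ ^ r) = r * c := by
  have hN : 2 * r ≠ 0 := by have := hr.pos; omega
  have hω := Complex.isPrimitiveRoot_exp (2 * r) hN
  set ω := Complex.exp (2 * Real.pi * Complex.I / (2 * r : ℕ))
  obtain ⟨m, hm⟩ := exists_mult hN hω hσ
  have hωr : ω ^ r = -1 := by
    have := hω.pow (by omega) (mul_comm 2 r)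
    exact this.eq_neg_one_of_two_right
  have hξ : IsPrimitiveRoot (ω ^ 2) r := hω.pow (by omega) rfl
  have h0 : ∑ k ∈ Finset.range (2 * r), (((-1) ^ k * m k : ℤ) : ℂ) * (ω ^ 2) ^ (k * ((r + 1) / 2)) = 0 := by
    rw [← ht]
    have h1 := hm 1
    rw [pow_one] at h1
    rw [h1]
    refine Finset.sum_congr rfl fun k _ => ?_
    have : 2 * (k * ((r + 1) / 2)) = k * r + k := by
      obtain ⟨t, rfl⟩ := hodd
      rw [show (2 * t + 1 + 1) / 2 = t + 1 by omega]; ring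
    rw [← pow_mul, this, pow_add, mul_comm k r, pow_mul, hωr]
    push_cast
    rw [mul_one]
    have : ((-1 : ℂ) ^ k) * (-1) ^ k = 1 := by rw [← mul_pow]; simp
    linear_combination (m k * ω ^ k) * this
  obtain ⟨c, hc⟩ := prime_dvd_of_sum_eq_zero hr hξ _ _ _ h0
  refine ⟨c, ?_⟩
  rw [hm r]
  have := congrArg (Int.cast : ℤ → ℂ) hc
  push_cast at this
  rw [← this]
  refine Finset.sum_congr rfl fun k _ => ?_
  rw [mul_comm k r, pow_mul, hωr, mul_comm]

theorem dvd_finrank_of_trace_eq_zero {r : ℕ} (hr : r.Prime) {σ : Module.End ℂ V}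
    (hσ : σ ^ r = 1) (ht : LinearMap.trace ℂ V σ = 0) : r ∣ Module.finrank ℂ V := by
  have hω := Complex.isPrimitiveRoot_exp r hr.ne_zero
  obtain ⟨m, hm⟩ := exists_mult hr.ne_zero hω hσ
  have h1 := hm 1
  rw [pow_one, ht] at h1
  have h2 := prime_dvd_of_sum_eq_zero hr hω _ (fun k => (m k : ℤ)) (fun k => k * 1)
    (by simpa using h1.symm)
  have h0 := hm 0
  rw [pow_zero, LinearMap.trace_one] at h0
  have h3 : Module.finrank ℂ V = ∑ k ∈ Finset.range r, m k := by
    simp only [mul_zero, pow_zero, mul_one] at h0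
    exact_mod_cast h0
  rw [h3]
  exact_mod_cast h2

end Spectral

end

/-! ### Orders of characters and of grouplike elements -/

section

section FreeAction

variable {A : Type*} [Ring A] [HopfAlgebra ℂ A] [Module.Finite ℂ A]
  {V : Type*} [AddCommGroup V] [Module ℂ V] [Module.Finite ℂ V]

omit [Module.Finite ℂ A] [Module.Finite ℂ V] in
theorem isBilin_psi (ρ : A →ₐ[ℂ] Module.End ℂ V) :
    IsBilin (fun (x : A) (v : V) => sw (fun a b => a ⊗ₜ[ℂ] ρ b v) x) := by
  have h : ∀ v : V, IsLin (fun b => ρ b v) := fun v => ⟨by simp, by simp⟩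
  refine ⟨fun v => ?_, fun x => ?_⟩
  · have := h v
    fun_prop
  · fun_prop

/-- The map `x ⊗ v ↦ x₁ ⊗ x₂ v`. -/
noncomputable def psi (ρ : A →ₐ[ℂ] Module.End ℂ V) : A ⊗[ℂ] V →ₗ[ℂ] A ⊗[ℂ] V :=
  (isBilin_psi ρ).lift

omit [Module.Finite ℂ A] [Module.Finite ℂ V] in
theorem psi_tmul (ρ : A →ₐ[ℂ] Module.End ℂ V) (x : A) (v : V) :
    psi ρ (x ⊗ₜ v) = sw (fun a b => a ⊗ₜ[ℂ] ρ b v) x := IsBilin.lift_tmul ..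

omit [Module.Finite ℂ V] [Module.Finite ℂ A] in
theorem psi_surjective (ρ : A →ₐ[ℂ] Module.End ℂ V) : Function.Surjective (psi ρ) := by
  have hl : ∀ v : V, IsLin (fun b => ρ b v) := fun v => ⟨by simp, by simp⟩
  rw [← LinearMap.range_eq_top, eq_top_iff, ← TensorProduct.span_tmul_eq_top, Submodule.span_le]
  rintro _ ⟨x, v, rfl⟩
  refine ⟨sw (fun a b => a ⊗ₜ[ℂ] ρ (S b) v) x, ?_⟩
  have hv := hl v
  rw [map_sw (L := fun y => psi ρ y)]
  simp only [psi_tmul]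
  have hv' : ∀ b, IsLin (fun c => ρ c (ρ b v)) := fun b => hl _
  have hv'' : ∀ a, IsLin (fun c => ρ a (ρ c v)) := fun b => by fun_prop
  rw [sw_coassoc (T := fun c d b => c ⊗ₜ[ℂ] ρ d (ρ (S b) v))]
  have h1 : ∀ u z : A, sw (fun v' w => u ⊗ₜ[ℂ] ρ v' (ρ (S w) v)) z =
      (ε z : ℂ) • (u ⊗ₜ[ℂ] v) := by
    intro u z
    have := sw_antipode_right' (f := fun y => u ⊗ₜ[ℂ] ρ y v) z
    simpa using this
  rw [sw_congr h1, sw_counit_right' (f := fun u => u ⊗ₜ[ℂ] v)]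

theorem finrank_mul_trace (ρ : A →ₐ[ℂ] Module.End ℂ V) (χ : A →ₐ[ℂ] ℂ) (t : Module.End ℂ V)
    (ht : ∀ a v, t (ρ a v) = ρ (tau χ a) (t v)) :
    (Module.finrank ℂ A : ℂ) * LinearMap.trace ℂ V t =
      LinearMap.trace ℂ A (tau χ).toLinearMap * LinearMap.trace ℂ V t := by
  have hl : ∀ v : V, IsLin (fun b => ρ b v) := fun v => ⟨by simp, by simp⟩
  let e : (A ⊗[ℂ] V) ≃ₗ[ℂ] (A ⊗[ℂ] V) := LinearEquiv.ofBijective (psi ρ)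
    ⟨LinearMap.injective_iff_surjective.2 (psi_surjective ρ), psi_surjective ρ⟩
  have key : TensorProduct.map LinearMap.id t ∘ₗ psi ρ =
      psi ρ ∘ₗ TensorProduct.map (tau χ).toLinearMap t := by
    ext x v
    simp only [TensorProduct.AlgebraTensorModule.curry_apply, TensorProduct.curry_apply,
      LinearMap.coe_restrictScalars, LinearMap.comp_apply, TensorProduct.map_tmul, psi_tmul,
      AlgHom.toLinearMap_apply]
    have hv := hl v
    have htv := hl (t v)
    rw [map_sw (L := fun y => TensorProduct.map LinearMap.id t y)]
    simp only [TensorProduct.map_tmul, LinearMap.id_apply, ht]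
    rw [tau_apply, map_sw (L := fun y => sw (fun a b => a ⊗ₜ[ℂ] ρ b (t v)) y)]
    have h1 : ∀ a b : A, sw (fun c d => c ⊗ₜ[ℂ] ρ d (t v)) (χ b • a) =
        sw (fun c d => χ b • (c ⊗ₜ[ℂ] ρ d (t v))) a := by
      intro a b
      rw [IsLin.map_smul (f := fun y => sw (fun c d => c ⊗ₜ[ℂ] ρ d (t v)) y) (by fun_prop), sw_smul]
    rw [sw_congr h1, sw_coassoc (T := fun c d b => χ b • (c ⊗ₜ[ℂ] ρ d (t v)))]
    refine sw_congr (fun a b => ?_) x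
    rw [tau_apply, map_sw (L := fun y => a ⊗ₜ[ℂ] ρ y (t v))]
    exact sw_congr (fun c d => by simp) b
  have h2 : e.conj (TensorProduct.map (tau χ).toLinearMap t) =
      TensorProduct.map LinearMap.id t := by
    rw [LinearEquiv.conj_apply]
    ext1
    ext x v
    obtain ⟨z, hz⟩ := e.surjective (x ⊗ₜ[ℂ] v)
    have := LinearMap.congr_fun key z
    simp only [LinearMap.comp_apply] at this
    simp only [TensorProduct.AlgebraTensorModule.curry_apply, TensorProduct.curry_apply,
      LinearMap.coe_restrictScalars, LinearMap.comp_apply, ← hz, LinearEquiv.coe_coe,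
      LinearEquiv.symm_apply_apply]
    exact this.symm
  have h3 := congrArg (LinearMap.trace ℂ _) h2
  rw [LinearMap.trace_conj', LinearMap.trace_tensorProduct', LinearMap.trace_tensorProduct',
    LinearMap.trace_id] at h3
  exact h3.symm

theorem trace_mulRight_groupLike {g : A} (hg : IsGroupLikeElem ℂ g)
    (h0 : LinearMap.trace ℂ A (LinearMap.mulRight ℂ g) ≠ 0) :
    LinearMap.trace ℂ A (LinearMap.mulRight ℂ g) = Module.finrank ℂ A := by
  have hb : IsBilin (fun y x : A => sw (fun a b => (y * a) ⊗ₜ[ℂ] b) x) :=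
    ⟨fun x => by fun_prop, fun y => by fun_prop⟩
  have hs : Function.Surjective hb.lift := by
    rw [← LinearMap.range_eq_top, eq_top_iff, ← TensorProduct.span_tmul_eq_top, Submodule.span_le]
    rintro _ ⟨y, x, rfl⟩
    refine ⟨sw (fun a b => (y * S a) ⊗ₜ[ℂ] b) x, ?_⟩
    rw [map_sw (L := fun y => hb.lift y)]
    simp only [IsBilin.lift_tmul]
    rw [← sw_coassoc (T := fun a c d => (y * S a * c) ⊗ₜ[ℂ] d)]
    have h1 : ∀ z d : A, sw (fun a c => (y * S a * c) ⊗ₜ[ℂ] d) z = (ε z : ℂ) • (y ⊗ₜ[ℂ] d) := by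
      intro z d
      have := sw_antipode_left' (f := fun u => (y * u) ⊗ₜ[ℂ] d) z
      simpa [mul_assoc] using this
    rw [sw_congr h1, sw_counit_left' (f := fun d => y ⊗ₜ[ℂ] d)]
  let e : (A ⊗[ℂ] A) ≃ₗ[ℂ] (A ⊗[ℂ] A) := LinearEquiv.ofBijective hb.lift
    ⟨LinearMap.injective_iff_surjective.2 hs, hs⟩
  have key : TensorProduct.map (LinearMap.mulRight ℂ g) (LinearMap.mulRight ℂ g) ∘ₗ hb.lift =
      hb.lift ∘ₗ TensorProduct.map LinearMap.id (LinearMap.mulRight ℂ g) := by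
    ext y x
    simp only [TensorProduct.AlgebraTensorModule.curry_apply, TensorProduct.curry_apply,
      LinearMap.coe_restrictScalars, LinearMap.comp_apply, TensorProduct.map_tmul,
      IsBilin.lift_tmul, LinearMap.mulRight_apply, LinearMap.id_apply]
    rw [map_sw (L := fun z => TensorProduct.map _ _ z), sw_mul]
    refine sw_congr (fun a b => ?_) x
    rw [sw_groupLike hg]
    simp [mul_assoc]
  have h2 : e.conj (TensorProduct.map LinearMap.id (LinearMap.mulRight ℂ g)) =
      TensorProduct.map (LinearMap.mulRight ℂ g) (LinearMap.mulRight ℂ g) := by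
    rw [LinearEquiv.conj_apply]
    ext1
    ext x v
    obtain ⟨z, hz⟩ := e.surjective (x ⊗ₜ[ℂ] v)
    have := LinearMap.congr_fun key z
    simp only [LinearMap.comp_apply] at this
    simp only [TensorProduct.AlgebraTensorModule.curry_apply, TensorProduct.curry_apply,
      LinearMap.coe_restrictScalars, LinearMap.comp_apply, ← hz, LinearEquiv.coe_coe,
      LinearEquiv.symm_apply_apply]
    exact this.symm
  have h3 := congrArg (LinearMap.trace ℂ _) h2
  rw [LinearMap.trace_conj', LinearMap.trace_tensorProduct', LinearMap.trace_tensorProduct',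
    LinearMap.trace_id] at h3
  exact (mul_right_cancel₀ h0 h3).symm

end FreeAction

section Orders

variable {A : Type*} [Ring A] [HopfAlgebra ℂ A]

theorem tau_counit : tau (ε : A →ₐ[ℂ] ℂ) = 1 := by
  ext x
  rw [tau_apply, sw_counit_right' (f := fun a => a)]; rfl

/-- Convolution powers of a character. -/
noncomputable def chiPow (χ : A →ₐ[ℂ] ℂ) (k : ℕ) : A →ₐ[ℂ] ℂ := (ε : A →ₐ[ℂ] ℂ).comp (tau χ ^ k)

theorem chiPow_zero (χ : A →ₐ[ℂ] ℂ) : chiPow χ 0 = ε := rfl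

theorem tau_comp_tau (χ ψ : A →ₐ[ℂ] ℂ) : tau (χ.comp (tau ψ)) = tau χ * tau ψ := by
  ext x
  rw [AlgHom.mul_apply, tau_apply ψ, map_sw (L := fun y => tau χ y), tau_apply]
  have h1 : ∀ a b : A, tau χ (ψ b • a) = sw (fun u v => χ v • ψ b • u) a := by
    intro a b
    rw [map_smul, tau_apply, sw_smul]
    exact sw_congr (fun u v => smul_comm _ _ _) _
  rw [sw_congr h1, sw_coassoc (T := fun u v b => χ v • ψ b • u)]
  refine sw_congr (fun a b => ?_) x
  rw [AlgHom.comp_apply, tau_apply, map_sw (L := fun y => χ y), sw_smul_const]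
  exact sw_congr (fun u v => by
    rw [map_smul, smul_eq_mul, smul_smul, mul_comm]) b

theorem tau_chiPow (χ : A →ₐ[ℂ] ℂ) (k : ℕ) : tau (chiPow χ k) = tau χ ^ k := by
  induction k with
  | zero => exact tau_counit
  | succ k ih => rw [pow_succ, ← ih, ← tau_comp_tau]; rfl

theorem chiPow_comp (χ : A →ₐ[ℂ] ℂ) (j k : ℕ) (x : A) :
    chiPow χ j ((tau χ ^ k) x) = chiPow χ (j + k) x := by
  rw [chiPow, chiPow, pow_add]; rfl

variable [Module.Finite ℂ A]

theorem orderOf_tau_pos (χ : A →ₐ[ℂ] ℂ) : 0 < orderOf (tau χ) := by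
  obtain ⟨i, j, hij, h⟩ := Finite.exists_ne_map_eq_of_infinite (chiPow χ)
  wlog hlt : i < j generalizing i j
  · exact this j i hij.symm h.symm (by omega)
  rw [orderOf_pos_iff, isOfFinOrder_iff_pow_eq_one]
  refine ⟨j - i, by omega, ?_⟩
  have h1 : tau χ ^ i = tau χ ^ j := by rw [← tau_chiPow, h, tau_chiPow]
  have hinv : tau (charInv χ) * tau χ = 1 := by
    ext x
    exact tau_charInv_tau χ x
  have hinv' : tau χ * tau (charInv χ) = 1 := by
    ext x
    exact tau_tau_charInv χ x
  have hu : IsUnit (tau χ) := ⟨⟨tau χ, tau (charInv χ), hinv', hinv⟩, rfl⟩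
  have hui := hu.pow i
  apply hui.mul_left_cancel
  rw [← pow_add, mul_one, h1]
  congr 1
  omega

theorem trace_tau_eq_zero {χ : A →ₐ[ℂ] ℂ} (hχ : tau χ ≠ 1) :
    LinearMap.trace ℂ A (tau χ).toLinearMap = 0 := by
  by_contra h0
  have h := finrank_mul_trace (Algebra.lmul ℂ A) χ (tau χ).toLinearMap (fun a v => by simp)
  have h1 := mul_right_cancel₀ h0 h
  have h2 : (tau χ).toLinearMap = 1 := by
    refine eq_one_of_trace_eq (orderOf_tau_pos χ).ne' ?_ h1.symm
    have := congrArg AlgHom.toEnd (pow_orderOf_eq_one (tau χ))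
    rwa [map_pow, map_one] at this
  exact hχ (AlgHom.ext fun x => LinearMap.congr_fun h2 x)

theorem trace_mulRight_eq_zero {g : A} (hg : IsGroupLikeElem ℂ g) (hf : IsOfFinOrder g)
    (h1 : g ≠ 1) : LinearMap.trace ℂ A (LinearMap.mulRight ℂ g) = 0 := by
  by_contra h0
  have h := trace_mulRight_groupLike hg h0
  have h2 : LinearMap.mulRight ℂ g = 1 := by
    refine eq_one_of_trace_eq (orderOf_pos_iff.2 hf).ne' ?_ h
    rw [LinearMap.pow_mulRight, pow_orderOf_eq_one, LinearMap.mulRight_one]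
    rfl
  apply h1
  simpa using LinearMap.congr_fun h2 1

theorem isOfFinOrder_groupLike {g : A} (hg : IsGroupLikeElem ℂ g) : IsOfFinOrder g := by
  have hfin : Finite {a : A | IsGroupLikeElem ℂ a} :=
    (linearIndepOn_isGroupLikeElem (R := ℂ) (A := A)).linearIndependent.finite
  obtain ⟨i, j, hij, h⟩ := Finite.exists_ne_map_eq_of_infinite
    (fun k : ℕ => (⟨g ^ k, hg.pow⟩ : {a : A | IsGroupLikeElem ℂ a}))
  wlog hlt : i < j generalizing i j
  · exact this j i hij.symm h.symm (by omega)
  rw [isOfFinOrder_iff_pow_eq_one]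
  refine ⟨j - i, by omega, ?_⟩
  have h1 : g ^ i = g ^ j := congrArg Subtype.val h
  apply (hg.isUnit.pow i).mul_left_cancel
  rw [← pow_add, mul_one, h1]
  congr 1
  omega

/-- The averaging operator of an operator of finite order with traceless powers. -/
theorem average {V : Type*} [AddCommGroup V] [Module ℂ V] [Module.Finite ℂ V] {N : ℕ} (hN : 0 < N)
    {σ : Module.End ℂ V} (hσ : σ ^ N = 1)
    (ht : ∀ j, 0 < j → j < N → LinearMap.trace ℂ V (σ ^ j) = 0) :
    ∃ E : Module.End ℂ V, IsIdempotentElem E ∧ E = (N : ℂ)⁻¹ • ∑ j ∈ Finset.range N, σ ^ j ∧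
      (∀ x, E x = x ↔ σ x = x) ∧
      N * Module.finrank ℂ (LinearMap.range E) = Module.finrank ℂ V := by
  have hN' : (N : ℂ) ≠ 0 := by exact_mod_cast hN.ne'
  set E : Module.End ℂ V := (N : ℂ)⁻¹ • ∑ j ∈ Finset.range N, σ ^ j with hE
  have h1 : σ * E = E := by
    rw [hE, mul_smul_comm, Finset.mul_sum]
    congr 1
    have := Finset.sum_range_succ' (fun j => σ ^ j) N
    rw [Finset.sum_range_succ, hσ, pow_zero] at this
    rw [add_right_cancel this]
    exact Finset.sum_congr rfl fun j _ => (pow_succ' σ j).symm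
  have h2 : ∀ j, σ ^ j * E = E := by
    intro j
    induction j with
    | zero => simp
    | succ j ih => rw [pow_succ, mul_assoc, h1, ih]
  have h3 : ∀ x, σ x = x → E x = x := by
    intro x hx
    have : ∀ j, (σ ^ j) x = x := by
      intro j
      induction j with
      | zero => simp
      | succ j ih => rw [pow_succ, Module.End.mul_apply, hx, ih]
    simp [hE, this, ← Nat.cast_smul_eq_nsmul ℂ, smul_smul, hN']
  have hid : IsIdempotentElem E := by
    change E * E = E
    conv_lhs => enter [1]; rw [hE]
    rw [smul_mul_assoc, Finset.sum_mul]
    simp [h2, ← Nat.cast_smul_eq_nsmul ℂ, smul_smul, hN']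
  refine ⟨E, hid, rfl, fun x => ⟨fun hx => ?_, h3 x⟩, ?_⟩
  · have := LinearMap.congr_fun h1 x
    rwa [Module.End.mul_apply, hx] at this
  · have h4 := trace_idempotent hid
    rw [hE, map_smul, map_sum, Finset.sum_eq_single_of_mem 0 (Finset.mem_range.2 hN)
      (fun j hj hj0 => ht j (Nat.pos_of_ne_zero hj0) (Finset.mem_range.1 hj)), pow_zero,
      LinearMap.trace_one, ← hE, smul_eq_mul, inv_mul_eq_iff_eq_mul₀ hN'] at h4
    exact_mod_cast h4.symm

theorem trace_tau_pow_eq_zero (χ : A →ₐ[ℂ] ℂ) {j : ℕ} (h0 : 0 < j) (h1 : j < orderOf (tau χ)) :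
    LinearMap.trace ℂ A ((tau χ).toLinearMap ^ j) = 0 := by
  have h : (tau χ).toLinearMap ^ j = (tau (chiPow χ j)).toLinearMap := by
    rw [tau_chiPow]
    exact (map_pow AlgHom.toEnd (tau χ) j).symm
  rw [h]
  apply trace_tau_eq_zero
  rw [tau_chiPow]
  exact pow_ne_one_of_lt_orderOf h0.ne' h1

omit [Module.Finite ℂ A] in
theorem toLinearMap_tau_pow_order (χ : A →ₐ[ℂ] ℂ) :
    (tau χ).toLinearMap ^ orderOf (tau χ) = 1 := by
  have := congrArg AlgHom.toEnd (pow_orderOf_eq_one (tau χ))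
  rwa [map_pow, map_one] at this

theorem orderOf_tau_dvd (χ : A →ₐ[ℂ] ℂ) : orderOf (tau χ) ∣ Module.finrank ℂ A := by
  obtain ⟨E, -, -, -, h⟩ := average (orderOf_tau_pos χ) (toLinearMap_tau_pow_order χ)
    (fun j h0 h1 => trace_tau_pow_eq_zero χ h0 h1)
  exact ⟨_, h.symm⟩

theorem average_groupLike {g : A} (hg : IsGroupLikeElem ℂ g) :
    orderOf g * Module.finrank ℂ (LinearMap.range (LinearMap.mulRight ℂ
      ((orderOf g : ℂ)⁻¹ • ∑ j ∈ Finset.range (orderOf g), g ^ j))) = Module.finrank ℂ A := by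
  have hf := isOfFinOrder_groupLike hg
  obtain ⟨E, -, hE, -, h⟩ := average (N := orderOf g) (orderOf_pos_iff.2 hf)
    (σ := LinearMap.mulRight ℂ g)
    (by rw [LinearMap.pow_mulRight, pow_orderOf_eq_one, LinearMap.mulRight_one]; rfl)
    (fun j h0 h1 => by
      rw [LinearMap.pow_mulRight]
      exact trace_mulRight_eq_zero hg.pow hf.pow (pow_ne_one_of_lt_orderOf h0.ne' h1))
  have : E = LinearMap.mulRight ℂ ((orderOf g : ℂ)⁻¹ • ∑ j ∈ Finset.range (orderOf g), g ^ j) := by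
    rw [hE]
    ext x
    simp [LinearMap.pow_mulRight, Finset.mul_sum]
  rw [← this]
  exact h

theorem orderOf_groupLike_dvd {g : A} (hg : IsGroupLikeElem ℂ g) :
    orderOf g ∣ Module.finrank ℂ A := ⟨_, (average_groupLike hg).symm⟩

/-- A grouplike element and a character of complementary orders force a normalised integral. -/
theorem exists_integral_of_orders {g : A} (hg : IsGroupLikeElem ℂ g) (χ : A →ₐ[ℂ] ℂ)
    (hχ : χ g = 1) (hn : orderOf g * orderOf (tau χ) = Module.finrank ℂ A) :
    ∃ y : A, (∀ h, h * y = (ε h : ℂ) • y) ∧ (ε y : ℂ) = 1 := by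
  set N := orderOf g
  set M := orderOf (tau χ)
  have hN : 0 < N := orderOf_pos_iff.2 (isOfFinOrder_groupLike hg)
  have hM : 0 < M := orderOf_tau_pos χ
  have hN' : (N : ℂ) ≠ 0 := by exact_mod_cast hN.ne'
  set e : A := (N : ℂ)⁻¹ • ∑ j ∈ Finset.range N, g ^ j with he
  have hrank : Module.finrank ℂ (LinearMap.range (LinearMap.mulRight ℂ e)) = M := by
    have := average_groupLike hg
    rw [← hn] at this
    exact Nat.eq_of_mul_eq_mul_left hN this
  have hg1 : ∀ k, chiPow χ k g = 1 := by
    intro k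
    induction k with
    | zero => exact hg.counit_eq_one
    | succ k ih =>
      rw [← chiPow_comp, pow_one, tau_groupLike χ hg, hχ, one_smul, ih]
  have he1 : ∀ k, chiPow χ k e = 1 := by
    intro k
    simp [he, hg1, hN']
  let f : A →ₗ[ℂ] (Fin M → ℂ) := LinearMap.pi fun i => (chiPow χ i).toLinearMap
  have hinj : Function.Injective (fun i : Fin M => chiPow χ i) := by
    intro i j h
    have h1 : tau χ ^ (i : ℕ) = tau χ ^ (j : ℕ) := by
      rw [← tau_chiPow, ← tau_chiPow]; exact congrArg tau h
    exact Fin.ext (pow_injOn_Iio_orderOf i.2 j.2 h1)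
  have hli : LinearIndependent ℂ (fun i : Fin M => (chiPow χ i).toLinearMap) :=
    (linearIndependent_algHom_toLinearMap ℂ A ℂ).comp _ hinj
  have hsurj : Function.Surjective f := by
    rw [← LinearMap.range_eq_top]
    by_contra hne
    obtain ⟨φ, hφ0, hφ⟩ := Submodule.exists_dual_map_eq_bot_of_lt_top (lt_top_iff_ne_top.2 hne)
      inferInstance
    apply hφ0
    have h1 : ∀ a, φ (f a) = 0 := by
      intro a
      have : φ (f a) ∈ Submodule.map φ (LinearMap.range f) := ⟨_, ⟨a, rfl⟩, rfl⟩
      rwa [hφ, Submodule.mem_bot] at this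
    have h2 : ∑ i, φ (Pi.single i 1) • (chiPow χ i).toLinearMap = 0 := by
      ext a
      rw [LinearMap.zero_apply, ← h1 a]
      conv_rhs => rw [← LinearMap.sum_single_apply (fun _ => ℂ) (f a)]
      rw [map_sum, LinearMap.sum_apply]
      refine Finset.sum_congr rfl fun i _ => ?_
      have : (LinearMap.single ℂ (fun _ : Fin M => ℂ) i (f a i)) = (f a i) • Pi.single i (1 : ℂ) := by
        rw [← Pi.single_smul]; simp
      simp only [LinearMap.coe_single] at this
      rw [this, map_smul]
      simp [f, mul_comm]
    have h3 := Fintype.linearIndependent_iff.1 hli _ h2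
    exact LinearMap.pi_ext' fun i => LinearMap.ext_ring (by simpa using h3 i)
  let f' := f ∘ₗ (LinearMap.range (LinearMap.mulRight ℂ e)).subtype
  have hsurj' : Function.Surjective f' := by
    intro v
    obtain ⟨a, rfl⟩ := hsurj v
    refine ⟨⟨a * e, ⟨a, rfl⟩⟩, ?_⟩
    ext i
    simp [f', f, he1]
  have hinj' : Function.Injective f' := by
    rw [LinearMap.injective_iff_surjective_of_finrank_eq_finrank (by simpa using hrank)]
    exact hsurj'
  obtain ⟨⟨y, hy⟩, hy1⟩ := hsurj' (Pi.single ⟨0, hM⟩ 1)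
  have hyi : ∀ i : Fin M, chiPow χ i y = Pi.single (M := fun _ => ℂ) ⟨0, hM⟩ 1 i := fun i =>
    congrFun hy1 i
  obtain ⟨y', rfl⟩ := hy
  refine ⟨y' * e, fun h => ?_, ?_⟩
  · have : (⟨h * (y' * e), ⟨h * y', by simp [mul_assoc]⟩⟩ :
        LinearMap.range (LinearMap.mulRight ℂ e)) =
        ⟨(ε h : ℂ) • (y' * e), ⟨(ε h : ℂ) • y', by simp⟩⟩ := by
      apply hinj'
      ext i
      have := hyi i
      simp only [LinearMap.mulRight_apply] at this
      by_cases h0 : i = ⟨0, hM⟩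
      · subst h0
        simp only [f', f, LinearMap.comp_apply, Submodule.subtype_apply, LinearMap.pi_apply,
          AlgHom.toLinearMap_apply, map_mul (chiPow χ _) h, this, map_smul]
        simp [chiPow_zero]
      · simp only [f', f, LinearMap.comp_apply, Submodule.subtype_apply, LinearMap.pi_apply,
          AlgHom.toLinearMap_apply, map_mul (chiPow χ _) h, this, map_smul]
        simp [h0]
    exact congrArg Subtype.val this
  · have := hyi ⟨0, hM⟩
    simpa [chiPow_zero] using this

end Orders

section Maschke

variable {A : Type*} [Ring A] [HopfAlgebra ℂ A]

theorem sw_average_mul {y : A} (hy : ∀ h, h * y = (ε h : ℂ) • y) (P : A →ₗ[ℂ] A) (h x : A) :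
    sw (fun a b => a * P (S b * (h * x))) y = h * sw (fun a b => a * P (S b * x)) y := by
  have key := sw_coassoc (T := fun u v w : A =>
    sw (fun a b => (u * a) * P (S (v * b) * (w * x))) y) h
  have h1 : ∀ a b : A, sw (fun c d => sw (fun a' b' => (c * a') * P (S (d * b') * (b * x))) y) a
      = (ε a : ℂ) • sw (fun c d => c * P (S d * (b * x))) y := by
    intro a b
    rw [← sw_mul (f := fun c d => c * P (S d * (b * x))) a y, hy]
    exact IsLin.map_smul (f := fun z => sw (fun c d => c * P (S d * (b * x))) z) (by fun_prop) _ _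
  have h2 : ∀ a b : A, sw (fun c d => sw (fun a' b' => (a * a') * P (S (c * b') * (d * x))) y) b
      = (ε b : ℂ) • (a * sw (fun a' b' => a' * P (S b' * x)) y) := by
    intro a b
    rw [sw_comm, map_sw (L := fun z => a * z), sw_smul]
    refine sw_congr (fun a' b' => ?_) y
    have h3 : ∀ c d : A, (a * a') * P (S (c * b') * (d * x))
        = (a * a') * P (S b' * (S c * d * x)) := fun c d => by
      rw [S_mul]; simp only [mul_assoc]
    rw [sw_congr h3, sw_antipode_left' (f := fun z => (a * a') * P (S b' * (z * x))), one_mul,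
      mul_assoc]
  rw [sw_congr h1, sw_congr h2,
    sw_counit_left' (f := fun b => sw (fun c d => c * P (S d * (b * x))) y),
    sw_counit_right' (f := fun a => a * sw (fun a' b' => a' * P (S b' * x)) y)] at key
  exact key

theorem isSemisimpleRing_of_integral {y : A} (hy : ∀ h, h * y = (ε h : ℂ) • y)
    (hy1 : (ε y : ℂ) = 1) : IsSemisimpleRing A := by
  refine (isSemisimpleModule_iff A A).2 ⟨fun I => ?_⟩
  obtain ⟨π, hπ⟩ := LinearMap.exists_leftInverse_of_injective
    (I.restrictScalars ℂ).subtype (Submodule.ker_subtype _)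
  have hπ1 : ∀ x : A, x ∈ I → (π x : A) = x := fun x hx =>
    congrArg Subtype.val (LinearMap.congr_fun hπ ⟨x, hx⟩)
  obtain ⟨P, hP1, hP⟩ : ∃ P : A →ₗ[ℂ] A, (∀ x ∈ I, P x = x) ∧ ∀ x, P x ∈ I :=
    ⟨(I.restrictScalars ℂ).subtype ∘ₗ π, hπ1, fun x => (π x).2⟩
  have hmem : ∀ x, sw (fun a b => a * P (S b * x)) y ∈ I := fun x =>
    Submodule.sum_mem _ fun i _ => I.smul_mem _ (hP _)
  let f : A →ₗ[A] I :=
    { toFun := fun x => ⟨sw (fun a b => a * P (S b * x)) y, hmem x⟩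
      map_add' := fun x z => Subtype.ext
        (IsLin.map_add (f := fun x => sw (fun a b => a * P (S b * x)) y) (by fun_prop) x z)
      map_smul' := fun h x => Subtype.ext (sw_average_mul hy P h x) }
  refine ⟨LinearMap.ker f, LinearMap.isCompl_of_proj (f := f) fun x => Subtype.ext ?_⟩
  change sw (fun a b => a * P (S b * x)) y = x
  have h1 : ∀ a b : A, a * P (S b * x) = a * S b * x := fun a b => by
    rw [hP1 _ (show S b * (x : A) ∈ I from I.smul_mem _ x.2), mul_assoc]
  rw [sw_congr h1, sw_antipode_right' (f := fun z => z * (x : A)), hy1, one_smul, one_mul]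

end Maschke

end

/-! ### Trace formulas -/

section

section Sigma

variable {A : Type*} [Ring A] [HopfAlgebra ℂ A]

theorem sw_S_tau (χ : A →ₐ[ℂ] ℂ) (x : A) :
    sw (fun a b => S a * tau χ b) x = χ x • (1 : A) := by
  have h1 : ∀ a b : A, S a * tau χ b = sw (fun c d => χ d • (S a * c)) b := fun a b => by
    rw [tau_apply, map_sw (L := fun y => S a * y)]
    exact sw_congr (fun c d => mul_smul_comm _ _ _) b
  have h2 : ∀ w d : A, sw (fun a c => χ d • (S a * c)) w = (ε w : ℂ) • χ d • (1 : A) := fun w d =>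
    sw_antipode_left' (f := fun y => χ d • y) w
  rw [sw_congr h1, ← sw_coassoc (T := fun a c d => χ d • (S a * c)), sw_congr h2,
    sw_counit_left' (f := fun d => χ d • (1 : A))]

theorem ell_S (χ : A →ₐ[ℂ] ℂ) (x : A) : ell χ (S x) = S (tau (charInv χ) x) := by
  rw [ell_apply, sw_S, tau_apply, map_sw (L := fun y : A => S y)]
  exact sw_congr (fun a b => by rw [map_smul, charInv_apply]) x

variable (A) in
/-- The square of the antipode. -/
noncomputable def S2 : A →ₐ[ℂ] A :=
  AlgHom.ofLinearMap ((S : A →ₗ[ℂ] A) ∘ₗ S) (by simp) (by simp [S_mul])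

variable [Module.Finite ℂ A]

namespace Frob

variable (F : Frob A)

theorem trace_eq_sw (T : A →ₗ[ℂ] A) :
    LinearMap.trace ℂ A T = sw (fun a b => F.lam (S (T b) * a)) F.Λ := by
  have h : T = ∑ i ∈ (ℛ ℂ F.Λ).index,
      (F.lam ∘ₗ LinearMap.mulRight ℂ ((ℛ ℂ F.Λ).left i) ∘ₗ S).smulRight
        (T ((ℛ ℂ F.Λ).right i)) := by
    ext x
    have := F.sw_lam_S x
    conv_lhs => rw [← this]
    rw [sw, map_sum]
    simp
  conv_lhs => rw [h]
  rw [map_sum, sw]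
  refine Finset.sum_congr rfl fun i _ => ?_
  rw [LinearMap.trace_smulRight]
  simp

theorem S2_bijective (F : Frob A) : Function.Bijective (S2 A) :=
  ⟨fun _ _ h => F.S_injective (F.S_injective h), fun x => by
    obtain ⟨y, rfl⟩ := F.S_surjective x
    obtain ⟨z, rfl⟩ := F.S_surjective y
    exact ⟨z, rfl⟩⟩

/-- The inverse of the square of the antipode. -/
noncomputable def sigma (F : Frob A) : A ≃ₐ[ℂ] A := (AlgEquiv.ofBijective (S2 A) F.S2_bijective).symm

theorem S2_sigma (x : A) : S (S (F.sigma x)) = x :=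
  (AlgEquiv.ofBijective (S2 A) F.S2_bijective).apply_symm_apply x

theorem sigma_S2 (x : A) : F.sigma (S (S x)) = x :=
  (AlgEquiv.ofBijective (S2 A) F.S2_bijective).symm_apply_apply x

theorem trace_sigma_tau_mul (χ : A →ₐ[ℂ] ℂ) (z : A) :
    LinearMap.trace ℂ A (LinearMap.mulRight ℂ z ∘ₗ F.sigma.toLinearMap ∘ₗ (tau χ).toLinearMap) =
      χ F.Λ * F.lam (S z) := by
  rw [F.trace_eq_sw]
  have h1 : ∀ a b : A, F.lam (S ((LinearMap.mulRight ℂ z ∘ₗ F.sigma.toLinearMap ∘ₗ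
      (tau χ).toLinearMap) b) * a) = F.lam (S z * (S (F.sigma (tau χ b)) * a)) := fun a b => by
    simp [S_mul, mul_assoc]
  have h2 : sw (fun a b => S (F.sigma (tau χ b)) * a) F.Λ = χ F.Λ • (1 : A) := by
    apply F.S_injective
    rw [map_sw (L := fun y : A => S y), map_smul, S_one, ← sw_S_tau]
    exact sw_congr (fun a b => by rw [S_mul, S2_sigma]) _
  rw [sw_congr h1, ← map_sw (L := fun y => F.lam (S z * y)), h2]
  simp

omit [Module.Finite ℂ A] in
theorem char_Λ_eq_zero {χ : A →ₐ[ℂ] ℂ} (h : χ ≠ ε) : χ F.Λ = 0 := by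
  by_contra h0
  apply h
  ext x
  have := congrArg χ (F.mul_Λ x)
  rw [map_mul, map_smul, smul_eq_mul] at this
  exact mul_right_cancel₀ h0 this

theorem trace_sigma_tau_mul_eq_zero (hε : (ε F.Λ : ℂ) = 0) (χ : A →ₐ[ℂ] ℂ) (z : A) :
    LinearMap.trace ℂ A (LinearMap.mulRight ℂ z ∘ₗ F.sigma.toLinearMap ∘ₗ (tau χ).toLinearMap)
      = 0 := by
  rw [trace_sigma_tau_mul]
  by_cases h : χ = ε
  · rw [h, hε, zero_mul]
  · rw [F.char_Λ_eq_zero h, zero_mul]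

theorem antipode_pow_eq_one {r : ℕ} (hg : F.g ^ r = 1) (hα : tau F.α ^ r = 1) :
    (S : Module.End ℂ A) ^ (4 * r) = 1 := by
  let s : Module.End ℂ A := S
  let t : Module.End ℂ A := (tau F.α).toLinearMap
  let l : Module.End ℂ A := (ell F.α).toLinearMap
  let L : Module.End ℂ A := LinearMap.mulLeft ℂ F.g
  let R : Module.End ℂ A := LinearMap.mulRight ℂ (S F.g)
  have hgg := F.isGroupLikeElem_g
  have ht : t ^ r = 1 := by
    have : ∀ k, t ^ k = (tau F.α ^ k).toLinearMap := by
      intro k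
      induction k with
      | zero => rfl
      | succ k ih => rw [pow_succ, pow_succ, ih]; rfl
    rw [this, hα]; rfl
  let t' : Module.End ℂ A := (tau (charInv F.α)).toLinearMap
  have htt : t * t' = 1 := LinearMap.ext fun x => tau_tau_charInv F.α x
  have htt' : t' * t = 1 := LinearMap.ext fun x => tau_charInv_tau F.α x
  have ht' : t' ^ r = 1 := by
    have hc : Commute t t' := by rw [Commute, SemiconjBy, htt, htt']
    have := hc.mul_pow r
    rwa [htt, one_pow, ht, one_mul, eq_comm] at this
  have hls : SemiconjBy s t' l := LinearMap.ext fun x => (ell_S F.α x).symm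
  have hl : l ^ r = 1 := by
    have := hls.pow_right r
    rw [ht', SemiconjBy, mul_one] at this
    ext x
    obtain ⟨y, rfl⟩ := F.S_surjective x
    exact (LinearMap.congr_fun this y).symm
  have key : s ^ 4 * l = (L * R) * t := by
    ext k
    rw [show s ^ 4 = s * (s * (s * s)) by simp only [pow_succ, pow_zero, one_mul, mul_assoc]]
    exact (F.radford k).trans (mul_assoc _ _ _)
  have hsl : Commute (s ^ 4) l := by
    have : Commute (s ^ 2) l := LinearMap.ext fun x => (ell_S_S F.α x).symm
    simpa [← pow_mul] using this.pow_left 2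
  have hα1 : F.α F.g * F.α (S F.g) = 1 := by
    rw [← map_mul, groupLike_mul_S hgg, map_one]
  have hLt : Commute (L * R) t := by
    refine LinearMap.ext fun x => ?_
    change F.g * (tau F.α x * S F.g) = tau F.α (F.g * (x * S F.g))
    have h1 : tau F.α (S F.g) = F.α (S F.g) • S F.g := by
      rw [tau_apply, sw_S, sw_groupLike hgg]
    rw [map_mul, map_mul, tau_groupLike F.α hgg, h1]
    simp only [smul_mul_assoc, mul_smul_comm, smul_smul]
    rw [mul_comm (F.α (S F.g)), hα1, one_smul]
  have hLR : Commute L R := LinearMap.ext fun x => (mul_assoc F.g x (S F.g)).symm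
  have hL : L ^ r = 1 := by
    rw [LinearMap.pow_mulLeft, hg, LinearMap.mulLeft_one]; rfl
  have hR : R ^ r = 1 := by
    have : (S F.g) ^ r = 1 := by
      have hc : Commute F.g (S F.g) := by
        rw [Commute, SemiconjBy, groupLike_mul_S hgg, S_mul_groupLike hgg]
      have := hc.mul_pow r
      rwa [groupLike_mul_S hgg, one_pow, hg, one_mul, eq_comm] at this
    rw [LinearMap.pow_mulRight, this, LinearMap.mulRight_one]; rfl
  have := congrArg (· ^ r) key
  simp only [hsl.mul_pow, hLt.mul_pow, hLR.mul_pow, hL, hR, ht, hl, mul_one, ← pow_mul] at this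
  exact this

end Frob
end Sigma

end

/-! ### The dual Hopf algebra -/

section

section DualHopf

variable {A : Type*} [Ring A] [HopfAlgebra ℂ A]

variable (A) in
/-- The linear dual, with the convolution product. -/
def HDual : Type _ := WithConv (A →ₗ[ℂ] ℂ)

noncomputable instance : Ring (HDual A) := inferInstanceAs (Ring (WithConv (A →ₗ[ℂ] ℂ)))

noncomputable instance : Algebra ℂ (HDual A) :=
  inferInstanceAs (Algebra ℂ (WithConv (A →ₗ[ℂ] ℂ)))

theorem HDual.ext {f g : HDual A} (h : ∀ x, f.ofConv x = g.ofConv x) : f = g :=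
  WithConv.ext (LinearMap.ext h)

theorem conv_apply (f g : HDual A) (x : A) :
    (f * g).ofConv x = sw (fun a b => f.ofConv a * g.ofConv b) x := by
  have := (ℛ ℂ x).convMul_apply f g
  exact this

theorem conv_one_apply (x : A) : (1 : HDual A).ofConv x = ε x := rfl

variable (A) in
/-- Evaluation at an element, as a functional on the dual. -/
noncomputable def dualEval : A →ₗ[ℂ] HDual A →ₗ[ℂ] ℂ where
  toFun x := { toFun := fun f => f.ofConv x, map_add' := fun _ _ => rfl, map_smul' := fun _ _ => rfl }
  map_add' x y := LinearMap.ext fun f => f.ofConv.map_add x y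
  map_smul' c x := LinearMap.ext fun f => f.ofConv.map_smul c x

@[simp] theorem dualEval_apply (x : A) (f : HDual A) : dualEval A x f = f.ofConv x := rfl

variable (A) in
/-- The transpose of right multiplication on the dual: `(x, f) ↦ f (x * ·)`. -/
noncomputable def dualAct : A →ₗ[ℂ] HDual A →ₗ[ℂ] HDual A where
  toFun x :=
    { toFun := fun f => .toConv (f.ofConv ∘ₗ LinearMap.mulLeft ℂ x)
      map_add' := fun _ _ => rfl
      map_smul' := fun _ _ => rfl }
  map_add' x y := LinearMap.ext fun f => HDual.ext (fun z => (congrArg f.ofConv (add_mul x y z)).trans (map_add f.ofConv _ _))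
  map_smul' c x := LinearMap.ext fun f => HDual.ext (fun z => (congrArg f.ofConv (smul_mul_assoc c x z)).trans (map_smul f.ofConv _ _))

@[simp] theorem dualAct_apply (x y : A) (f : HDual A) :
    (dualAct A x f).ofConv y = f.ofConv (x * y) := rfl

variable [Module.Finite ℂ A]

variable (A) in
/-- The dual functionals of a chosen basis. -/
noncomputable def dualCoord (i : Module.Free.ChooseBasisIndex ℂ A) : HDual A :=
  .toConv ((Module.Free.chooseBasis ℂ A).coord i)

theorem sum_dualCoord {M : Type*} [AddCommGroup M] [Module ℂ M] (L : A →ₗ[ℂ] M) (x : A) :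
    ∑ i, (dualCoord A i).ofConv x • L (Module.Free.chooseBasis ℂ A i) = L x := by
  conv_rhs => rw [← (Module.Free.chooseBasis ℂ A).sum_repr x]
  rw [map_sum]
  exact Finset.sum_congr rfl fun i _ => (map_smul L _ _).symm

theorem sum_dualCoord' (f : HDual A) :
    ∑ i, f.ofConv (Module.Free.chooseBasis ℂ A i) • dualCoord A i = f := by
  refine HDual.ext (fun x => ?_)
  change dualEval A x _ = f.ofConv x
  rw [map_sum, ← sum_dualCoord f.ofConv x]
  exact Finset.sum_congr rfl fun i _ => by simp [mul_comm]

noncomputable instance dualCoalgebraStruct : CoalgebraStruct ℂ (HDual A) where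
  comul := ∑ i, (TensorProduct.mk ℂ _ _ (dualCoord A i)) ∘ₗ
    dualAct A (Module.Free.chooseBasis ℂ A i)
  counit := dualEval A 1

theorem dual_comul (f : HDual A) : comul (R := ℂ) f =
    ∑ i, dualCoord A i ⊗ₜ[ℂ] dualAct A (Module.Free.chooseBasis ℂ A i) f := by
  simp [comul]

theorem dual_counit (f : HDual A) : counit (R := ℂ) f = f.ofConv 1 := rfl

omit [Module.Finite ℂ A] in
theorem dualAct_mul (x y : A) (f : HDual A) :
    dualAct A (x * y) f = dualAct A y (dualAct A x f) :=
  HDual.ext (fun z => congrArg f.ofConv (mul_assoc x y z))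

noncomputable instance dualCoalgebra : Coalgebra ℂ (HDual A) where
  coassoc := by
    ext f : 1
    simp only [LinearMap.comp_apply, dual_comul, map_sum, LinearMap.rTensor_tmul,
      LinearMap.lTensor_tmul, LinearEquiv.coe_coe, TensorProduct.sum_tmul, TensorProduct.tmul_sum,
      TensorProduct.assoc_tmul]
    rw [Finset.sum_comm]
    refine Finset.sum_congr rfl fun j _ => ?_
    rw [← TensorProduct.tmul_sum, ← TensorProduct.tmul_sum]
    congr 1
    set b := Module.Free.chooseBasis ℂ A
    have h : ∀ i, dualAct A (b j) (dualCoord A i) ⊗ₜ[ℂ] dualAct A (b i) f =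
        ∑ k, dualCoord A k ⊗ₜ[ℂ] ((dualCoord A i).ofConv (b j * b k) • dualAct A (b i) f) := by
      intro i
      conv_lhs => rw [← sum_dualCoord' (dualAct A (b j) (dualCoord A i)), TensorProduct.sum_tmul]
      exact Finset.sum_congr rfl fun k _ => by rw [TensorProduct.smul_tmul]; rfl
    rw [Finset.sum_congr rfl fun i _ => h i, Finset.sum_comm]
    refine Finset.sum_congr rfl fun k _ => ?_
    rw [← TensorProduct.tmul_sum, ← dualAct_mul]
    congr 1
    exact sum_dualCoord ((dualAct A).flip f) (b j * b k)
  rTensor_counit_comp_comul := by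
    ext f : 1
    simp only [LinearMap.comp_apply, dual_comul, map_sum, LinearMap.rTensor_tmul, dual_counit,
      TensorProduct.mk_apply]
    have := sum_dualCoord ((dualAct A).flip f) 1
    have h1 : (dualAct A).flip f 1 = f :=
      HDual.ext (fun z => congrArg f.ofConv (one_mul z))
    rw [h1] at this
    conv_rhs => rw [← this, TensorProduct.tmul_sum]
    refine Finset.sum_congr rfl fun i _ => ?_
    rw [← TensorProduct.smul_tmul, smul_eq_mul, mul_one]; rfl
  lTensor_counit_comp_comul := by
    ext f : 1
    simp only [LinearMap.comp_apply, dual_comul, map_sum, LinearMap.lTensor_tmul, dual_counit,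
      LinearMap.flip_apply, TensorProduct.mk_apply]
    conv_rhs => rw [← sum_dualCoord' f, TensorProduct.sum_tmul]
    refine Finset.sum_congr rfl fun i _ => ?_
    rw [TensorProduct.smul_tmul, smul_eq_mul, mul_one, dualAct_apply, mul_one]

/-- The pairing of `D ⊗ D` with a pair of elements. -/
noncomputable def dualPair (x y : A) :
    HDual A ⊗[ℂ] HDual A →ₗ[ℂ] ℂ :=
  LinearMap.mul' ℂ ℂ ∘ₗ TensorProduct.map (dualEval A x) (dualEval A y)

omit [Module.Finite ℂ A] in
@[simp] theorem dualPair_tmul (x y : A) (f g : HDual A) :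
    dualPair x y (f ⊗ₜ g) = f.ofConv x * g.ofConv y := rfl

theorem dualPair_comul (x y : A) (f : HDual A) :
    dualPair x y (comul f) = f.ofConv (x * y) := by
  rw [dual_comul, map_sum]
  exact sum_dualCoord (f.ofConv ∘ₗ LinearMap.mulRight ℂ y) x

theorem dualPair_injective {s t : HDual A ⊗[ℂ] HDual A}
    (h : ∀ x y, dualPair x y s = dualPair x y t) : s = t := by
  set b := Module.Free.chooseBasis ℂ A
  have key : ∀ s : HDual A ⊗[ℂ] HDual A,
      s = ∑ i, ∑ j, dualPair (b i) (b j) s • (dualCoord A i ⊗ₜ[ℂ] dualCoord A j) := by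
    intro s
    induction s with
    | zero => simp
    | add s t hs ht =>
      conv_lhs => rw [hs, ht]
      simp only [map_add, add_smul, Finset.sum_add_distrib]
    | tmul f g =>
      conv_lhs => rw [← sum_dualCoord' f, ← sum_dualCoord' g]
      simp only [TensorProduct.sum_tmul, TensorProduct.tmul_sum, TensorProduct.smul_tmul_smul,
        dualPair_tmul, b]
      rw [Finset.sum_comm]
  rw [key s, key t]
  simp only [h]

omit [Module.Finite ℂ A] in
theorem dualPair_mul (x y : A) (s t : HDual A ⊗[ℂ] HDual A) :
    dualPair x y (s * t) =
      sw (fun a b => sw (fun c d => dualPair a c s * dualPair b d t) y) x := by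
  induction s with
  | zero => simp [sw]
  | add s s' hs hs' =>
    rw [add_mul, map_add, hs, hs']
    simp [sw, add_mul, Finset.sum_add_distrib]
  | tmul f g =>
    induction t with
    | zero => simp [sw]
    | add t t' ht ht' =>
      rw [mul_add, map_add, ht, ht']
      simp [sw, mul_add, Finset.sum_add_distrib]
    | tmul f' g' =>
      rw [Algebra.TensorProduct.tmul_mul_tmul, dualPair_tmul, conv_apply, conv_apply, sw_mul_const]
      refine sw_congr (fun a b => ?_) x
      rw [sw_const_mul]
      refine sw_congr (fun c d => ?_) y
      simp; ring

noncomputable instance dualBialgebra : Bialgebra ℂ (HDual A) :=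
  Bialgebra.mk' ℂ _ (by rw [dual_counit, conv_one_apply, map_one])
    (by
      intro f g
      rw [dual_counit, conv_apply, sw_one]; rfl)
    (by
      refine dualPair_injective fun x y => ?_
      rw [dualPair_comul, Algebra.TensorProduct.one_def, dualPair_tmul]
      simp only [conv_one_apply, map_mul])
    (by
      intro f g
      refine dualPair_injective fun x y => ?_
      rw [dualPair_comul, conv_apply, dualPair_mul, sw_mul]
      simp only [dualPair_comul])

/-- The transpose of the antipode. -/
noncomputable def dualS : HDual A →ₗ[ℂ] HDual A where
  toFun f := .toConv (f.ofConv ∘ₗ S)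
  map_add' _ _ := rfl
  map_smul' _ _ := rfl

noncomputable instance dualHopf : HopfAlgebra ℂ (HDual A) where
  antipode := dualS
  mul_antipode_rTensor_comul := by
    refine LinearMap.ext fun f => HDual.ext (fun x => ?_)
    have h : ∀ t, (LinearMap.mul' ℂ _ (LinearMap.rTensor _ dualS t) :
        HDual A).ofConv x = sw (fun a b => dualPair (S a) b t) x := by
      intro t
      induction t with
      | zero => rw [map_zero, map_zero]; simp only [map_zero, sw, Finset.sum_const_zero]; rfl
      | add s t hs ht =>
        rw [map_add, map_add]
        refine (congrArg₂ (· + ·) hs ht).trans ?_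
        simp [sw, Finset.sum_add_distrib]
      | tmul f g => rw [LinearMap.rTensor_tmul, LinearMap.mul'_apply, conv_apply]; rfl
    simp only [LinearMap.comp_apply]
    rw [h]
    simp only [dualPair_comul]
    rw [sw_antipode_left' (f := fun y => f.ofConv y), Algebra.linearMap_apply, Algebra.algebraMap_eq_smul_one]
    exact mul_comm _ _
  mul_antipode_lTensor_comul := by
    refine LinearMap.ext fun f => HDual.ext (fun x => ?_)
    have h : ∀ t, (LinearMap.mul' ℂ _ (LinearMap.lTensor _ dualS t) :
        HDual A).ofConv x = sw (fun a b => dualPair a (S b) t) x := by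
      intro t
      induction t with
      | zero => rw [map_zero, map_zero]; simp only [map_zero, sw, Finset.sum_const_zero]; rfl
      | add s t hs ht =>
        rw [map_add, map_add]
        refine (congrArg₂ (· + ·) hs ht).trans ?_
        simp [sw, Finset.sum_add_distrib]
      | tmul f g => rw [LinearMap.lTensor_tmul, LinearMap.mul'_apply, conv_apply]; rfl
    simp only [LinearMap.comp_apply]
    rw [h]
    simp only [dualPair_comul]
    rw [sw_antipode_right' (f := fun y => f.ofConv y), Algebra.linearMap_apply, Algebra.algebraMap_eq_smul_one]
    exact mul_comm _ _

variable (A) in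
noncomputable def dualLinearEquiv : Module.Dual ℂ A ≃ₗ[ℂ] HDual A where
  toFun := .toConv
  invFun := fun f => f.ofConv
  map_add' _ _ := rfl
  map_smul' _ _ := rfl

instance dualFinite : Module.Finite ℂ (HDual A) := Module.Finite.equiv (dualLinearEquiv A)

omit [Module.Finite ℂ A] in
theorem finrank_dual : Module.finrank ℂ (HDual A) = Module.finrank ℂ A := by
  rw [← (dualLinearEquiv A).finrank_eq, Subspace.dual_finrank_eq]

theorem dual_S_pow_apply (k : ℕ) (f : HDual A) (x : A) :
    (((S : Module.End ℂ (HDual A)) ^ k) f).ofConv x =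
      f.ofConv (((S : Module.End ℂ A) ^ k) x) := by
  induction k generalizing f with
  | zero => rfl
  | succ k ih =>
    rw [pow_succ, pow_succ']
    exact ih (S f)

/-- The character of the dual given by evaluation at a group-like element. -/
noncomputable def evalChar {g : A} (hg : IsGroupLikeElem ℂ g) : HDual A →ₐ[ℂ] ℂ :=
  AlgHom.ofLinearMap (dualEval A g) (by rw [dualEval_apply, conv_one_apply]; exact hg.counit_eq_one)
    (by intro f h; rw [dualEval_apply, conv_apply, sw_groupLike hg]; rfl)

theorem tau_evalChar_pow_apply {g : A} (hg : IsGroupLikeElem ℂ g) (k : ℕ) (f : HDual A)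
    (x : A) : ((tau (evalChar hg) ^ k) f).ofConv x = f.ofConv (x * g ^ k) := by
  induction k generalizing f x with
  | zero => rw [pow_zero, pow_zero, mul_one]; rfl
  | succ k ih =>
    rw [pow_succ, AlgHom.mul_apply, ih, tau_apply]
    change dualEval A (x * g ^ k) _ = _
    rw [map_sw (L := fun z => dualEval A (x * g ^ k) z), pow_succ, ← mul_assoc,
      ← dualPair_comul, comul_eq_sw, map_sw (L := fun z => dualPair (x * g ^ k) g z)]
    exact sw_congr (fun a b => by rw [map_smul, smul_eq_mul, mul_comm]; rfl) f

theorem tau_evalChar_pow_eq_one_iff {g : A} (hg : IsGroupLikeElem ℂ g) (k : ℕ) :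
    tau (evalChar hg) ^ k = 1 ↔ g ^ k = 1 := by
  constructor
  · intro h
    rw [← sub_eq_zero, ← Module.forall_dual_apply_eq_zero_iff ℂ]
    intro f
    rw [map_sub, sub_eq_zero]
    have := tau_evalChar_pow_apply hg k (.toConv f) 1
    rw [h, one_mul] at this
    exact this.symm
  · intro h
    refine AlgHom.ext fun f => HDual.ext (fun x => ?_)
    rw [tau_evalChar_pow_apply, h, mul_one]; rfl

theorem orderOf_tau_evalChar {g : A} (hg : IsGroupLikeElem ℂ g) :
    orderOf (tau (evalChar hg)) = orderOf g :=
  orderOf_eq_orderOf_iff.2 fun k => tau_evalChar_pow_eq_one_iff hg k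

theorem Frob.dual_integral_eq_zero (F : Frob A) (hg : F.g ≠ 1) {y : HDual A}
    (hy : ∀ h, h * y = (ε h : ℂ) • y) : (ε y : ℂ) = 0 := by
  have h1 : F.lam 1 = 0 := by
    by_contra h0
    have := F.sw_lam_right 1
    rw [sw_one] at this
    exact hg (smul_right_injective A h0 this).symm
  have h2 : ∀ x, F.lam x * y.ofConv 1 = 0 := by
    intro x
    obtain ⟨l, hl⟩ : ∃ l : HDual A, ∀ x, l.ofConv x = F.lam x := ⟨.toConv F.lam, fun _ => rfl⟩
    have h3 := conv_apply l y x
    have h4 : (ε l : ℂ) = 0 := (hl 1).trans h1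
    rw [hy, h4, zero_smul] at h3
    have h5 := congrArg y.ofConv (F.sw_lam x)
    rw [map_sw (L := fun z => y.ofConv z), map_smul, smul_eq_mul] at h5
    rw [← h5]
    refine Eq.trans ?_ h3.symm
    exact sw_congr (fun a b => by simp [hl]) x
  have := h2 F.Λ
  rwa [F.lam_Λ, one_mul] at this

end DualHopf

end

/-! ### Irreducible representations -/

section

section Reps

/-- A complete list of irreducible matrix representations of a finite-dimensional algebra. -/
structure Reps (A : Type*) [Ring A] [Algebra ℂ A] where
  N : ℕ
  n : Fin N → ℕ
  pos : ∀ i, 0 < n i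
  rep : (i : Fin N) → A →ₐ[ℂ] Matrix (Fin (n i)) (Fin (n i)) ℂ
  surj : ∀ M : (i : Fin N) → Matrix (Fin (n i)) (Fin (n i)) ℂ, ∃ a, ∀ i, rep i a = M i
  nil : ∀ a, (∀ i, rep i a = 0) → IsNilpotent a

variable {A : Type*} [Ring A] [Algebra ℂ A]

theorem nonempty_reps (A : Type*) [Ring A] [Algebra ℂ A] [Module.Finite ℂ A] :
    Nonempty (Reps A) := by
  have : IsArtinianRing A := IsArtinianRing.of_finite ℂ A
  let Q := A ⧸ Ring.jacobson A
  have : IsSemisimpleRing Q := inferInstance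
  obtain ⟨N, n, hn, ⟨e⟩⟩ := IsSemisimpleRing.exists_algEquiv_pi_matrix_of_isAlgClosed ℂ Q
  let ρ : (i : Fin N) → A →ₐ[ℂ] Matrix (Fin (n i)) (Fin (n i)) ℂ := fun i =>
    (Pi.evalAlgHom ℂ (fun i => Matrix (Fin (n i)) (Fin (n i)) ℂ) i).comp
      ((e : Q →ₐ[ℂ] _).comp (Ideal.Quotient.mkₐ ℂ (Ring.jacobson A)))
  have key : ∀ a i, ρ i a = e (Ideal.Quotient.mk _ a) i := fun a i => rfl
  refine ⟨⟨N, n, fun i => Nat.pos_of_ne_zero (hn i).out, ρ, fun M => ?_, fun a ha => ?_⟩⟩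
  · obtain ⟨a, ha⟩ := Ideal.Quotient.mk_surjective (e.symm M)
    refine ⟨a, fun i => ?_⟩
    rw [key, ha, AlgEquiv.apply_symm_apply]
  · have h0 : e (Ideal.Quotient.mk _ a) = 0 := funext fun i => (key a i).symm.trans (ha i)
    have h1 : a ∈ Ring.jacobson A := by
      rw [← Ideal.Quotient.eq_zero_iff_mem]
      exact (map_eq_zero_iff _ e.injective).1 h0
    obtain ⟨k, hk⟩ := IsSemiprimaryRing.isNilpotent (R := A)
    refine ⟨k, ?_⟩
    have := Ideal.pow_mem_pow h1 k
    rwa [hk] at this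

namespace Reps
variable (R : Reps A)

/-- The character of an irreducible representation. -/
noncomputable def ch (i : Fin R.N) : A →ₗ[ℂ] ℂ :=
  (Matrix.traceLinearMap _ ℂ ℂ) ∘ₗ (R.rep i).toLinearMap

theorem ch_apply (i : Fin R.N) (a : A) : R.ch i a = (R.rep i a).trace := rfl

theorem ch_one (i : Fin R.N) : R.ch i 1 = R.n i := by simp [ch_apply]

theorem ch_mul_comm (i : Fin R.N) (a b : A) : R.ch i (a * b) = R.ch i (b * a) := by
  simp only [ch_apply, map_mul]; exact Matrix.trace_mul_comm _ _

theorem rep_surjective (i : Fin R.N) : Function.Surjective (R.rep i) := fun M => by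
  obtain ⟨a, ha⟩ := R.surj (Pi.single i M)
  exact ⟨a, by rw [ha, Pi.single_eq_same]⟩

/-- `e` is a primitive idempotent belonging to the `i`-th irreducible representation. -/
structure IsPrim (i : Fin R.N) (e : A) : Prop where
  idem : e * e = e
  rep_ne : ∀ j, j ≠ i → R.rep j e = 0
  tr : (R.rep i e).trace = 1

theorem IsPrim.ch_eq {R : Reps A} {i : Fin R.N} {e : A} (h : R.IsPrim i e) (j : Fin R.N) :
    R.ch j e = if j = i then 1 else 0 := by
  split_ifs with hj
  · subst hj; exact h.tr
  · rw [ch_apply, h.rep_ne j hj]; simp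

/-- Idempotents lift along the representations inside a subalgebra. -/
theorem exists_prim_of_mem (B : Subalgebra ℂ A) (i : Fin R.N)
    (M : Matrix (Fin (R.n i)) (Fin (R.n i)) ℂ)
    (hM : M * M = M) (hM1 : M.trace = 1) (x : A) (hx : x ∈ B) (hxi : R.rep i x = M)
    (hxj : ∀ j, j ≠ i → R.rep j x = 0) : ∃ e ∈ B, R.IsPrim i e := by
  let f : B →+* ((j : Fin R.N) → Matrix (Fin (R.n j)) (Fin (R.n j)) ℂ) :=
    (RingHom.pi fun j => ((R.rep j).comp B.val : B →+* _))
  have hf : ∀ b j, f b j = R.rep j b := fun b j => rfl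
  have hid : f ⟨x, hx⟩ * f ⟨x, hx⟩ = f ⟨x, hx⟩ := by
    funext j
    rw [Pi.mul_apply, hf]
    by_cases h : j = i
    · subst h; rw [hxi, hM]
    · rw [hxj j h, mul_zero]
  obtain ⟨e, he, he1⟩ := exists_isIdempotentElem_eq_of_ker_isNilpotent f (fun b hb => by
    obtain ⟨k, hk⟩ := R.nil b (fun j => by
      rw [← hf, (RingHom.mem_ker (f := f)).1 hb]; rfl)
    exact ⟨k, Subtype.ext (by simpa using hk)⟩) _ ⟨⟨x, hx⟩, rfl⟩ hid
  have h2 : ∀ j, R.rep j e = R.rep j x := fun j => congrFun he1 j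
  refine ⟨e, e.2, congrArg Subtype.val he, fun j hj => (h2 j).trans (hxj j hj), ?_⟩
  rw [h2, hxi, hM1]

theorem exists_prim (i : Fin R.N) : ∃ e, R.IsPrim i e := by
  obtain ⟨x, hx⟩ := R.surj (Pi.single i (Matrix.single ⟨0, R.pos i⟩ ⟨0, R.pos i⟩ 1))
  have hxi := hx i
  rw [Pi.single_eq_same] at hxi
  obtain ⟨e, -, he⟩ := R.exists_prim_of_mem ⊤ i _ (by simp)
    (by simp) x trivial hxi
    (fun j hj => by rw [hx, Pi.single_eq_of_ne hj])
  exact ⟨e, he⟩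

/-- A choice of primitive idempotents. -/
noncomputable def e (i : Fin R.N) : A := (R.exists_prim i).choose

theorem e_prim (i : Fin R.N) : R.IsPrim i (R.e i) := (R.exists_prim i).choose_spec

theorem ch_e (i j : Fin R.N) : R.ch j (R.e i) = if j = i then 1 else 0 := (R.e_prim i).ch_eq j

theorem ch_injective : Function.Injective R.ch := fun i j h => by
  have := R.ch_e i j
  rw [← h, R.ch_e, if_pos rfl] at this
  by_contra hij
  rw [if_neg (fun h => hij h.symm)] at this
  exact one_ne_zero this

/-- Traces of endomorphisms of a matrix algebra. -/
theorem _root_.Matrix.eq_smul_trace_of_comm {k : ℕ} (hk : 0 < k)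
    (f : Matrix (Fin k) (Fin k) ℂ →ₗ[ℂ] ℂ) (hf : ∀ x y, f (x * y) = f (y * x))
    (x : Matrix (Fin k) (Fin k) ℂ) : f x = f (Matrix.single ⟨0, hk⟩ ⟨0, hk⟩ 1) * x.trace := by
  set o : Fin k := ⟨0, hk⟩
  have h1 : ∀ a b, f (Matrix.single a b 1) = if a = b then f (Matrix.single o o 1) else 0 := by
    intro a b
    have h2 : Matrix.single a b (1 : ℂ) = Matrix.single a o 1 * Matrix.single o b 1 := by simp
    rw [h2, hf]
    split_ifs with hab
    · subst hab; simp
    · rw [Matrix.single_mul_single_of_ne _ _ _ _ (fun h => hab h.symm), map_zero]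
  generalize f (Matrix.single o o 1) = c at h1 ⊢
  conv_lhs => rw [Matrix.matrix_eq_sum_single x]
  have h3 : ∀ a b, Matrix.single a b (x a b) = x a b • Matrix.single a b (1 : ℂ) := by
    intro a b; simp
  simp only [map_sum, h3, map_smul, h1, smul_eq_mul, mul_ite, mul_zero, Finset.sum_ite_eq,
    Finset.mem_univ, if_true, Matrix.trace, Matrix.diag, Finset.mul_sum]
  exact Finset.sum_congr rfl fun a _ => mul_comm _ _

theorem traceForm_eq_sum (f : A →ₗ[ℂ] ℂ) (hf : ∀ a b, f (a * b) = f (b * a))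
    (hnil : ∀ a, IsNilpotent a → f a = 0) {e : Fin R.N → A} (he : ∀ i, R.IsPrim i (e i)) (a : A) :
    f a = ∑ i, f (e i) * R.ch i a := by
  have h0 : ∀ x y, (∀ i, R.rep i x = R.rep i y) → f x = f y := fun x y h => by
    rw [← sub_eq_zero, ← map_sub]
    exact hnil _ (R.nil _ fun i => by rw [map_sub, h, sub_self])
  choose s hs using fun i (M : Matrix (Fin (R.n i)) (Fin (R.n i)) ℂ) => R.surj (Pi.single i M)
  have hsingle : ∀ i, ∃ c : ℂ, ∀ x : Matrix (Fin (R.n i)) (Fin (R.n i)) ℂ,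
      f (s i x) = c * x.trace := by
    intro i
    let g : Matrix (Fin (R.n i)) (Fin (R.n i)) ℂ →ₗ[ℂ] ℂ :=
      { toFun := fun x => f (s i x)
        map_add' := fun x y => by
          rw [← map_add]
          exact h0 _ _ fun j => by rw [map_add, hs, hs, hs, Pi.single_add, Pi.add_apply]
        map_smul' := fun c x => by
          rw [RingHom.id_apply, ← map_smul]
          exact h0 _ _ fun j => by rw [map_smul, hs, hs, Pi.single_smul, Pi.smul_apply] }
    have hmul : ∀ x y, g (x * y) = f (s i x * s i y) := fun x y =>
      h0 _ _ fun j => by rw [map_mul, hs, hs, hs, Pi.single_mul, Pi.mul_apply]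
    exact ⟨_, Matrix.eq_smul_trace_of_comm (R.pos i) g fun x y => by rw [hmul, hmul, hf]⟩
  choose c hc using hsingle
  have h1 : ∀ x, f x = ∑ i, c i * R.ch i x := by
    intro x
    simp only [ch_apply, ← hc, ← map_sum]
    refine h0 _ _ fun j => ?_
    rw [map_sum, Finset.sum_eq_single j]
    · rw [hs, Pi.single_eq_same]
    · intro i _ hij
      rw [hs, Pi.single_eq_of_ne hij.symm]
    · simp
  have h2 : ∀ i, f (e i) = c i := fun i => by
    rw [h1]; simp [(he i).ch_eq]
  simp only [h2, ← h1]

theorem exists_twist {k : ℕ} (hk : 0 < k) (f : A →ₐ[ℂ] Matrix (Fin k) (Fin k) ℂ)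
    (hf : Function.Surjective f) :
    ∃ i, ∃ g : Matrix (Fin (R.n i)) (Fin (R.n i)) ℂ ≃ₐ[ℂ] Matrix (Fin k) (Fin k) ℂ,
      ∀ a, f a = g (R.rep i a) := by
  have : Nonempty (Fin k) := ⟨⟨0, hk⟩⟩
  have hJ : ∀ x, (∀ i, R.rep i x = 0) → f x = 0 := by
    intro x hx
    by_contra hne
    let T : TwoSidedIdeal (Matrix (Fin k) (Fin k) ℂ) := .mk' {y | ∃ a, (∀ i, R.rep i a = 0) ∧ f a = y}
      ⟨0, by simp, map_zero f⟩
      (by rintro _ _ ⟨a, ha, rfl⟩ ⟨b, hb, rfl⟩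
          exact ⟨a + b, fun i => by rw [map_add, ha, hb, add_zero], map_add _ _ _⟩)
      (by rintro _ ⟨a, ha, rfl⟩
          exact ⟨-a, fun i => by rw [map_neg, ha, neg_zero], map_neg _ _⟩)
      (by rintro y _ ⟨b, hb, rfl⟩
          obtain ⟨a, rfl⟩ := hf y
          exact ⟨a * b, fun i => by rw [map_mul, hb, mul_zero], map_mul _ _ _⟩)
      (by rintro _ y ⟨b, hb, rfl⟩
          obtain ⟨a, rfl⟩ := hf y
          exact ⟨b * a, fun i => by rw [map_mul, hb, zero_mul], map_mul _ _ _⟩)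
    have hT : ∀ y, y ∈ T ↔ ∃ a, (∀ i, R.rep i a = 0) ∧ f a = y := fun y => by
      simp only [T, TwoSidedIdeal.mem_mk', Set.mem_ofPred_eq]
    have h1 : T = ⊥ ∨ T = ⊤ := eq_bot_or_eq_top T
    rcases h1 with h | h
    · have : f x ∈ T := (hT _).2 ⟨x, hx, rfl⟩
      rw [h] at this
      exact hne (by simpa using this)
    · have : (1 : Matrix (Fin k) (Fin k) ℂ) ∈ T := by rw [h]; trivial
      obtain ⟨a, ha, ha1⟩ := (hT _).1 this
      have h3 : IsNilpotent (f a) := (R.nil a ha).map f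
      rw [ha1] at h3
      exact not_isNilpotent_one h3
  have h0 : ∀ x y, (∀ i, R.rep i x = R.rep i y) → f x = f y := fun x y h => by
    rw [← sub_eq_zero, ← map_sub]
    exact hJ _ fun i => by rw [map_sub, h, sub_self]
  choose c hc using fun i => R.surj (Pi.single i 1)
  have hc1 : ∀ i a j, R.rep j (c i * a) = if j = i then R.rep j a else 0 := by
    intro i a j
    rw [map_mul, hc]
    split_ifs with h
    · subst h; rw [Pi.single_eq_same, one_mul]
    · rw [Pi.single_eq_of_ne h, zero_mul]
  have hcomm : ∀ i y, Commute (f (c i)) y := by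
    intro i y
    obtain ⟨a, rfl⟩ := hf y
    change f (c i) * f a = f a * f (c i)
    rw [← map_mul, ← map_mul]
    refine h0 _ _ fun j => ?_
    rw [hc1, map_mul, hc]
    split_ifs with h
    · subst h; rw [Pi.single_eq_same, mul_one]
    · rw [Pi.single_eq_of_ne h, mul_zero]
  have hsum : ∑ i, f (c i) = 1 := by
    rw [← map_sum, ← map_one f]
    refine h0 _ _ fun j => ?_
    rw [map_sum, Finset.sum_eq_single j]
    · rw [hc, Pi.single_eq_same, map_one]
    · intro i _ hij
      rw [hc, Pi.single_eq_of_ne hij.symm]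
    · simp
  obtain ⟨i, hi⟩ : ∃ i, f (c i) ≠ 0 := by
    by_contra! h
    simp [h] at hsum
  obtain ⟨z, hz⟩ : ∃ z : ℂ, f (c i) = z • 1 := by
    have := (Matrix.mem_range_scalar_iff_commute_single' (M := f (c i))).2
      (fun a b => (hcomm i _).symm)
    obtain ⟨z, hz⟩ := this
    exact ⟨z, by rw [← hz]; simp [Matrix.smul_one_eq_diagonal]⟩
  have hz0 : z ≠ 0 := by rintro rfl; exact hi (by rw [hz, zero_smul])
  have hker : ∀ a, R.rep i a = 0 → f a = 0 := by
    intro a ha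
    have h1 : f (c i * a) = 0 := hJ _ fun j => by
      rw [hc1]
      split_ifs with h
      · subst h; exact ha
      · rfl
    rw [map_mul, hz, smul_mul_assoc, one_mul] at h1
    exact (smul_eq_zero.1 h1).resolve_left hz0
  have hker' : ∀ a b, R.rep i a = R.rep i b → f a = f b := fun a b h => by
    rw [← sub_eq_zero, ← map_sub]
    exact hker _ (by rw [map_sub, h, sub_self])
  choose l hl using R.rep_surjective i
  let g : Matrix (Fin (R.n i)) (Fin (R.n i)) ℂ →ₐ[ℂ] Matrix (Fin k) (Fin k) ℂ :=
    AlgHom.ofLinearMap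
      { toFun := fun x => f (l x)
        map_add' := fun x y => by
          rw [← map_add]; exact hker' _ _ (by rw [map_add, hl, hl, hl])
        map_smul' := fun c x => by
          rw [RingHom.id_apply, ← map_smul]; exact hker' _ _ (by rw [map_smul, hl, hl]) }
      (by rw [← map_one f]; exact hker' _ _ (by rw [hl, map_one]))
      (fun x y => by
        change f _ = f _ * f _
        rw [← map_mul]; exact hker' _ _ (by rw [map_mul, hl, hl, hl]))
  have hg : ∀ a, g (R.rep i a) = f a := fun a => hker' _ _ (hl _)
  have : Nonempty (Fin (R.n i)) := ⟨⟨0, R.pos i⟩⟩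
  exact ⟨i, AlgEquiv.ofBijective g ⟨g.toRingHom.injective, fun y => by
    obtain ⟨a, rfl⟩ := hf y; exact ⟨_, hg a⟩⟩, fun a => (hg a).symm⟩

theorem exists_ch_eq {k : ℕ} (hk : 0 < k) (f : A →ₐ[ℂ] Matrix (Fin k) (Fin k) ℂ)
    (hf : Function.Surjective f) :
    ∃ i, R.n i = k ∧ (∀ a, (f a).trace = R.ch i a) ∧ ∀ a, R.rep i a = 0 → f a = 0 := by
  obtain ⟨i, g, hg⟩ := R.exists_twist hk f hf
  have hik : R.n i = k := by
    have := g.toLinearEquiv.finrank_eq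
    simp only [Module.finrank_matrix, Module.finrank_self, Fintype.card_fin, mul_one] at this
    nlinarith
  refine ⟨i, hik, fun a => ?_, fun a ha => by rw [hg, ha, map_zero]⟩
  subst hik
  rw [hg, Matrix.trace_map', ch_apply]

end Reps
end Reps

end

/-! ### Automorphisms acting on irreducible representations -/

section

section Traces

/-- The operator `φ ↦ X * φ * Y` on matrices. -/
noncomputable def sandwich {k l : ℕ} (X : Matrix (Fin k) (Fin k) ℂ) (Y : Matrix (Fin l) (Fin l) ℂ) :
    Module.End ℂ (Matrix (Fin k) (Fin l) ℂ) where
  toFun φ := X * φ * Y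
  map_add' a b := by rw [Matrix.mul_add, Matrix.add_mul]
  map_smul' c a := by simp

theorem trace_sandwich {k l : ℕ} (X : Matrix (Fin k) (Fin k) ℂ) (Y : Matrix (Fin l) (Fin l) ℂ) :
    LinearMap.trace ℂ _ (sandwich X Y) = X.trace * Y.trace := by
  rw [LinearMap.trace_eq_matrix_trace ℂ (Matrix.stdBasis ℂ (Fin k) (Fin l))]
  simp only [Matrix.trace, Matrix.diag, LinearMap.toMatrix_apply, Fintype.sum_prod_type,
    Finset.sum_mul_sum]
  refine Finset.sum_congr rfl fun a _ => Finset.sum_congr rfl fun b _ => ?_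
  rw [Matrix.stdBasis_eq_single]
  have : ∀ M : Matrix (Fin k) (Fin l) ℂ, (Matrix.stdBasis ℂ (Fin k) (Fin l)).repr M (a, b) = M a b :=
    fun M => rfl
  rw [this]
  change (X * Matrix.single a b (1 : ℂ) * Y) a b = _
  rw [Matrix.mul_apply, Finset.sum_eq_single b]
  · simp
  · intro c _ hc; simp [Matrix.mul_apply (M := X), hc.symm]
  · simp

theorem exists_restrict {V : Type*} [AddCommGroup V] [Module ℂ V] [Module.Finite ℂ V]
    (σ P : Module.End ℂ V) (hP : P * P = P) (h : σ * P = P * σ) :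
    ∃ T : Module.End ℂ (LinearMap.range P), (∀ w, (T w : V) = σ w) ∧
      LinearMap.trace ℂ _ T = LinearMap.trace ℂ _ (P * σ) := by
  have hmem : ∀ w ∈ LinearMap.range P, P w = w := by
    rintro _ ⟨v, rfl⟩; exact LinearMap.congr_fun hP v
  have hr : ∀ v, (P * σ) v ∈ LinearMap.range P := fun v => ⟨σ v, rfl⟩
  refine ⟨(P * σ).restrict (p := LinearMap.range P) (q := LinearMap.range P) fun v _ => hr v,
    fun w => ?_, LinearMap.trace_restrict_eq_of_forall_mem _ _ hr⟩
  rw [LinearMap.coe_restrict_apply, ← h, Module.End.mul_apply, hmem w w.2]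

/-- The average of the powers of an operator. -/
noncomputable def avg {V : Type*} [AddCommGroup V] [Module ℂ V] (σ : Module.End ℂ V) (K : ℕ) :
    Module.End ℂ V := (K : ℂ)⁻¹ • ∑ k ∈ Finset.range K, σ ^ k

section avg
variable {V : Type*} [AddCommGroup V] [Module ℂ V] {σ : Module.End ℂ V} {K : ℕ}

theorem avg_apply (x : V) : avg σ K x = (K : ℂ)⁻¹ • ∑ k ∈ Finset.range K, (σ ^ k) x := by
  simp [avg]

theorem mul_avg (h : σ ^ K = 1) : σ * avg σ K = avg σ K := by
  rw [avg, mul_smul_comm, Finset.mul_sum]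
  congr 1
  have h1 := Finset.sum_range_succ (fun k => σ ^ k) K
  rw [Finset.sum_range_succ', h, pow_zero] at h1
  rw [← add_right_cancel h1]
  exact Finset.sum_congr rfl fun k _ => (pow_succ' σ k).symm

end avg
end Traces

namespace Reps
variable {A : Type*} [Ring A] [Algebra ℂ A] (R : Reps A)

theorem exists_actFun (φ : A ≃ₐ[ℂ] A) (i : Fin R.N) :
    ∃ j, ∃ g : Matrix (Fin (R.n j)) (Fin (R.n j)) ℂ ≃ₐ[ℂ] Matrix (Fin (R.n i)) (Fin (R.n i)) ℂ,
      ∀ a, R.rep i (φ a) = g (R.rep j a) :=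
  R.exists_twist (R.pos i) ((R.rep i).comp φ) ((R.rep_surjective i).comp φ.surjective)

noncomputable def actFun (φ : A ≃ₐ[ℂ] A) (i : Fin R.N) : Fin R.N := (R.exists_actFun φ i).choose

theorem actFun_spec (φ : A ≃ₐ[ℂ] A) (i : Fin R.N) :
    ∃ g : Matrix (Fin (R.n (R.actFun φ i))) (Fin (R.n (R.actFun φ i))) ℂ ≃ₐ[ℂ]
      Matrix (Fin (R.n i)) (Fin (R.n i)) ℂ, ∀ a, R.rep i (φ a) = g (R.rep (R.actFun φ i) a) :=
  (R.exists_actFun φ i).choose_spec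

theorem n_actFun (φ : A ≃ₐ[ℂ] A) (i : Fin R.N) : R.n (R.actFun φ i) = R.n i := by
  obtain ⟨g, -⟩ := R.actFun_spec φ i
  have := g.toLinearEquiv.finrank_eq
  simp only [Module.finrank_matrix, Module.finrank_self, Fintype.card_fin, mul_one] at this
  nlinarith

theorem trace_algEquiv {k l : ℕ} (g : Matrix (Fin k) (Fin k) ℂ ≃ₐ[ℂ] Matrix (Fin l) (Fin l) ℂ)
    (x : Matrix (Fin k) (Fin k) ℂ) : (g x).trace = x.trace := by
  have := g.toLinearEquiv.finrank_eq
  simp only [Module.finrank_matrix, Module.finrank_self, Fintype.card_fin, mul_one] at this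
  obtain rfl : k = l := by nlinarith
  exact Matrix.trace_map' g x

theorem ch_actFun (φ : A ≃ₐ[ℂ] A) (i : Fin R.N) (a : A) :
    R.ch (R.actFun φ i) a = R.ch i (φ a) := by
  obtain ⟨g, hg⟩ := R.actFun_spec φ i
  rw [ch_apply, ch_apply, hg, trace_algEquiv]

/-- The permutation of the irreducible representations induced by an algebra automorphism. -/
noncomputable def act (φ : A ≃ₐ[ℂ] A) : Equiv.Perm (Fin R.N) where
  toFun := R.actFun φ
  invFun := R.actFun φ.symm
  left_inv i := R.ch_injective <| LinearMap.ext fun a => by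
    rw [ch_actFun, ch_actFun, AlgEquiv.apply_symm_apply]
  right_inv i := R.ch_injective <| LinearMap.ext fun a => by
    rw [ch_actFun, ch_actFun, AlgEquiv.symm_apply_apply]

theorem ch_act (φ : A ≃ₐ[ℂ] A) (i : Fin R.N) (a : A) : R.ch (R.act φ i) a = R.ch i (φ a) :=
  R.ch_actFun φ i a

theorem n_act (φ : A ≃ₐ[ℂ] A) (i : Fin R.N) : R.n (R.act φ i) = R.n i := R.n_actFun φ i

theorem act_spec (φ : A ≃ₐ[ℂ] A) (i : Fin R.N) :
    ∃ g : Matrix (Fin (R.n (R.act φ i))) (Fin (R.n (R.act φ i))) ℂ ≃ₐ[ℂ]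
      Matrix (Fin (R.n i)) (Fin (R.n i)) ℂ, ∀ a, R.rep i (φ a) = g (R.rep (R.act φ i) a) :=
  R.actFun_spec φ i

theorem act_eq_iff (φ : A ≃ₐ[ℂ] A) (i j : Fin R.N) :
    R.act φ i = j ↔ ∀ a, R.ch i (φ a) = R.ch j a :=
  ⟨fun h a => by rw [← h, ch_act], fun h => R.ch_injective <| LinearMap.ext fun a => by
    rw [ch_act, h]⟩

theorem act_mul (φ ψ : A ≃ₐ[ℂ] A) : R.act (φ * ψ) = R.act ψ * R.act φ :=
  Equiv.ext fun i => (R.act_eq_iff _ _ _).2 fun a => by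
    rw [Equiv.Perm.mul_apply, ch_act, ch_act, AlgEquiv.mul_apply]

theorem act_one : R.act 1 = 1 :=
  Equiv.ext fun i => (R.act_eq_iff _ _ _).2 fun a => by simp

theorem act_pow (φ : A ≃ₐ[ℂ] A) (k : ℕ) : R.act (φ ^ k) = R.act φ ^ k := by
  induction k with
  | zero => simp [act_one]
  | succ k ih => rw [pow_succ, act_mul, ih, pow_succ']

theorem exists_inner {φ : A ≃ₐ[ℂ] A} {i : Fin R.N} (h : R.act φ i = i) :
    ∃ t : (Fin (R.n i) → ℂ) ≃ₗ[ℂ] (Fin (R.n i) → ℂ),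
      ∀ a v, (R.rep i (φ a)).mulVec (t v) = t ((R.rep i a).mulVec v) := by
  obtain ⟨g, hg⟩ : ∃ g : Matrix (Fin (R.n i)) (Fin (R.n i)) ℂ ≃ₐ[ℂ]
      Matrix (Fin (R.n i)) (Fin (R.n i)) ℂ, ∀ a, R.rep i (φ a) = g (R.rep i a) := by
    have := R.act_spec φ i
    rwa [h] at this
  obtain ⟨t, ht⟩ := AlgEquiv.eq_linearEquivConjAlgEquiv
    ((Matrix.toLinAlgEquiv'.symm.trans g).trans Matrix.toLinAlgEquiv')
  refine ⟨t, fun a v => ?_⟩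
  have h1 := LinearMap.congr_fun (DFunLike.congr_fun ht (Matrix.toLinAlgEquiv' (R.rep i a))) (t v)
  simpa [LinearEquiv.conjAlgEquiv_apply, ← hg] using h1

theorem exists_fixed_prim {φ : A ≃ₐ[ℂ] A} {K : ℕ} (hK : 0 < K) (hφ : φ ^ K = 1) {i : Fin R.N}
    (h : R.act φ i = i) : ∃ e, R.IsPrim i e ∧ φ e = e := by
  obtain ⟨t, ht⟩ := R.exists_inner h
  have : Nonempty (Fin (R.n i)) := ⟨⟨0, R.pos i⟩⟩
  obtain ⟨l, hl⟩ := Module.End.exists_eigenvalue (t : Module.End ℂ (Fin (R.n i) → ℂ))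
  obtain ⟨v, hv⟩ := hl.exists_hasEigenvector
  have hv0 : v ≠ 0 := hv.2
  have htv : t v = l • v := hv.apply_eq_smul
  have hl0 : l ≠ 0 := by
    rintro rfl
    rw [zero_smul, LinearEquiv.map_eq_zero_iff] at htv
    exact hv0 htv
  have hK0 : (K : ℂ) ≠ 0 := by exact_mod_cast hK.ne'
  -- the rank one matrices with image spanned by `v`
  let P : A → Prop := fun a => (∀ j, j ≠ i → R.rep j a = 0) ∧
    (∃ f, R.rep i a = Matrix.vecMulVec v f) ∧ R.ch i a = 1
  have hP : ∀ a, P a → P (φ a) := by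
    rintro a ⟨h1, ⟨f, hf⟩, h3⟩
    refine ⟨fun j hj => ?_, ?_, ?_⟩
    · obtain ⟨g, hg⟩ := R.act_spec φ j
      rw [hg, h1, map_zero]
      exact fun h' => hj ((R.act φ).injective (h'.trans h.symm))
    · refine ⟨fun b => l * (f ⬝ᵥ t.symm (Pi.single b 1)), ?_⟩
      ext c b
      have h4 := congrFun (ht a (t.symm (Pi.single b 1))) c
      rw [LinearEquiv.apply_symm_apply, hf, Matrix.mulVec_single_one, Matrix.vecMulVec_mulVec,
        ] at h4
      simp only [Matrix.col_apply] at h4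
      rw [h4]
      simp [htv, Matrix.vecMulVec_apply]
      ring
    · rw [← R.ch_act, h, h3]
  have hPow : ∀ a, P a → ∀ k : ℕ, P ((φ.toLinearMap ^ k : Module.End ℂ A) a) := by
    intro a ha k
    induction k with
    | zero => exact ha
    | succ k ih => rw [pow_succ', Module.End.mul_apply]; exact hP _ ih
  obtain ⟨x0, hx0⟩ : ∃ x0, P x0 := by
    obtain ⟨c, hc⟩ := Function.ne_iff.1 hv0
    have hc : v c ≠ 0 := hc
    obtain ⟨x, hx⟩ := R.surj (Pi.single i (Matrix.vecMulVec v (Pi.single c (v c)⁻¹)))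
    have hxi := hx i
    rw [Pi.single_eq_same] at hxi
    refine ⟨x, fun j hj => by rw [hx, Pi.single_eq_of_ne hj], ⟨_, hxi⟩, ?_⟩
    rw [ch_apply, hxi, Matrix.trace_vecMulVec]
    simp [hc]
  have hφK : (φ.toLinearMap ^ K : Module.End ℂ A) = 1 := by
    have h1 : ∀ k : ℕ, (φ.toLinearMap ^ k : Module.End ℂ A) = (φ ^ k).toLinearMap := by
      intro k
      induction k with
      | zero => rfl
      | succ k ih => rw [pow_succ, pow_succ, ih]; rfl
    rw [h1, hφ]; rfl
  set x := avg φ.toLinearMap K x0 with hx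
  have hxs : x = (K : ℂ)⁻¹ • ∑ k ∈ Finset.range K, (φ.toLinearMap ^ k : Module.End ℂ A) x0 :=
    avg_apply _
  have hfix : φ x = x := LinearMap.congr_fun (mul_avg hφK) x0
  have hPx : P x := by
    choose f hf using fun k => (hPow x0 hx0 k).2.1
    refine ⟨fun j hj => ?_, ⟨(K : ℂ)⁻¹ • ∑ k ∈ Finset.range K, f k, ?_⟩, ?_⟩
    · rw [hxs, map_smul, map_sum, Finset.sum_eq_zero, smul_zero]
      exact fun k _ => (hPow x0 hx0 k).1 j hj
    · rw [hxs, map_smul, map_sum, Finset.sum_congr rfl fun k _ => hf k]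
      ext a b
      simp [Matrix.vecMulVec_apply, Matrix.sum_apply, Finset.mul_sum]
      exact Finset.sum_congr rfl fun k _ => by ring
    · rw [hxs, map_smul, map_sum, Finset.sum_congr rfl fun k _ => (hPow x0 hx0 k).2.2]
      simp [hK0]
  obtain ⟨h1, ⟨f, hf⟩, h3⟩ := hPx
  have hfv : f ⬝ᵥ v = 1 := by
    rw [ch_apply, hf, Matrix.trace_vecMulVec] at h3
    rw [← h3, dotProduct_comm]
  obtain ⟨e, he, hp⟩ := R.exists_prim_of_mem (AlgHom.equalizer (φ : A →ₐ[ℂ] A) (AlgHom.id ℂ A)) i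
    (R.rep i x) (by
      rw [hf, Matrix.vecMulVec_mul_vecMulVec, hfv, one_smul]) h3 x
    ((AlgHom.mem_equalizer _ _ _).2 hfix) rfl h1
  exact ⟨e, hp, (AlgHom.mem_equalizer _ _ _).1 he⟩

end Reps

end

/-! ### Multiplicities of irreducible representations -/

section

section Theta
variable {A : Type*} [Ring A] [HopfAlgebra ℂ A] 

/-- The trace of right multiplication. -/
noncomputable def theta (A : Type*) [Ring A] [Algebra ℂ A] : A →ₗ[ℂ] ℂ :=
  LinearMap.trace ℂ A ∘ₗ (LinearMap.mul ℂ A).flip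

theorem theta_apply {A : Type*} [Ring A] [Algebra ℂ A] (a : A) :
    theta A a = LinearMap.trace ℂ A (LinearMap.mulRight ℂ a) := rfl

theorem Frob.sw_lam_S_mul (F : Frob A) [Module.Finite ℂ A] (x z : A) :
    sw (fun a b => F.lam (S b * z) • a) x = sw (fun u v => F.lam (S x * u) • v) z := by
  have h1 : ∀ a b : A, F.lam (S b * z) • a =
      sw (fun c d => sw (fun u v => F.lam (S d * u) • (a * (S c * v))) z) b := by
    intro a b
    have := congrArg (a * ·) (F.sw_lam (S b * z))
    simp only [mul_smul_comm, mul_one] at this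
    rw [← this, map_sw (L := fun y => a * y), sw_mul, sw_S]
    simp only [mul_smul_comm]
  rw [sw_congr h1, ← sw_coassoc (T := fun a c d =>
    sw (fun u v => F.lam (S d * u) • (a * (S c * v))) z)]
  have h2 : ∀ w d : A, sw (fun a c => sw (fun u v => F.lam (S d * u) • (a * (S c * v))) z) w =
      counit (R := ℂ) w • sw (fun u v => F.lam (S d * u) • v) z := by
    intro w d
    have := sw_antipode_right (f := fun y => sw (fun u v => F.lam (S d * u) • (y * v)) z) w
    simpa [mul_assoc] using this
  rw [sw_congr h2, sw_counit_left (f := fun d => sw (fun u v => F.lam (S d * u) • v) z)]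

theorem Frob.theta_eq (F : Frob A) [Module.Finite ℂ A] (x : A) :
    theta A x = F.lam (S x * sw (fun a b => S b * a) F.Λ) := by
  rw [theta_apply, F.trace_eq_sw, map_sw (L := fun y => F.lam (S x * y))]
  simp [S_mul, mul_assoc]

theorem Frob.sw_mul_theta (F : Frob A) [Module.Finite ℂ A] (χ : A →ₗ[ℂ] ℂ)
    (hχ : ∀ a b, χ (a * b) = χ (b * a)) (x : A) :
    sw (fun a b => χ a * theta A b) x = χ 1 * theta A x := by
  set z := sw (fun a b => S b * a) F.Λ with hz
  have h1 : sw (fun a b => χ a * theta A b) x = sw (fun u v => F.lam (S x * u) * χ v) z := by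
    have := congrArg χ (F.sw_lam_S_mul x z)
    rw [map_sw (L := χ), map_sw (L := χ)] at this
    simp only [map_smul, smul_eq_mul] at this
    rw [← this]
    exact sw_congr (fun a b => by rw [F.theta_eq, mul_comm]) x
  rw [h1, F.theta_eq, hz, map_sw (L := fun z => sw (fun u v => F.lam (S x * u) * χ v) z),
    map_sw (L := fun y => χ 1 * F.lam (S x * y))]
  have h2 : ∀ a b : A, sw (fun u v => F.lam (S x * u) * χ v) (S b * a) =
      sw (fun a1 a2 => sw (fun b1 b2 => F.lam (S x * (S b2 * a1)) * χ (a2 * S b1)) b) a := by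
    intro a b
    rw [sw_mul, sw_S, sw_comm]
    exact sw_congr (fun c d => sw_congr (fun e f => by rw [hχ d]) b) a
  rw [sw_congr h2, sw_coassoc (T := fun a1 a2 b =>
    sw (fun b1 b2 => F.lam (S x * (S b2 * a1)) * χ (a2 * S b1)) b)]
  refine sw_congr (fun a w => ?_) F.Λ
  rw [← sw_coassoc (T := fun a2 b1 b2 => F.lam (S x * (S b2 * a)) * χ (a2 * S b1))]
  have h3 : ∀ w d : A, sw (fun a2 b1 => F.lam (S x * (S d * a)) * χ (a2 * S b1)) w =
      counit (R := ℂ) w • (F.lam (S x * (S d * a)) * χ 1) := fun w d =>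
    sw_antipode_right (f := fun y => F.lam (S x * (S d * a)) * χ y) w
  rw [sw_congr h3, sw_counit_left (f := fun d => F.lam (S x * (S d * a)) * χ 1), mul_comm]

/-- Multiplicities of idempotents in tensor products of representations. -/
theorem exists_natCast_eq {k l : ℕ} (f : A →ₐ[ℂ] Matrix (Fin k) (Fin k) ℂ)
    (g : A →ₗ[ℂ] Matrix (Fin l) (Fin l) ℂ) (hg : ∀ a b, g (a * b) = g b * g a)
    {e : A} (he : e * e = e) :
    ∃ N : ℕ, sw (fun a b => (f a).trace * (g b).trace) e = N ∧
      ((∃ φ : Matrix (Fin k) (Fin l) ℂ, φ ≠ 0 ∧ sw (fun a b => f a * φ * g b) e = φ) → 0 < N) := by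
  have hX : ∀ φ : Matrix (Fin k) (Fin l) ℂ, ∀ b, IsLin (fun a => f a * φ * g b) := fun φ b =>
    ⟨by simp [Matrix.add_mul], by simp⟩
  have hY : ∀ φ : Matrix (Fin k) (Fin l) ℂ, ∀ a, IsLin (fun b => f a * φ * g b) := fun φ b =>
    ⟨by simp [Matrix.mul_add], by simp⟩
  have hφ : ∀ a b, IsLin (fun φ : Matrix (Fin k) (Fin l) ℂ => f a * φ * g b) := fun a b =>
    ⟨by simp [Matrix.mul_add, Matrix.add_mul], by simp⟩
  let T : A → Module.End ℂ (Matrix (Fin k) (Fin l) ℂ) := fun x => sw (fun a b => sandwich (f a) (g b)) x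
  have hT : ∀ x φ, T x φ = sw (fun a b => f a * φ * g b) x := fun x φ => by
    simp only [T]
    exact map_sw (L := fun t : Module.End ℂ (Matrix (Fin k) (Fin l) ℂ) => t φ) _ x ⟨by simp, by simp⟩
  have hid : IsIdempotentElem (T e) := by
    refine LinearMap.ext fun φ => ?_
    rw [Module.End.mul_apply, hT, hT e φ, ← hT, ← hT]
    conv_rhs => rw [← he, hT, sw_mul _ _ (hX φ) (hY φ)]
    rw [hT, hT]
    refine sw_congr (fun a b => ?_) e
    rw [map_sw (L := fun ψ => f a * ψ * g b) _ _ (hφ a b)]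
    exact sw_congr (fun c d => by simp only [map_mul, hg, Matrix.mul_assoc]) e
  refine ⟨Module.finrank ℂ (LinearMap.range (T e)), ?_, fun ⟨φ, h0, h⟩ => ?_⟩
  · rw [← trace_idempotent hid, map_sw (L := LinearMap.trace ℂ (Matrix (Fin k) (Fin l) ℂ))]
    exact sw_congr (fun a b => (trace_sandwich _ _).symm) e
  · rw [Module.finrank_pos_iff, Submodule.nontrivial_iff_ne_bot]
    intro hb
    rw [LinearMap.range_eq_bot] at hb
    rw [← hT, hb] at h
    exact h0 h.symm

end Theta

namespace Reps
section Alg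
variable {A : Type*} [Ring A] [Algebra ℂ A] [Module.Finite ℂ A] (R : Reps A)

/-- The dimension of the projective cover of the `i`-th irreducible representation. -/
noncomputable def m (i : Fin R.N) : ℕ :=
  Module.finrank ℂ (LinearMap.range (LinearMap.mulRight ℂ (R.e i)))

omit [Module.Finite ℂ A] in
theorem mulRight_idem {e : A} (he : e * e = e) :
    LinearMap.mulRight ℂ e * LinearMap.mulRight ℂ e = LinearMap.mulRight ℂ e :=
  LinearMap.ext fun x => by simp [mul_assoc, he]

theorem theta_idem {e : A} (he : e * e = e) :
    theta A e = Module.finrank ℂ (LinearMap.range (LinearMap.mulRight ℂ e)) :=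
  trace_idempotent (mulRight_idem he)

omit [Module.Finite ℂ A] in
theorem theta_mul_comm (a b : A) : theta A (a * b) = theta A (b * a) := by
  have h : ∀ a b : A, LinearMap.mulRight ℂ (a * b) =
      LinearMap.mulRight ℂ b * LinearMap.mulRight ℂ a :=
    fun a b => LinearMap.ext fun x => by simp [mul_assoc]
  rw [theta_apply, theta_apply, h, h, LinearMap.trace_mul_comm]

omit [Module.Finite ℂ A] in
theorem isNilpotent_mulRight {a : A} (h : IsNilpotent a) : IsNilpotent (LinearMap.mulRight ℂ a) := by
  obtain ⟨k, hk⟩ := h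
  exact ⟨k, by rw [LinearMap.pow_mulRight, hk]; ext; simp⟩

theorem theta_eq_sum (a : A) : theta A a = ∑ i, (R.m i : ℂ) * R.ch i a := by
  rw [R.traceForm_eq_sum (theta A) theta_mul_comm (fun a ha =>
    (LinearMap.isNilpotent_trace_of_isNilpotent (isNilpotent_mulRight ha)).eq_zero) R.e_prim]
  exact Finset.sum_congr rfl fun i _ => by rw [theta_idem (R.e_prim i).idem, m]

theorem theta_e (i : Fin R.N) : theta A (R.e i) = R.m i := theta_idem (R.e_prim i).idem

theorem finrank_range_prim {i : Fin R.N} {e : A} (he : R.IsPrim i e) :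
    Module.finrank ℂ (LinearMap.range (LinearMap.mulRight ℂ e)) = R.m i := by
  have := theta_idem he.idem
  rw [R.theta_eq_sum] at this
  simp only [he.ch_eq, mul_ite, mul_one, mul_zero, Finset.sum_ite_eq', Finset.mem_univ,
    if_true] at this
  exact_mod_cast this.symm

theorem sum_n_mul_m : ∑ i, R.n i * R.m i = Module.finrank ℂ A := by
  have := R.theta_eq_sum 1
  rw [theta_apply, LinearMap.mulRight_one, ← Module.End.one_eq_id, LinearMap.trace_one] at this
  simp only [ch_one] at this
  rw [Finset.sum_congr rfl fun i _ => mul_comm _ _]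
  exact_mod_cast this.symm

theorem n_le_m (i : Fin R.N) : R.n i ≤ R.m i := by
  set E := R.rep i (R.e i) with hE
  have hEE : IsIdempotentElem (sandwich (1 : Matrix (Fin (R.n i)) (Fin (R.n i)) ℂ) E) :=
    LinearMap.ext fun x => by
      change 1 * (1 * x * E) * E = 1 * x * E
      rw [one_mul, one_mul, mul_assoc, hE, ← map_mul, (R.e_prim i).idem]
  have h1 := trace_idempotent hEE
  rw [trace_sandwich, (R.e_prim i).tr, Matrix.trace_one, mul_one, Fintype.card_fin] at h1
  have h1 := Nat.cast_injective h1
  rw [h1]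
  refine le_trans (Submodule.finrank_mono ?_) (Submodule.finrank_map_le (R.rep i).toLinearMap
    (LinearMap.range (LinearMap.mulRight ℂ (R.e i))))
  rintro _ ⟨x, rfl⟩
  obtain ⟨a, rfl⟩ := R.rep_surjective i x
  refine ⟨a * R.e i, ⟨a, rfl⟩, ?_⟩
  change R.rep i (a * R.e i) = 1 * R.rep i a * E
  rw [map_mul, one_mul]

theorem m_pos (i : Fin R.N) : 0 < R.m i := (R.pos i).trans_le (R.n_le_m i)

theorem m_act (φ : A ≃ₐ[ℂ] A) (i : Fin R.N) : R.m (R.act φ i) = R.m i := by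
  have h1 : theta A (φ (R.e (R.act φ i))) = theta A (R.e (R.act φ i)) := by
    rw [theta_apply, theta_apply]
    have : LinearMap.mulRight ℂ (φ (R.e (R.act φ i))) =
        φ.toLinearEquiv.conj (LinearMap.mulRight ℂ (R.e (R.act φ i))) := by
      ext x; simp [LinearEquiv.conj_apply]
    rw [this, LinearMap.trace_conj']
  rw [theta_e, R.theta_eq_sum] at h1
  have h2 : ∀ j, R.ch j (φ (R.e (R.act φ i))) = if j = i then 1 else 0 := by
    intro j
    rw [← ch_act, ch_e]
    simp
  simp only [h2, mul_ite, mul_one, mul_zero, Finset.sum_ite_eq', Finset.mem_univ, if_true] at h1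
  exact_mod_cast h1.symm

/-- The automorphism induced on the projective cover of a fixed irreducible representation. -/
theorem exists_restrict_of_act_eq {φ : A ≃ₐ[ℂ] A} {K : ℕ} (hK : 0 < K) (hφ : φ ^ K = 1)
    {i : Fin R.N} (h : R.act φ i = i) :
    ∃ e, R.IsPrim i e ∧ φ e = e ∧ ∃ T : Module.End ℂ (LinearMap.range (LinearMap.mulRight ℂ e)),
      (∀ w, (T w : A) = φ w) ∧
      LinearMap.trace ℂ _ T = LinearMap.trace ℂ A (LinearMap.mulRight ℂ e ∘ₗ φ.toLinearMap) := by
  obtain ⟨e, he, hφe⟩ := R.exists_fixed_prim hK hφ h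
  exact ⟨e, he, hφe, exists_restrict φ.toLinearMap _ (mulRight_idem he.idem)
    (LinearMap.ext fun x => by simp [hφe])⟩

end Alg
end Reps

end

/-! ### Non-semisimple Hopf algebras with a character of prime order -/

section

section Lin
variable {V : Type*} [AddCommGroup V] [Module ℂ V] [FiniteDimensional ℂ V]

theorem exists_trace_involution {X : Module.End ℂ V} (hX : X * X = 1) :
    ∃ a : ℕ, a ≤ Module.finrank ℂ V ∧
      LinearMap.trace ℂ V X = 2 * (a : ℂ) - Module.finrank ℂ V ∧
      (a = Module.finrank ℂ V → X = 1) ∧ (a = 0 → X = -1) := by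
  set P : Module.End ℂ V := (2⁻¹ : ℂ) • (1 + X) with hP
  have hX2 : X = (2 : ℂ) • P - 1 := by rw [hP, smul_smul]; norm_num
  have hPP : IsIdempotentElem P := by
    rw [IsIdempotentElem, hP, smul_mul_smul_comm, mul_add, add_mul, add_mul, hX, one_mul, one_mul,
      mul_one, show (1 : Module.End ℂ V) + X + (X + 1) = (2 : ℂ) • (1 + X) by rw [two_smul]; abel,
      smul_smul]
    norm_num
  refine ⟨Module.finrank ℂ (LinearMap.range P), Submodule.finrank_le _, ?_, fun h => ?_, fun h => ?_⟩
  · rw [hX2, map_sub, map_smul, trace_idempotent hPP, LinearMap.trace_one, smul_eq_mul]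
  · have : P = 1 := LinearMap.ext fun v => by
      have hv : v ∈ LinearMap.range P := by
        rw [Submodule.eq_top_of_finrank_eq h]; trivial
      obtain ⟨w, rfl⟩ := hv
      exact LinearMap.congr_fun hPP w
    rw [hX2, this, two_smul]; abel
  · have : P = 0 := LinearMap.range_eq_bot.1 (Submodule.finrank_eq_zero.1 h)
    rw [hX2, this]; simp

theorem le_finrank_of_trace_eq_zero {r : ℕ} (hr : r.Prime) (hodd : Odd r) {T : Module.End ℂ V}
    (hT : T ^ (2 * r) = 1) (ht : LinearMap.trace ℂ V T = 0) (hV : Odd (Module.finrank ℂ V)) :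
    r ≤ Module.finrank ℂ V ∧
      (Module.finrank ℂ V = r → (∃ v, v ≠ 0 ∧ T v = v) → T ^ r = 1) := by
  obtain ⟨c, hc⟩ := exists_trace_pow_eq hr hodd hT ht
  obtain ⟨a, ha, htr, h1, h2⟩ := exists_trace_involution (X := T ^ r)
    (by rw [← pow_add, ← two_mul, hT])
  have key : (r : ℤ) * c = 2 * a - Module.finrank ℂ V := by
    rw [hc] at htr; exact_mod_cast htr
  have hr0 : 0 < r := hr.pos
  obtain ⟨k, hk⟩ := hV
  have hc0 : c ≠ 0 := by rintro rfl; omega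
  have hcr : (r : ℤ) ≤ |(r : ℤ) * c| := by
    rw [abs_mul, Nat.abs_cast]
    exact le_mul_of_one_le_right (by positivity) (Int.one_le_abs hc0)
  have hle : |(r : ℤ) * c| ≤ Module.finrank ℂ V := by rw [key, abs_le]; omega
  refine ⟨by omega, fun h ⟨v, hv, hTv⟩ => ?_⟩
  have hab : |(r : ℤ) * c| = r := by omega
  rcases eq_or_eq_neg_of_abs_eq hab with h' | h'
  · exact h1 (by omega)
  · exfalso
    have hneg := LinearMap.congr_fun (h2 (by omega)) v
    have hfix : ∀ k, (T ^ k) v = v := fun k => by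
      induction k with
      | zero => simp
      | succ k ih => rw [pow_succ, Module.End.mul_apply, hTv, ih]
    rw [hfix] at hneg
    have h2v : (2 : ℂ) • v = 0 := by
      rw [two_smul]; nth_rw 1 [hneg]; simp
    exact hv ((smul_eq_zero.1 h2v).resolve_left two_ne_zero)
end Lin

section tauE
variable {A : Type*} [Ring A] [HopfAlgebra ℂ A]

/-- Left translation by a character, as an automorphism. -/
noncomputable def tauE (χ : A →ₐ[ℂ] ℂ) : A ≃ₐ[ℂ] A :=
  AlgEquiv.ofAlgHom (tau χ) (tau (charInv χ))
    (AlgHom.ext (tau_tau_charInv χ)) (AlgHom.ext (tau_charInv_tau χ))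

theorem tauE_apply (χ : A →ₐ[ℂ] ℂ) (x : A) : tauE χ x = tau χ x := rfl

theorem tauE_pow_apply (χ : A →ₐ[ℂ] ℂ) (k : ℕ) (x : A) : (tauE χ ^ k) x = (tau χ ^ k) x := by
  induction k generalizing x with
  | zero => rfl
  | succ k ih => rw [pow_succ, pow_succ, AlgEquiv.mul_apply, ih]; rfl

end tauE

/-- A finite-dimensional Hopf algebra with a character of odd prime order `r` such that
`S ^ (4 * r) = 1` and whose left integrals have counit zero. -/
structure Datum (A : Type*) [Ring A] [HopfAlgebra ℂ A] where
  F : Frob A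
  R : Reps A
  χ : A →ₐ[ℂ] ℂ
  r : ℕ
  hr : r.Prime
  odd : Odd r
  ord : orderOf (tau χ) = r
  hS : (S : Module.End ℂ A) ^ (4 * r) = 1
  hε : ε F.Λ = 0

namespace Datum
variable {A : Type*} [Ring A] [HopfAlgebra ℂ A] [Module.Finite ℂ A] (D : Datum A)

noncomputable def τ : A ≃ₐ[ℂ] A := tauE D.χ
noncomputable def σ : A ≃ₐ[ℂ] A := D.F.sigma
noncomputable def π : Equiv.Perm (Fin D.R.N) := D.R.act D.τ
noncomputable def s : Equiv.Perm (Fin D.R.N) := D.R.act D.σ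

omit [Module.Finite ℂ A] in
theorem τ_pow : D.τ ^ D.r = 1 := AlgEquiv.ext fun x => by
  rw [τ, tauE_pow_apply, ← D.ord, pow_orderOf_eq_one]; rfl

theorem σ_pow : D.σ ^ (2 * D.r) = 1 := by
  have h : ∀ k x, (S ^ (2 * k) : Module.End ℂ A) ((D.σ ^ k) x) = x := fun k => by
    induction k with
    | zero => intro x; rfl
    | succ k ih =>
      intro x
      rw [mul_add, pow_add, pow_succ' D.σ, AlgEquiv.mul_apply]
      have : (S ^ (2 * k) * S ^ (2 * 1) : Module.End ℂ A) (D.σ ((D.σ ^ k) x)) =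
        (S ^ (2 * k) : Module.End ℂ A) (S (S (D.F.sigma ((D.σ ^ k) x)))) := rfl
      rw [this, D.F.S2_sigma, ih]
  refine AlgEquiv.ext fun x => ?_
  have := h (2 * D.r) x
  rw [← mul_assoc, show 2 * 2 = 4 from rfl, D.hS] at this
  exact this

theorem σ_comm : Commute D.σ D.τ := AlgEquiv.ext fun x => by
  rw [AlgEquiv.mul_apply, AlgEquiv.mul_apply]
  apply D.F.S_injective; apply D.F.S_injective
  change S (S (D.F.sigma (tau D.χ x))) = S (S (tau D.χ (D.F.sigma x)))
  rw [D.F.S2_sigma, ← tau_S_S, D.F.S2_sigma]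

omit [Module.Finite ℂ A] in
theorem π_pow : D.π ^ D.r = 1 := by rw [π, ← Reps.act_pow, τ_pow, Reps.act_one]

theorem s_pow : D.s ^ (2 * D.r) = 1 := by rw [s, ← Reps.act_pow, σ_pow, Reps.act_one]

theorem s_comm : Commute D.s D.π := by
  rw [Commute, SemiconjBy, s, π, ← Reps.act_mul, ← Reps.act_mul, D.σ_comm.eq]

theorem trace_σ_τ (j : ℕ) (z : A) :
    LinearMap.trace ℂ A (LinearMap.mulRight ℂ z ∘ₗ (D.σ * D.τ ^ j).toLinearMap) = 0 := by
  rw [← D.F.trace_sigma_tau_mul_eq_zero D.hε (chiPow D.χ j) z]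
  congr 1
  ext x
  change (D.σ * D.τ ^ j) x * z = D.F.sigma (tau (chiPow D.χ j) x) * z
  rw [tau_chiPow, AlgEquiv.mul_apply, τ, tauE_pow_apply]; rfl

theorem σ_τ_pow (j : ℕ) : (D.σ * D.τ ^ j) ^ (2 * D.r) = 1 := by
  rw [(D.σ_comm.pow_right j).mul_pow, D.σ_pow, ← pow_mul,
    show j * (2 * D.r) = D.r * (2 * j) by ring, pow_mul, D.τ_pow, one_pow, one_mul]

omit [Module.Finite ℂ A] in
theorem tau_ne_one : tau D.χ ≠ 1 := fun h => by
  have := D.ord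
  rw [h, orderOf_one] at this
  exact D.hr.one_lt.ne this

theorem dvd_n {i : Fin D.R.N} (h : D.π i = i) : D.r ∣ D.R.n i := by
  obtain ⟨t, ht⟩ := D.R.exists_inner h
  have : Nonempty (Fin (D.R.n i)) := ⟨⟨0, D.R.pos i⟩⟩
  have : Nontrivial A := ⟨1, 0, fun h0 => by
    have := D.R.ch_one i
    rw [h0, map_zero] at this
    exact (D.R.pos i).ne (by exact_mod_cast this)⟩
  set t' : Module.End ℂ (Fin (D.R.n i) → ℂ) := t.toLinearMap with ht'
  have htr : LinearMap.trace ℂ _ t' = 0 := by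
    have := finrank_mul_trace (Matrix.toLinAlgEquiv'.toAlgHom.comp (D.R.rep i)) D.χ t'
      (fun a v => (ht a v).symm)
    rw [trace_tau_eq_zero D.tau_ne_one, zero_mul] at this
    exact (mul_eq_zero.1 this).resolve_left (by exact_mod_cast Module.finrank_pos.ne')
  obtain ⟨l, hl⟩ := Module.End.exists_eigenvalue t'
  obtain ⟨v, hv⟩ := hl.exists_hasEigenvector
  have hv0 : v ≠ 0 := hv.2
  have htv : t v = l • v := hv.apply_eq_smul
  have hl0 : l ≠ 0 := by
    rintro rfl
    rw [zero_smul] at htv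
    exact hv0 (t.map_eq_zero_iff.1 htv)
  have hk : ∀ k a w, (t' ^ k) ((D.R.rep i a).mulVec w) =
      (D.R.rep i ((D.τ ^ k) a)).mulVec ((t' ^ k) w) := fun k => by
    induction k with
    | zero => intro a w; rfl
    | succ k ih =>
      intro a w
      rw [pow_succ', Module.End.mul_apply, ih, pow_succ', AlgEquiv.mul_apply, Module.End.mul_apply]
      exact (ht _ _).symm
  have hkv : ∀ k, (t' ^ k) v = l ^ k • v := fun k => by
    induction k with
    | zero => simp
    | succ k ih => rw [pow_succ', Module.End.mul_apply, ih, map_smul, pow_succ, mul_smul]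
                   exact congrArg _ htv
  have hcyc : ∀ w, ∃ a, (D.R.rep i a).mulVec v = w := fun w => by
    obtain ⟨j, hj⟩ := Function.ne_iff.1 hv0
    obtain ⟨a, ha⟩ := D.R.rep_surjective i (Matrix.vecMulVec w (Pi.single j (v j)⁻¹))
    refine ⟨a, ?_⟩
    rw [ha, Matrix.vecMulVec_mulVec]
    have : (Pi.single j (v j)⁻¹ : Fin (D.R.n i) → ℂ) ⬝ᵥ v = 1 := by
      rw [single_dotProduct]; exact inv_mul_cancel₀ hj
    rw [this]; simp
  have hT : (l⁻¹ • t') ^ D.r = 1 := LinearMap.ext fun w => by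
    obtain ⟨a, rfl⟩ := hcyc w
    rw [smul_pow, LinearMap.smul_apply, hk, hkv, D.τ_pow, Matrix.mulVec_smul, smul_smul,
      ← mul_pow, inv_mul_cancel₀ hl0, one_pow, one_smul]; rfl
  have := dvd_finrank_of_trace_eq_zero D.hr hT (by rw [map_smul, htr, smul_zero])
  simpa using this

theorem exists_σ_τ_restrict {i : Fin D.R.N} {j : ℕ} (h : D.s ((D.π ^ j) i) = i) :
    ∃ e, D.R.IsPrim i e ∧ (D.σ * D.τ ^ j) e = e ∧
      ∃ T : Module.End ℂ (LinearMap.range (LinearMap.mulRight ℂ e)),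
        (∀ w, (T w : A) = (D.σ * D.τ ^ j) w) ∧ T ^ (2 * D.r) = 1 ∧
        LinearMap.trace ℂ _ T = 0 := by
  have h' : D.R.act (D.σ * D.τ ^ j) i = i := by
    rw [Reps.act_mul, Reps.act_pow]
    change (D.π ^ j * D.s) i = i
    rw [← (D.s_comm.pow_right j).eq]; exact h
  obtain ⟨e, he, hφ, T, hT, htr⟩ := D.R.exists_restrict_of_act_eq
    (by have := D.hr.pos; omega) (D.σ_τ_pow j) h'
  refine ⟨e, he, hφ, T, hT, ?_, by rw [htr, D.trace_σ_τ]⟩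
  have hk : ∀ k w, ((T ^ k) w : A) = ((D.σ * D.τ ^ j) ^ k) w := fun k => by
    induction k with
    | zero => intro w; rfl
    | succ k ih =>
      intro w
      rw [pow_succ', Module.End.mul_apply, hT, ih, pow_succ' (D.σ * D.τ ^ j) k]
      rfl
  exact LinearMap.ext fun w => Subtype.ext (by rw [hk, D.σ_τ_pow]; rfl)

theorem le_m {i : Fin D.R.N} {j : ℕ} (h : D.s ((D.π ^ j) i) = i) (hm : Odd (D.R.m i)) :
    D.r ≤ D.R.m i := by
  obtain ⟨e, he, -, T, -, hT, htr⟩ := D.exists_σ_τ_restrict h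
  rw [← D.R.finrank_range_prim he] at hm ⊢
  exact (le_finrank_of_trace_eq_zero D.hr D.odd hT htr hm).1

omit [Module.Finite ℂ A] in
theorem n_π (i : Fin D.R.N) : D.R.n (D.π i) = D.R.n i := D.R.n_act _ i
theorem m_π (i : Fin D.R.N) : D.R.m (D.π i) = D.R.m i := D.R.m_act _ i
theorem n_s (i : Fin D.R.N) : D.R.n (D.s i) = D.R.n i := D.R.n_act _ i
theorem m_s (i : Fin D.R.N) : D.R.m (D.s i) = D.R.m i := D.R.m_act _ i
end Datum

end

/-! ### Fusion of irreducible representations -/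

section

theorem trace_mul_of_eq_one {n : ℕ} (h : n = 1) (M N : Matrix (Fin n) (Fin n) ℂ) :
    (M * N).trace = M.trace * N.trace := by
  subst h
  simp [Matrix.trace_fin_one, Matrix.mul_apply]

namespace Reps
variable {A : Type*} [Ring A] [HopfAlgebra ℂ A] [Module.Finite ℂ A] (R : Reps A)

omit [Module.Finite ℂ A] in
theorem exists_index (η : A →ₐ[ℂ] ℂ) : ∃ i, R.n i = 1 ∧ ∀ a, R.ch i a = η a := by
  have hη : Function.Surjective
      ((Matrix.scalarAlgHom (Fin 1) ℂ : ℂ →ₐ[ℂ] Matrix (Fin 1) (Fin 1) ℂ).comp η) := fun M =>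
    ⟨algebraMap ℂ A (M 0 0), by
      ext i j
      rw [Subsingleton.elim i 0, Subsingleton.elim j 0]
      simp [Matrix.algebraMap_eq_diagonal]⟩
  obtain ⟨i, hi, h, -⟩ := R.exists_ch_eq one_pos _ hη
  refine ⟨i, hi, fun a => ?_⟩
  rw [← h]
  simp

/-- The index of the trivial representation. -/
noncomputable def triv : Fin R.N := (R.exists_index ε).choose

omit [Module.Finite ℂ A] in
theorem n_triv : R.n R.triv = 1 := (R.exists_index ε).choose_spec.1

omit [Module.Finite ℂ A] in
theorem ch_triv (a : A) : R.ch R.triv a = ε a := (R.exists_index ε).choose_spec.2 a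

omit [Module.Finite ℂ A] in
theorem exists_char {i : Fin R.N} (h : R.n i = 1) : ∃ η : A →ₐ[ℂ] ℂ, ∀ a, R.ch i a = η a :=
  ⟨AlgHom.ofLinearMap (R.ch i) (by rw [ch_one, h]; simp) (fun a b => by
    rw [ch_apply, map_mul, trace_mul_of_eq_one h]; rfl), fun _ => rfl⟩

theorem m_eq_of_n_eq_one {i : Fin R.N} (h : R.n i = 1) : R.m i = R.m R.triv := by
  obtain ⟨η, hη⟩ := R.exists_char h
  rw [← R.m_act (tauE η) R.triv]
  congr 1
  refine ((R.act_eq_iff _ _ _).2 fun a => ?_).symm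
  rw [ch_triv, tauE_apply, ε_tau, hη]

theorem exists_star (F : Frob A) (i : Fin R.N) :
    ∃ k, R.n k = R.n i ∧ ∀ a, R.ch k a = R.ch i (S a) := by
  let f : A →ₐ[ℂ] Matrix (Fin (R.n i)) (Fin (R.n i)) ℂ :=
    AlgHom.ofLinearMap
      ((Matrix.transposeLinearEquiv _ _ ℂ ℂ).toLinearMap ∘ₗ (R.rep i).toLinearMap ∘ₗ S)
      (by simp) (fun a b => by simp [S_mul, Matrix.transpose_mul])
  have hf : ∀ a, f a = (R.rep i (S a)).transpose := fun _ => rfl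
  obtain ⟨k, hk, h, -⟩ := R.exists_ch_eq (R.pos i) f (fun M => by
    obtain ⟨a, ha⟩ := R.rep_surjective i M.transpose
    obtain ⟨b, rfl⟩ := F.S_surjective a
    exact ⟨b, by rw [hf, ha, Matrix.transpose_transpose]⟩)
  exact ⟨k, hk, fun a => by rw [← h, hf, Matrix.trace_transpose]; rfl⟩

omit [Module.Finite ℂ A] in
theorem exists_fusion (i j k : Fin R.N) :
    ∃ N : ℕ, sw (fun a b => R.ch i a * R.ch j b) (R.e k) = N := by
  obtain ⟨N, hN, -⟩ := exists_natCast_eq (R.rep i)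
    ((Matrix.transposeLinearEquiv _ _ ℂ ℂ).toLinearMap ∘ₗ (R.rep j).toLinearMap)
    (fun a b => by simp [Matrix.transpose_mul]) (R.e_prim k).idem
  refine ⟨N, hN ▸ sw_congr (fun a b => ?_) _⟩
  simp only [LinearMap.comp_apply, AlgHom.toLinearMap_apply]
  erw [Matrix.trace_transpose]
  rfl

noncomputable def fusion (i j k : Fin R.N) : ℕ := (R.exists_fusion i j k).choose

omit [Module.Finite ℂ A] in
theorem fusion_eq (i j k : Fin R.N) :
    (R.fusion i j k : ℂ) = sw (fun a b => R.ch i a * R.ch j b) (R.e k) :=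
  (R.exists_fusion i j k).choose_spec.symm

theorem sum_fusion (F : Frob A) (i k : Fin R.N) :
    ∑ j, R.m j * R.fusion i j k = R.n i * R.m k := by
  have := F.sw_mul_theta (R.ch i) (R.ch_mul_comm i) (R.e k)
  rw [theta_e, ch_one] at this
  have h2 : ∀ a b : A, R.ch i a * theta A b = ∑ j, (R.m j : ℂ) * (R.ch i a * R.ch j b) :=
    fun a b => by
      rw [theta_eq_sum, Finset.mul_sum]
      exact Finset.sum_congr rfl fun j _ => by ring
  rw [sw_congr h2, ← sum_sw] at this
  have h3 : ∀ j, sw (fun a b => (R.m j : ℂ) * (R.ch i a * R.ch j b)) (R.e k) =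
      R.m j * R.fusion i j k := fun j => by
    rw [fusion_eq, map_sw (L := fun x : ℂ => (R.m j : ℂ) * x)]
  simp only [h3] at this
  exact_mod_cast this

omit [Module.Finite ℂ A] in
theorem fusion_triv (i k : Fin R.N) : R.fusion i R.triv k = if i = k then 1 else 0 := by
  have : (R.fusion i R.triv k : ℂ) = if i = k then 1 else 0 := by
    rw [fusion_eq, sw_congr (g := fun a b => (ε b : ℂ) • R.ch i a)
      (fun a b => by rw [ch_triv, smul_eq_mul, mul_comm]), sw_counit_right', ch_e]
  split_ifs at this ⊢ <;> exact_mod_cast this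

theorem le_n_mul_m (F : Frob A) (i : Fin R.N) : R.m R.triv ≤ R.n i * R.m i := by
  rw [← R.sum_fusion F i i]
  refine le_trans (le_of_eq ?_) (Finset.single_le_sum (fun _ _ => Nat.zero_le _)
    (Finset.mem_univ R.triv))
  rw [fusion_triv, if_pos rfl, mul_one]

theorem m_triv_ne_one (F : Frob A) (hF : ε F.Λ = 0) : R.m R.triv ≠ 1 := fun h => by
  set e := R.e R.triv with he
  have hε : ε e = 1 := by rw [← ch_triv, he, ch_e, if_pos rfl]
  have hee : e * e = e := (R.e_prim _).idem
  have he0 : (⟨e, e, hee⟩ : LinearMap.range (LinearMap.mulRight ℂ e)) ≠ 0 := fun h0 => by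
    have : e = 0 := congrArg Subtype.val h0
    rw [this, map_zero] at hε
    exact zero_ne_one hε
  have hint : ∀ h, h * e = ε h • e := fun x => by
    obtain ⟨c, hc⟩ := (finrank_eq_one_iff_of_nonzero' _ he0).1 h ⟨x * e, x, rfl⟩
    have hc' : c • e = x * e := congrArg Subtype.val hc
    have := congrArg ε hc'
    rw [map_smul, map_mul, hε, mul_one, smul_eq_mul, mul_one] at this
    rw [← hc', this]
  have := congrArg ε (F.leftIntegral_eq hint)
  rw [map_smul, hF, hε, smul_zero] at this
  exact one_ne_zero this

omit [Module.Finite ℂ A] in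
theorem fusion_self_triv_pos {i : Fin R.N} (hi : ∀ a, R.ch i (S a) = R.ch i a) :
    0 < R.fusion i i R.triv := by
  obtain ⟨N, hN, hpos⟩ := exists_natCast_eq (R.rep i) ((R.rep i).toLinearMap ∘ₗ S)
    (fun a b => by simp [S_mul]) (R.e_prim R.triv).idem
  have hNeq : N = R.fusion i i R.triv := by
    have : (N : ℂ) = R.fusion i i R.triv := by
      rw [fusion_eq, ← hN]
      exact sw_congr (fun a b => by rw [← hi b]; rfl) _
    exact_mod_cast this
  rw [← hNeq]
  have : Nonempty (Fin (R.n i)) := ⟨⟨0, R.pos i⟩⟩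
  refine hpos ⟨1, one_ne_zero, ?_⟩
  rw [sw_congr (g := fun a b => R.rep i (a * S b)) (fun a b => by simp),
    sw_antipode_right' (f := fun y => R.rep i y), ← ch_triv, ch_e, if_pos rfl, one_smul, map_one]

/-- Right translation by a character, as an automorphism. -/
noncomputable def _root_.HopfPQ.ellE (χ : A →ₐ[ℂ] ℂ) : A ≃ₐ[ℂ] A :=
  AlgEquiv.ofAlgHom (ell χ) (ell (charInv χ))
    (AlgHom.ext (ell_ell_charInv χ)) (AlgHom.ext (ell_charInv_ell χ))

theorem _root_.HopfPQ.ellE_pow (F : Frob A) {χ : A →ₐ[ℂ] ℂ} {r : ℕ} (h : tauE χ ^ r = 1) :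
    ellE χ ^ r = 1 := by
  have hk : ∀ k x, (ellE χ ^ k) (S ((tauE χ ^ k) x)) = S x := fun k => by
    induction k with
    | zero => intro x; rfl
    | succ k ih =>
      intro x
      rw [pow_succ, AlgEquiv.mul_apply, pow_succ', AlgEquiv.mul_apply, tauE_apply]
      change (ellE χ ^ k) (ell χ (S (tau χ ((tauE χ ^ k) x)))) = _
      rw [ell_S, tau_charInv_tau, ih]
  refine AlgEquiv.ext fun x => ?_
  obtain ⟨y, rfl⟩ := F.S_surjective x
  have := hk r y
  rwa [h] at this

omit [Module.Finite ℂ A] in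
theorem fusion_act_ellE {χ : A →ₐ[ℂ] ℂ} {i : Fin R.N} (hi : R.act (tauE χ) i = i)
    (j k : Fin R.N) : R.fusion i (R.act (ellE χ) j) k = R.fusion i j k := by
  have hi' := (R.act_eq_iff _ _ _).1 hi
  have : (R.fusion i (R.act (ellE χ) j) k : ℂ) = R.fusion i j k := by
    rw [fusion_eq, fusion_eq]
    have h1 : ∀ a b : A, R.ch i a * R.ch (R.act (ellE χ) j) b =
        sw (fun c d => R.ch i a * (χ c * R.ch j d)) b := fun a b => by
      rw [ch_act]
      change R.ch i a * R.ch j (sw (fun c d => χ c • d) b) = _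
      rw [map_sw (L := fun y => R.ch i a * R.ch j y)]
      simp
    have h2 : ∀ a b : A, R.ch i a * R.ch j b =
        sw (fun c d => R.ch i c * (χ d * R.ch j b)) a := fun a b => by
      rw [← hi' a, tauE_apply, tau_apply, map_sw (L := fun y => R.ch i y * R.ch j b)]
      exact sw_congr (fun c d => by simp; ring) _
    rw [sw_congr h1, sw_congr h2, sw_coassoc (T := fun a b c => R.ch i a * (χ b * R.ch j c))]
  exact_mod_cast this

theorem exists_act_tauE_eq (F : Frob A) {χ : A →ₐ[ℂ] ℂ} {j : Fin R.N}
    (hj : R.act (ellE χ) j = j) : ∃ k, R.n k = R.n j ∧ R.act (tauE χ) k = k := by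
  obtain ⟨k, hk, h⟩ := R.exists_star F j
  have hj' := (R.act_eq_iff _ _ _).1 hj
  refine ⟨k, hk, (R.act_eq_iff _ _ _).2 fun a => ?_⟩
  rw [h, h, ← hj' (S _)]
  change R.ch j (ell χ (S (tau χ a))) = _
  rw [ell_S, tau_charInv_tau]

end Reps

namespace Datum
variable {A : Type*} [Ring A] [HopfAlgebra ℂ A] [Module.Finite ℂ A] (D : Datum A)

theorem s_triv : D.s D.R.triv = D.R.triv := (D.R.act_eq_iff _ _ _).2 fun a => by
  rw [Reps.ch_triv, Reps.ch_triv, ← D.F.S2_sigma a, ε_S, ε_S, D.F.S2_sigma]; rfl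

theorem π_ne {i : Fin D.R.N} (hi : D.R.n i = 1) : D.π i ≠ i := fun h => by
  have := D.dvd_n h
  rw [hi, Nat.dvd_one] at this
  exact D.hr.ne_one this

omit [Module.Finite ℂ A] in
theorem ch_π_pow (i : Fin D.R.N) (j : ℕ) (a : A) :
    D.R.ch ((D.π ^ j) i) a = D.R.ch i ((tau D.χ ^ j) a) := by
  rw [π, ← Reps.act_pow, Reps.ch_act, τ, tauE_pow_apply]

end Datum

end

/-! ### Orbits of commuting permutations -/

section

section Perm
variable {ι : Type*} {π s : Equiv.Perm ι} {r : ℕ}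

theorem comm_pow_apply (hc : Commute s π) (a b : ℕ) (i : ι) :
    (s ^ a) ((π ^ b) i) = (π ^ b) ((s ^ a) i) :=
  Equiv.congr_fun (hc.pow_pow a b).eq i

theorem pow_inj_of_ne (hr : r.Prime) (hπ : π ^ r = 1) {i : ι} (hi : π i ≠ i) {a b : ℕ}
    (ha : a < r) (hb : b < r) (h : (π ^ a) i = (π ^ b) i) : a = b := by
  have := Fact.mk hr
  have hper : Function.IsPeriodicPt π r i := by
    rw [Function.IsPeriodicPt, ← Equiv.Perm.coe_pow, hπ]; rfl
  have hmin : Function.minimalPeriod π i = r := Function.minimalPeriod_eq_prime hper hi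
  rw [Equiv.Perm.coe_pow, Equiv.Perm.coe_pow] at h
  exact Function.iterate_injOn_Iio_minimalPeriod (f := π) (x := i) (by rwa [hmin]) (by rwa [hmin]) h

theorem apply_pow_eq (hc : Commute s π) (hr : r.Prime) {i : ι} (hs : (s ^ r) i = i)
    {a k : ℕ} (ha0 : 0 < a) (ha : a < r) (h : (s ^ a) i = (π ^ k) i) : ∃ j, s i = (π ^ j) i := by
  have hu : ∀ u, (s ^ (a * u)) i = (π ^ (k * u)) i := fun u => by
    induction u with
    | zero => rfl
    | succ u ih =>
      rw [mul_add, mul_one, add_comm, pow_add, Equiv.Perm.mul_apply, ih, comm_pow_apply hc, h,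
        ← Equiv.Perm.mul_apply, ← pow_add, mul_add, mul_one]
  have hsr : ∀ u, (s ^ (r * u)) i = i := fun u => by
    induction u with
    | zero => rfl
    | succ u ih => rw [mul_add, mul_one, pow_add, Equiv.Perm.mul_apply, hs, ih]
  obtain ⟨u, -, h1⟩ := Nat.exists_mul_mod_eq_one_of_coprime
    (Nat.coprime_of_lt_prime ha0.ne' ha hr).symm hr.one_lt
  refine ⟨k * u, ?_⟩
  rw [← hu, ← Nat.div_add_mod (a * u) r, h1, add_comm, pow_add, Equiv.Perm.mul_apply, hsr, pow_one]

theorem exists_pow_fixed (hc : Commute s π) (hπ : π ^ r = 1) (hr : 0 < r) {i : ι} {j : ℕ}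
    (h : s i = (π ^ j) i) : ∃ k, s ((π ^ k) i) = i := by
  refine ⟨(r - 1) * j, ?_⟩
  have := comm_pow_apply hc 1 ((r - 1) * j) i
  rw [pow_one] at this
  rw [this, h, ← Equiv.Perm.mul_apply, ← pow_add]
  have : (r - 1) * j + j = r * j := by
    obtain ⟨r, rfl⟩ := Nat.exists_eq_succ_of_ne_zero hr.ne'
    simp; ring
  rw [this, pow_mul, hπ, one_pow, Equiv.Perm.one_apply]

variable [Fintype ι] [DecidableEq ι]

omit [Fintype ι] [DecidableEq ι] in
theorem pow_invariant {w : ι → ℕ} (hw : ∀ i, w (π i) = w i) (k : ℕ) (i : ι) :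
    w ((π ^ k) i) = w i := by
  induction k with
  | zero => rfl
  | succ k ih => rw [pow_succ', Equiv.Perm.mul_apply, hw, ih]

/-- The orbit of `i` under the powers of `π` below `r`. -/
def orb (π : Equiv.Perm ι) (r : ℕ) (i : ι) : Finset ι := (Finset.range r).image fun j => (π ^ j) i

omit [Fintype ι] in
theorem mem_orb_self (hr : 0 < r) (i : ι) : i ∈ orb π r i :=
  Finset.mem_image.2 ⟨0, Finset.mem_range.2 hr, rfl⟩

omit [Fintype ι] in
theorem exists_of_mem_orb {i x : ι} (h : x ∈ orb π r i) : ∃ j, x = (π ^ j) i := by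
  obtain ⟨j, -, rfl⟩ := Finset.mem_image.1 h
  exact ⟨j, rfl⟩

omit [Fintype ι] in
theorem mem_orb_of_apply_mem (hr : 0 < r) (hπ : π ^ r = 1) {i x : ι} (h : π x ∈ orb π r i) :
    x ∈ orb π r i := by
  obtain ⟨j, hj, hx⟩ := Finset.mem_image.1 h
  have hj := Finset.mem_range.1 hj
  rcases Nat.eq_zero_or_pos j with rfl | hj0
  · refine Finset.mem_image.2 ⟨r - 1, Finset.mem_range.2 (by omega), π.injective ?_⟩
    rw [← hx, ← Equiv.Perm.mul_apply, ← pow_succ', Nat.sub_add_cancel hr, hπ]; rfl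
  · refine Finset.mem_image.2 ⟨j - 1, Finset.mem_range.2 (by omega), π.injective ?_⟩
    rw [← hx, ← Equiv.Perm.mul_apply, ← pow_succ', Nat.sub_add_cancel hj0]

omit [Fintype ι] in
theorem sum_orb {w : ι → ℕ} (hr : r.Prime) (hπ : π ^ r = 1) (hw : ∀ i, w (π i) = w i)
    {k : ι} (hfix : π k ≠ k) : ∑ i ∈ orb π r k, w i = r * w k := by
  have hinj : Set.InjOn (fun j => (π ^ j) k) (Finset.range r : Set ℕ) := fun a ha b hb h =>
    pow_inj_of_ne hr hπ hfix (by simpa using ha) (by simpa using hb) h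
  rw [orb, Finset.sum_image hinj, Finset.sum_congr rfl fun j _ => pow_invariant hw j k]
  simp

omit [Fintype ι] in
theorem disjoint_orb {C : Finset ι} (hC : ∀ x, π x ∈ C → x ∈ C) {k : ι} (hk : k ∉ C) :
    Disjoint C (orb π r k) := by
  have hnot : ∀ j, (π ^ j) k ∉ C := fun j => by
    induction j with
    | zero => exact hk
    | succ j ih => exact fun h => ih (hC _ (by rwa [pow_succ', Equiv.Perm.mul_apply] at h))
  refine Finset.disjoint_right.2 fun x hx => ?_
  obtain ⟨j, rfl⟩ := exists_of_mem_orb hx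
  exact hnot j

theorem sum_add_orbit_le {w : ι → ℕ} (hr : r.Prime) (hπ : π ^ r = 1) (hw : ∀ i, w (π i) = w i)
    {C : Finset ι} (hC : ∀ x, π x ∈ C → x ∈ C) {k : ι} (hk : k ∉ C) (hfix : π k ≠ k) :
    ∑ i ∈ C, w i + r * w k ≤ ∑ i, w i := by
  rw [← sum_orb hr hπ hw hfix, ← Finset.sum_union (disjoint_orb hC hk)]
  exact Finset.sum_le_sum_of_subset (Finset.subset_univ _)

theorem orbit_le {w : ι → ℕ} (hr : r.Prime) (hπ : π ^ r = 1) (hw : ∀ i, w (π i) = w i)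
    {k : ι} (hfix : π k ≠ k) : r * w k ≤ ∑ i, w i := by
  simpa using sum_add_orbit_le hr hπ hw (C := ∅) (by simp) (by simp) hfix

theorem sq_orbit_le {w : ι → ℕ} (hr : r.Prime) (hπ : π ^ r = 1) (hc : Commute s π)
    (hw : ∀ i, w (π i) = w i) (hws : ∀ i, w (s i) = w i) {i : ι} (hs : (s ^ r) i = i)
    (hfix : π i ≠ i) (h : ∀ j, s i ≠ (π ^ j) i) : r * r * w i ≤ ∑ i, w i := by
  have key : ∀ a a' b b', a ≤ a' → a' < r → b < r → b' < r →
      (s ^ a) ((π ^ b) i) = (s ^ a') ((π ^ b') i) → a = a' ∧ b = b' := by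
    intro a a' b b' haa ha' hb hb' heq
    obtain ⟨c, rfl⟩ := Nat.exists_eq_add_of_le haa
    rw [pow_add, Equiv.Perm.mul_apply] at heq
    have heq := (s ^ a).injective heq
    rcases Nat.eq_zero_or_pos c with rfl | hc0
    · exact ⟨rfl, pow_inj_of_ne hr hπ hfix hb hb' heq⟩
    · exfalso
      have h1 : (s ^ c) i = (π ^ ((r - b') + b)) i := by
        rw [pow_add, Equiv.Perm.mul_apply, heq, comm_pow_apply hc, ← Equiv.Perm.mul_apply,
          ← pow_add, Nat.sub_add_cancel hb'.le, hπ, Equiv.Perm.one_apply]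
      obtain ⟨j, hj⟩ := apply_pow_eq hc hr hs hc0 (by omega) h1
      exact h j hj
  set f : ℕ × ℕ → ι := fun x => (s ^ x.1) ((π ^ x.2) i) with hf
  have hinj : Set.InjOn f (Finset.range r ×ˢ Finset.range r : Finset (ℕ × ℕ)) := by
    rintro ⟨a, b⟩ hab ⟨a', b'⟩ hab' heq
    simp only [Finset.coe_product, Finset.coe_range, Set.mem_prod, Set.mem_Iio] at hab hab'
    rcases le_total a a' with hle | hle
    · obtain ⟨h1, h2⟩ := key a a' b b' hle hab'.1 hab.2 hab'.2 heq
      rw [h1, h2]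
    · obtain ⟨h1, h2⟩ := key a' a b' b hle hab.1 hab'.2 hab.2 heq.symm
      rw [h1, h2]
  have hsum : ∑ x ∈ (Finset.range r ×ˢ Finset.range r).image f, w x = r * r * w i := by
    rw [Finset.sum_image hinj, Finset.sum_congr rfl fun x _ =>
      (pow_invariant hws x.1 _).trans (pow_invariant hw x.2 i)]
    simp
  rw [← hsum]
  exact Finset.sum_le_sum_of_subset (Finset.subset_univ _)

theorem exists_odd_fixed {w : ι → ℕ} (hs : s ^ (2 * r) = 1) (hws : ∀ i, w (s i) = w i)
    (hodd : Odd (∑ i, w i)) : ∃ i, Odd (w i) ∧ (s ^ r) i = i := by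
  by_contra! hne
  have : ∑ i, (w i : ZMod 2) = 0 := by
    refine Finset.sum_involution (fun i _ => (s ^ r) i) (fun i _ => ?_) (fun i _ hi => ?_)
      (fun i _ => Finset.mem_univ _) (fun i _ => ?_)
    · rw [pow_invariant hws]; exact CharTwo.add_self_eq_zero _
    · refine hne i ?_
      by_contra heven
      exact hi ((ZMod.natCast_eq_zero_iff _ _).2 (even_iff_two_dvd.1 (Nat.not_odd_iff_even.1 heven)))
    · rw [← Equiv.Perm.mul_apply, ← pow_add, ← two_mul, hs, Equiv.Perm.one_apply]
  rw [← Nat.cast_sum, ZMod.natCast_eq_zero_iff] at this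
  exact Nat.not_even_iff_odd.2 hodd (even_iff_two_dvd.2 this)

theorem prime_dvd_sum {f : ι → ℕ} (hr : r.Prime) (hπ : π ^ r = 1) (hf : ∀ i, f (π i) = f i)
    (h0 : ∀ i, π i = i → f i = 0) : r ∣ ∑ i, f i := by
  have := Fact.mk hr
  let g : Function.End (Σ i, Fin (f i)) := fun x => ⟨π x.1, Fin.cast (hf x.1).symm x.2⟩
  have hg : ∀ (k : ℕ) x, ((g ^ k) x).1 = (π ^ k) x.1 ∧ (((g ^ k) x).2 : ℕ) = x.2 := fun k => by
    induction k with
    | zero => exact fun x => ⟨rfl, rfl⟩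
    | succ k ih =>
      intro x
      rw [pow_succ, pow_succ]
      exact ⟨(ih (g x)).1, (ih (g x)).2⟩
  have hgr : g ^ r ^ 1 = 1 := funext fun x => by
    rw [pow_one]
    obtain ⟨h1, h2⟩ := hg r x
    rw [hπ] at h1
    exact Sigma.ext h1 ((Fin.heq_ext_iff (congrArg f h1)).2 h2)
  have hmod := Equiv.Perm.card_fixedPoints_modEq hgr
  have hempty : IsEmpty (Function.fixedPoints g) := ⟨fun ⟨x, hx⟩ => by
    have h1 : π x.1 = x.1 := congrArg Sigma.fst hx
    exact Nat.not_lt_zero _ (x.2.isLt.trans_eq (h0 _ h1))⟩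
  rw [Fintype.card_eq_zero (α := Function.fixedPoints g), Fintype.card_sigma] at hmod
  simp only [Fintype.card_fin] at hmod
  exact (Nat.modEq_zero_iff_dvd).1 hmod
end Perm

end

/-! ### Fixed points of the square of the antipode -/

section

variable {A : Type*} [Ring A] [HopfAlgebra ℂ A]

/-- A coalgebra map in terms of `sw`. -/
def IsComulHom (ψ : A → A) : Prop :=
  ∀ f : A → A → A, (∀ b, IsLin (fun a => f a b)) → (∀ a, IsLin (f a)) →
    ∀ x, sw f (ψ x) = sw (fun a b => f (ψ a) (ψ b)) x

theorem Frob.isComulHom_sigma [Module.Finite ℂ A] (F : Frob A) : IsComulHom F.sigma := by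
  intro f h1 h2 x
  obtain ⟨y, rfl⟩ := F.S_surjective x
  obtain ⟨y, rfl⟩ := F.S_surjective y
  have hl : IsLin (fun a : A => F.sigma a) := ⟨by simp, by simp⟩
  have h1' : ∀ b, IsLin (fun a => f (F.sigma a) (F.sigma b)) := fun b => (h1 _).comp' hl
  have h2' : ∀ a, IsLin (fun b => f (F.sigma a) (F.sigma b)) := fun a => (h2 _).comp' hl
  have hSS : ∀ a : A, F.sigma (S (S a)) = a := F.sigma_S2
  rw [hSS, sw_S _ h1' h2', sw_S]
  simp only [hSS]

theorem IsComulHom.pow {ψ : A ≃ₐ[ℂ] A} (h : IsComulHom ψ) (k : ℕ) : IsComulHom (ψ ^ k : A ≃ₐ[ℂ] A) := by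
  induction k with
  | zero => exact fun f _ _ x => rfl
  | succ k ih =>
    intro f h1 h2 x
    rw [pow_succ, AlgEquiv.mul_apply, ih f h1 h2]
    have hl : IsLin (fun a : A => (ψ ^ k) a) := ⟨by simp, by simp⟩
    exact h _ (fun b => (h1 _).comp' hl) (fun a => (h2 _).comp' hl) x

variable [Module.Finite ℂ A]

theorem fixed_of_fixed {R : Reps A} {ψ : A ≃ₐ[ℂ] A} (hψ : IsComulHom ψ) {e₀ e : A}
    (he₀ : e₀ * e₀ = e₀) (h0 : e₀ ≠ 0) (hfix : ∀ w, ψ (w * e₀) = w * e₀)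
    (he : R.IsPrim R.triv e) (hψe : ψ e = e) (z : A) : ψ (z * e) = z * e := by
  obtain ⟨f, hf⟩ : ∃ f : Module.Dual ℂ A, f e₀ ≠ 0 := by
    by_contra! h
    exact h0 ((Module.forall_dual_apply_eq_zero_iff ℂ e₀).1 h)
  have hf' : IsLin (fun a : A => f a) := ⟨by simp, by simp⟩
  set y : A := sw (fun b c => f (b * e₀) • c) e₀ with hy
  have hmul : ∀ h, h * y = sw (fun u v => sw (fun b c => f (S u * b * e₀) • c) (v * e₀)) h := by
    intro h
    have h1 : ∀ u v : A, sw (fun b c => f (S u * b * e₀) • c) (v * e₀) =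
        sw (fun p q => sw (fun b c => f (S u * p * b * e₀) • (q * c)) e₀) v := fun u v => by
      rw [sw_mul (f := fun b c => f (S u * b * e₀) • c) v e₀]
      simp only [mul_assoc]
    rw [sw_congr h1, ← sw_coassoc (T := fun u p q =>
      sw (fun b c => f (S u * p * b * e₀) • (q * c)) e₀)]
    have h2 : ∀ v q : A, sw (fun u p => sw (fun b c => f (S u * p * b * e₀) • (q * c)) e₀) v =
        counit (R := ℂ) v • sw (fun b c => f (1 * b * e₀) • (q * c)) e₀ := fun v q =>
      sw_antipode_left (f := fun g => sw (fun b c => f (g * b * e₀) • (q * c)) e₀) v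
    rw [sw_congr h2, sw_counit_left (f := fun q => sw (fun b c => f (1 * b * e₀) • (q * c)) e₀),
      hy, map_sw (L := fun y => h * y)]
    simp
  have hψe₀ : ∀ b, ψ b * e₀ = b * e₀ := fun b => by
    have h1 : ψ e₀ = e₀ := by simpa [he₀] using hfix e₀
    rw [← hfix b, map_mul, h1]
  have hψy : ∀ h, ψ (h * y) = h * y := by
    intro h
    rw [hmul, map_sw (L := fun y => ψ y) _ _ ⟨by simp, by simp⟩]
    refine sw_congr (fun u v => ?_) h
    nth_rw 2 [← hfix v]
    rw [hψ _ (fun b => by fun_prop) (fun a => by fun_prop),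
      map_sw (L := fun y => ψ y) _ _ ⟨by simp, by simp⟩]
    refine sw_congr (fun b c => ?_) _
    rw [map_smul, mul_assoc, mul_assoc, hψe₀]
  have hψ1 : ψ y = y := by simpa using hψy 1
  have hεy : ε y = f e₀ := by
    rw [hy, map_sw (L := fun y => ε y), sw_congr (g := fun b c => ε c • f (b * e₀))
      (fun b c => by rw [map_smul, smul_eq_mul, smul_eq_mul, mul_comm]),
      sw_counit_right' (f := fun b => f (b * e₀)), he₀]
  set w := ψ (z * e) - z * e with hw
  have hwe : w * e = w := by
    rw [hw, sub_mul, mul_assoc z, he.idem]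
    nth_rw 2 [← hψe]
    rw [← map_mul, mul_assoc, he.idem]
  have hwy : w * y = 0 := by
    rw [hw, sub_mul, ← hψy (z * e), map_mul ψ (z * e) y, hψ1, sub_self]
  set ν := e * y * e - f e₀ • e with hν
  have hνnil : IsNilpotent ν := R.nil _ fun j => by
    by_cases hj : j = R.triv
    · subst hj
      have h1 : (R.rep R.triv ν).trace = 0 := by
        rw [← Reps.ch_apply, Reps.ch_triv, hν]
        have : ε e = 1 := by rw [← R.ch_triv, Reps.ch_apply, he.tr]
        rw [map_sub, map_mul, map_mul, map_smul, hεy, this]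
        simp
      have h2 := R.n_triv
      generalize R.rep R.triv ν = M at h1
      revert M
      rw [h2]
      intro M hM
      ext i j
      rw [Subsingleton.elim i 0, Subsingleton.elim j 0]
      simpa [Matrix.trace_fin_one] using hM
    · rw [hν]
      simp [he.rep_ne j hj]
  have hu : IsUnit (algebraMap ℂ A (f e₀) + ν) := by
    refine IsNilpotent.isUnit_add_left_of_commute hνnil ?_ (Algebra.commutes' _ _).symm
    exact (IsUnit.mk0 _ hf).map (algebraMap ℂ A)
  have h0 : w * (algebraMap ℂ A (f e₀) + ν) = 0 := by
    rw [hν, mul_add, mul_sub, ← mul_assoc, ← mul_assoc, hwe, hwy, zero_mul, mul_smul_comm, hwe,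
      ← Algebra.commutes, ← Algebra.smul_def]
    simp
  rw [← sub_eq_zero, ← hw]
  exact hu.mul_left_eq_zero.1 h0

end

/-! ### Dimension counts -/

section

namespace Datum
variable {A : Type*} [Ring A] [HopfAlgebra ℂ A] [Module.Finite ℂ A] (D : Datum A)

/-- The contribution of an irreducible representation to the dimension. -/
noncomputable def w (i : Fin D.R.N) : ℕ := D.R.n i * D.R.m i

theorem w_π (i : Fin D.R.N) : D.w (D.π i) = D.w i := by rw [w, w, n_π, m_π]

theorem w_s (i : Fin D.R.N) : D.w (D.s i) = D.w i := by rw [w, w, n_s, m_s]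

theorem sum_w : ∑ i, D.w i = Module.finrank ℂ A := D.R.sum_n_mul_m

theorem w_pos (i : Fin D.R.N) : 0 < D.w i := Nat.mul_pos (D.R.pos i) (D.R.m_pos i)

theorem le_w (i : Fin D.R.N) : D.R.m D.R.triv ≤ D.w i := D.R.le_n_mul_m D.F i

theorem two_le : 2 ≤ D.R.m D.R.triv := by
  have := D.R.m_pos D.R.triv
  have := D.R.m_triv_ne_one D.F D.hε
  omega

omit [Module.Finite ℂ A] in
theorem w_triv : D.w D.R.triv = D.R.m D.R.triv := by rw [w, D.R.n_triv, one_mul]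

theorem sq_le_w {i : Fin D.R.N} (h : D.π i = i) : D.r * D.r ≤ D.w i := by
  have h1 := Nat.le_of_dvd (D.R.pos i) (D.dvd_n h)
  exact Nat.mul_le_mul h1 (h1.trans (D.R.n_le_m i))

theorem exists_odd (hodd : Odd (Module.finrank ℂ A)) : ∃ i, Odd (D.w i) ∧ (D.s ^ D.r) i = i :=
  exists_odd_fixed D.s_pow D.w_s (by rwa [sum_w])

theorem le_m_or {i : Fin D.R.N} (hi : Odd (D.w i)) (hs : (D.s ^ D.r) i = i) (hfix : D.π i ≠ i) :
    D.r ≤ D.R.m i ∨ D.r * D.r * D.w i ≤ Module.finrank ℂ A := by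
  by_cases h : ∃ j, D.s i = (D.π ^ j) i
  · obtain ⟨j, hj⟩ := h
    obtain ⟨k, hk⟩ := exists_pow_fixed D.s_comm D.π_pow D.hr.pos hj
    exact Or.inl (D.le_m hk (Nat.odd_mul.1 hi).2)
  · push Not at h
    exact Or.inr (D.sum_w ▸ sq_orbit_le D.hr D.π_pow D.s_comm D.w_π D.w_s hs hfix h)

theorem false_of_order_large {p : ℕ} (hp : Odd p) (hpr : p < D.r)
    (hdim : Module.finrank ℂ A = p * D.r) : False := by
  have hr := D.hr.pos
  obtain ⟨i, hi, hs⟩ := D.exists_odd (by rw [hdim]; exact hp.mul D.odd)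
  have hlt : p * D.r < D.r * D.r := Nat.mul_lt_mul_of_pos_right hpr hr
  have hle : D.w i ≤ p * D.r := by
    rw [← hdim, ← sum_w]
    exact Finset.single_le_sum (fun _ _ => Nat.zero_le _) (Finset.mem_univ i)
  have hwi := D.w_pos i
  by_cases hfix : D.π i = i
  · have := D.sq_le_w hfix
    omega
  · rcases D.le_m_or hi hs hfix with h | h
    · have h1 := orbit_le D.hr D.π_pow D.w_π hfix
      rw [sum_w, hdim, mul_comm p] at h1
      have h2 := Nat.le_of_mul_le_mul_left h1 hr
      have h3 : D.R.m i ≤ D.w i := Nat.le_mul_of_pos_left _ (D.R.pos i)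
      omega
    · rw [hdim] at h
      have : D.r * D.r ≤ D.r * D.r * D.w i := Nat.le_mul_of_pos_right _ hwi
      omega

omit [Module.Finite ℂ A] in
theorem three_le : 3 ≤ D.r := by
  have := D.hr.two_le
  have := D.odd
  rcases this with ⟨k, hk⟩
  omega

omit [Module.Finite ℂ A] in
theorem mem_orb_triv_of_apply_mem (x : Fin D.R.N) (hx : D.π x ∈ orb D.π D.r D.R.triv) :
    x ∈ orb D.π D.r D.R.triv := mem_orb_of_apply_mem D.hr.pos D.π_pow hx

theorem sum_orb_triv : ∑ i ∈ orb D.π D.r D.R.triv, D.w i = D.r * D.R.m D.R.triv := by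
  rw [sum_orb D.hr D.π_pow D.w_π (D.π_ne D.R.n_triv), w_triv]

section small
variable {q : ℕ} (hq : Odd q) (hpq : D.r < q) (hq2 : q ≤ 2 * D.r + 1)
  (hdim : Module.finrank ℂ A = D.r * q)
include hq hpq hq2 hdim

omit hq hpq in
theorem n_eq_of_fixed {i : Fin D.R.N} (h : D.π i = i) :
    D.R.n i = D.r ∧ D.R.m i + D.R.m D.R.triv ≤ q := by
  have h3 := D.three_le
  have h1 := sum_add_orbit_le D.hr D.π_pow D.w_π (C := {i}) (k := D.R.triv)
    (fun x hx => by
      rw [Finset.mem_singleton] at hx ⊢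
      exact D.π.injective (hx.trans h.symm))
    (fun hx => D.π_ne D.R.n_triv (Finset.mem_singleton.1 hx ▸ h)) (D.π_ne D.R.n_triv)
  rw [Finset.sum_singleton, sum_w, hdim, w_triv, w] at h1
  obtain ⟨c, hc⟩ := D.dvd_n h
  have hnm := D.R.n_le_m i
  have hn := D.R.pos i
  rw [hc, mul_assoc, ← mul_add] at h1
  have h2 := Nat.le_of_mul_le_mul_left h1 D.hr.pos
  have hc0 : 0 < c := Nat.pos_of_ne_zero fun h0 => by rw [hc, h0] at hn; simp at hn
  have hc1 : c = 1 := by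
    by_contra hne
    have h2c : 2 ≤ c := by omega
    have : 2 * D.R.m i ≤ c * D.R.m i := Nat.mul_le_mul_right _ h2c
    have : D.r * 2 ≤ D.r * c := Nat.mul_le_mul_left _ h2c
    omega
  subst hc1
  exact ⟨by rw [hc, mul_one], by omega⟩

omit hq hpq in
theorem eq_of_n_eq {i k : Fin D.R.N} (h : D.π i = i) (hk : D.R.n k = D.r) : k = i := by
  by_contra hne
  have h3 := D.three_le
  have hwi := D.sq_le_w h
  have hwk : D.r * D.r ≤ D.w k := by
    have := D.R.n_le_m k
    rw [w, hk] at *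
    exact Nat.mul_le_mul_left _ this
  by_cases hfix : D.π k = k
  · have h1 := sum_add_orbit_le D.hr D.π_pow D.w_π (C := {i, k}) (k := D.R.triv)
      (fun x hx => by
        rw [Finset.mem_insert, Finset.mem_singleton] at hx ⊢
        exact hx.imp (fun hx => D.π.injective (hx.trans h.symm))
          (fun hx => D.π.injective (hx.trans hfix.symm)))
      (fun hx => by
        rw [Finset.mem_insert, Finset.mem_singleton] at hx
        rcases hx with hx | hx
        · exact D.π_ne D.R.n_triv (hx ▸ h)
        · exact D.π_ne D.R.n_triv (hx ▸ hfix)) (D.π_ne D.R.n_triv)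
    rw [Finset.sum_pair (Ne.symm hne), sum_w, hdim, w_triv] at h1
    have h2 := D.two_le
    nlinarith
  · have h1 := orbit_le D.hr D.π_pow D.w_π hfix
    rw [sum_w, hdim] at h1
    have h2 := Nat.le_of_mul_le_mul_left h1 D.hr.pos
    nlinarith

omit hq hpq in
theorem m_eq_of_fixed {i : Fin D.R.N} (h : D.π i = i) : D.R.m i = D.r := by
  obtain ⟨hn, hm⟩ := D.n_eq_of_fixed hq2 hdim h
  have hle := D.R.n_le_m i
  have h2 := D.two_le
  by_contra hne
  set π' := D.R.act (ellE D.χ) with hπ'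
  have huniq := fun k => D.eq_of_n_eq hq2 hdim (k := k) h
  have hi' : π' i = i := huniq _ ((D.R.n_act _ i).trans hn)
  have hself : ∀ a, D.R.ch i (S a) = D.R.ch i a := fun a => by
    obtain ⟨k, hk, hch⟩ := D.R.exists_star D.F i
    rw [← hch, huniq k (hk.trans hn)]
  have hpos := D.R.fusion_self_triv_pos hself
  have hdvd := prime_dvd_sum (π := π')
    (f := fun j => if j = i then 0 else D.R.m j * D.R.fusion i j D.R.triv) D.hr
    (by rw [hπ', ← Reps.act_pow, ellE_pow D.F D.τ_pow, Reps.act_one])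
    (fun j => by
      have : π' j = i ↔ j = i := ⟨fun hj => π'.injective (hj.trans hi'.symm), fun hj => hj ▸ hi'⟩
      simp only [this]
      rw [D.R.fusion_act_ellE (χ := D.χ) h, D.R.m_act])
    (fun j hj => if_pos (by
      obtain ⟨k, hk, hk'⟩ := D.R.exists_act_tauE_eq D.F hj
      exact huniq _ (hk ▸ (D.n_eq_of_fixed hq2 hdim hk').1)))
  have hsum := D.R.sum_fusion D.F i D.R.triv
  rw [← Finset.add_sum_erase _ _ (Finset.mem_univ i), hn] at hsum
  rw [← Finset.add_sum_erase _ _ (Finset.mem_univ i), if_pos rfl, zero_add,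
    Finset.sum_congr rfl fun j hj => if_neg (Finset.ne_of_mem_erase hj)] at hdvd
  have h1 : D.r ∣ D.R.m i * D.R.fusion i i D.R.triv :=
    (Nat.dvd_add_left hdvd).1 (hsum ▸ dvd_mul_right _ _)
  rcases D.hr.dvd_mul.1 h1 with h1 | h1
  · obtain ⟨c, hc⟩ := h1
    have : c < 2 := by
      by_contra! hc2
      have : D.r * 2 ≤ D.r * c := Nat.mul_le_mul_left _ hc2
      omega
    interval_cases c <;> omega
  · have h4 := Nat.le_of_dvd hpos h1
    have h5 : D.R.m i * D.r ≤ D.R.m i * D.R.fusion i i D.R.triv := Nat.mul_le_mul_left _ h4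
    have h6 : D.r * D.R.m i ≤ D.r * D.R.m D.R.triv := by
      rw [← hsum, mul_comm]; omega
    have h7 := Nat.le_of_mul_le_mul_left h6 D.hr.pos
    omega

omit hq hpq in
theorem dvd_m_triv {i : Fin D.R.N} (h : D.π i = i) : D.r ∣ D.R.m D.R.triv := by
  obtain ⟨hn, -⟩ := D.n_eq_of_fixed hq2 hdim h
  have hm := D.m_eq_of_fixed hq2 hdim h
  have hsi : D.s ((D.π ^ 0) i) = i :=
    D.eq_of_n_eq hq2 hdim h ((D.n_s i).trans hn)
  obtain ⟨e₀, he₀, hσe₀, T₀, hT₀, hT₀p, htr₀⟩ := D.exists_σ_τ_restrict hsi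
  obtain ⟨e, he, hσe, T, hT, hTp, htr⟩ := D.exists_σ_τ_restrict (i := D.R.triv) (j := 0) D.s_triv
  rw [pow_zero, mul_one] at *
  have hpow : ∀ {e : A} (T : Module.End ℂ (LinearMap.range (LinearMap.mulRight ℂ e))),
      (∀ w, (T w : A) = D.σ w) → ∀ k w, ((T ^ k) w : A) = (D.σ ^ k) w := fun T hT k => by
    induction k with
    | zero => intro w; rfl
    | succ k ih =>
      intro w
      rw [pow_succ', Module.End.mul_apply, hT, ih, pow_succ', AlgEquiv.mul_apply]
  have he₀0 : e₀ ≠ 0 := fun h0 => by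
    have := he₀.tr
    rw [h0] at this
    simp at this
  have hfin : Module.finrank ℂ (LinearMap.range (LinearMap.mulRight ℂ e₀)) = D.r := by
    rw [D.R.finrank_range_prim he₀, hm]
  have hT₀1 := (le_finrank_of_trace_eq_zero D.hr D.odd hT₀p htr₀ (by rw [hfin]; exact D.odd)).2 hfin
    ⟨⟨e₀, e₀, he₀.idem⟩, fun h0 => he₀0 (congrArg Subtype.val h0),
      Subtype.ext ((hT₀ _).trans hσe₀)⟩
  have hψ₀ : ∀ w, (D.σ ^ D.r) (w * e₀) = w * e₀ := fun w => by
    have := hpow T₀ hT₀ D.r ⟨w * e₀, w, rfl⟩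
    rw [hT₀1] at this
    exact this.symm
  have hσek : ∀ k, (D.σ ^ k) e = e := fun k => by
    induction k with
    | zero => rfl
    | succ k ih => rw [pow_succ, AlgEquiv.mul_apply, hσe, ih]
  have hψ := fixed_of_fixed ((D.F.isComulHom_sigma).pow (ψ := D.σ) D.r) he₀.idem he₀0 hψ₀ he
    (hσek _)
  have hT1 : T ^ D.r = 1 := LinearMap.ext fun ⟨x, z, hz⟩ => Subtype.ext <| by
    rw [hpow T hT]
    change (D.σ ^ D.r) x = x
    rw [← hz]
    exact hψ z
  have := dvd_finrank_of_trace_eq_zero D.hr hT1 htr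
  rwa [D.R.finrank_range_prim he] at this

theorem no_fixed (i : Fin D.R.N) : D.π i ≠ i := fun h => by
  obtain ⟨hn, hmd⟩ := D.n_eq_of_fixed hq2 hdim h
  have hm := D.m_eq_of_fixed hq2 hdim h
  have h2 := D.two_le
  have h3 := D.three_le
  obtain ⟨c, hc⟩ := D.dvd_m_triv hq2 hdim h
  have hc1 : c = 1 := by
    have : c < 2 := by
      by_contra! hc2
      have : D.r * 2 ≤ D.r * c := Nat.mul_le_mul_left _ hc2
      omega
    interval_cases c <;> omega
  have hd : D.R.m D.R.triv = D.r := by rw [hc, hc1, mul_one]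
  have hq' : q = 2 * D.r + 1 := by obtain ⟨t, ht⟩ := hq; omega
  set C := orb D.π D.r D.R.triv with hC
  have hiC : i ∉ C := fun hi => by
    obtain ⟨j, hj⟩ := exists_of_mem_orb hi
    have := pow_invariant D.n_π j D.R.triv
    rw [← hj, hn, D.R.n_triv] at this
    omega
  have hsum : ∑ j ∈ insert i C, D.w j = D.r * D.r + D.r * D.r := by
    rw [Finset.sum_insert hiC, D.sum_orb_triv, hd, w, hn, hm]
  obtain ⟨k, hk⟩ : ∃ k, k ∉ insert i C := by
    by_contra! hall
    rw [Finset.eq_univ_iff_forall.2 hall, sum_w, hdim, hq'] at hsum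
    nlinarith
  rw [Finset.mem_insert, not_or] at hk
  have hkfix : D.π k ≠ k := fun hk' =>
    hk.1 (D.eq_of_n_eq hq2 hdim h (D.n_eq_of_fixed hq2 hdim hk').1)
  have h1 := sum_add_orbit_le D.hr D.π_pow D.w_π (C := insert i C) (k := k)
    (fun x hx => by
      rw [Finset.mem_insert] at hx ⊢
      exact hx.imp (fun hx => D.π.injective (hx.trans h.symm)) (D.mem_orb_triv_of_apply_mem x))
    (by rw [Finset.mem_insert, not_or]; exact hk) hkfix
  rw [hsum, sum_w, hdim, hq'] at h1
  have hwk : D.w k ≤ 1 := by nlinarith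
  have := D.le_w k
  omega

theorem mem_orb_triv (i : Fin D.R.N) : i ∈ orb D.π D.r D.R.triv := by
  by_contra hi
  have h2 := D.two_le
  have h3 := D.three_le
  have hnf := D.no_fixed hq hpq hq2 hdim
  set C := orb D.π D.r D.R.triv with hC
  have hmem := D.mem_orb_triv_of_apply_mem
  have h1 := sum_add_orbit_le D.hr D.π_pow D.w_π hmem hi (hnf i)
  rw [D.sum_orb_triv, sum_w, hdim, ← mul_add] at h1
  have h1 := Nat.le_of_mul_le_mul_left h1 D.hr.pos
  have hwi := D.le_w i
  rcases Nat.even_or_odd (D.R.m D.R.triv) with heven | hodd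
  · obtain ⟨k, hk, hks⟩ := D.exists_odd (by rw [hdim]; exact D.odd.mul hq)
    have hnk : D.R.n k ≠ 1 := fun h => by
      rw [w, h, D.R.m_eq_of_n_eq_one h, one_mul] at hk
      exact Nat.not_even_iff_odd.2 hk heven
    have hnk3 : 3 ≤ D.R.n k := by
      obtain ⟨t, ht⟩ := (Nat.odd_mul.1 hk).1
      omega
    rcases D.le_m_or hk hks (hnf k) with h | h
    · have h4 := orbit_le D.hr D.π_pow D.w_π (hnf k)
      rw [sum_w, hdim] at h4
      have h4 := Nat.le_of_mul_le_mul_left h4 D.hr.pos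
      have : 3 * D.r ≤ D.w k := Nat.mul_le_mul hnk3 h
      omega
    · rw [hdim, mul_assoc] at h
      have h := Nat.le_of_mul_le_mul_left h D.hr.pos
      have : D.r * 3 ≤ D.r * D.w k := Nat.mul_le_mul_left _
        (hnk3.trans (Nat.le_mul_of_pos_right _ (D.R.m_pos k)))
      omega
  · have hle := D.le_m (i := D.R.triv) (j := 0) D.s_triv hodd
    have hd : D.R.m D.R.triv = D.r := by omega
    have hq' : q = 2 * D.r + 1 := by obtain ⟨t, ht⟩ := hq; omega
    set O := orb D.π D.r i with hO
    have hdisj : Disjoint C O := disjoint_orb hmem hi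
    have hsum : ∑ j ∈ C ∪ O, D.w j = D.r * D.r + D.r * D.w i := by
      rw [Finset.sum_union hdisj, D.sum_orb_triv, hd, sum_orb D.hr D.π_pow D.w_π (hnf i)]
    have hall : ∀ k, k ∈ C ∪ O := by
      by_contra! hk
      obtain ⟨k, hk⟩ := hk
      have h4 := sum_add_orbit_le D.hr D.π_pow D.w_π (C := C ∪ O)
        (fun x hx => by
          rw [Finset.mem_union] at hx ⊢
          exact hx.imp (hmem x) (mem_orb_of_apply_mem D.hr.pos D.π_pow)) hk (hnf k)
      rw [hsum, sum_w, hdim, ← mul_add, ← mul_add] at h4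
      have h4 := Nat.le_of_mul_le_mul_left h4 D.hr.pos
      have := D.le_w k
      omega
    have huniv := Finset.eq_univ_iff_forall.2 hall
    have hwi' : D.w i = D.r + 1 := by
      rw [huniv, sum_w, hdim, ← mul_add] at hsum
      have := Nat.eq_of_mul_eq_mul_left D.hr.pos hsum
      omega
    have hni : D.R.n i ≠ 1 := fun h => by
      rw [w, h, D.R.m_eq_of_n_eq_one h, one_mul] at hwi'
      omega
    have hmi : 2 ≤ D.R.m i := by
      have := D.R.pos i
      have := D.R.n_le_m i
      omega
    have hf := D.R.sum_fusion D.F i i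
    rw [← huniv, Finset.sum_union hdisj, Finset.sum_congr rfl (fun j hj => by
        obtain ⟨t, rfl⟩ := exists_of_mem_orb hj
        rw [pow_invariant D.m_π, hd] :
        ∀ j ∈ C, D.R.m j * D.R.fusion i j i = D.r * D.R.fusion i j i),
      Finset.sum_congr rfl (fun j hj => by
        obtain ⟨t, rfl⟩ := exists_of_mem_orb hj
        rw [pow_invariant D.m_π] :
        ∀ j ∈ O, D.R.m j * D.R.fusion i j i = D.R.m i * D.R.fusion i j i),
      ← Finset.mul_sum, ← Finset.mul_sum] at hf
    change _ = D.w i at hf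
    rw [hwi'] at hf
    have hK : 1 ≤ ∑ j ∈ C, D.R.fusion i j i := by
      have := Finset.single_le_sum (f := fun j => D.R.fusion i j i) (fun _ _ => Nat.zero_le _)
        (mem_orb_self (π := D.π) D.hr.pos D.R.triv)
      rwa [D.R.fusion_triv, if_pos rfl] at this
    generalize ∑ j ∈ C, D.R.fusion i j i = K at hf hK
    generalize ∑ j ∈ O, D.R.fusion i j i = L at hf
    have hK1 : K = 1 := by
      by_contra hne
      have : D.r * 2 ≤ D.r * K := Nat.mul_le_mul_left _ (by omega)
      omega
    subst hK1
    have : D.R.m i * L = 1 := by omega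
    have := Nat.eq_one_of_mul_eq_one_right this
    omega

end small
end Datum

end

/-! ### Local algebras -/

section

section Eigen
variable {V : Type*} [AddCommGroup V] [Module ℂ V] [FiniteDimensional ℂ V]

theorem dvd_finrank_of_eigenvalues {r : ℕ} (hr : r.Prime) {f : Module.End ℂ V}
    (hf : ∀ μ, f.HasEigenvalue μ → μ ^ r = 1) (ht : LinearMap.trace ℂ V f = 0) :
    r ∣ Module.finrank ℂ V := by
  have hsplit : f.charpoly.Splits := IsAlgClosed.splits _
  have hprim := Complex.isPrimitiveRoot_exp r hr.ne_zero
  have : NeZero r := ⟨hr.ne_zero⟩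
  have hroot : ∀ μ ∈ f.charpoly.roots.toFinset,
      ∃ e : ℕ, Complex.exp (2 * Real.pi * Complex.I / r) ^ e = μ := fun μ hμ => by
    obtain ⟨e, -, he⟩ := hprim.eq_pow_of_pow_eq_one (hf μ ((Module.End.hasEigenvalue_iff_isRoot_charpoly _ _).2
      (Polynomial.isRoot_of_mem_roots (Multiset.mem_toFinset.1 hμ))))
    exact ⟨e, he⟩
  choose! e he using hroot
  rw [Module.End.trace_eq_sum_roots_charpoly_of_splits hsplit, Finset.sum_multiset_count] at ht
  have h := prime_dvd_of_sum_eq_zero hr hprim f.charpoly.roots.toFinset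
    (fun μ => (f.charpoly.roots.count μ : ℤ)) e (by
      rw [← ht]
      refine Finset.sum_congr rfl fun μ hμ => ?_
      rw [he μ hμ, nsmul_eq_mul, Int.cast_natCast])
  have hcard : Multiset.card f.charpoly.roots = Module.finrank ℂ V := by
    rw [← hsplit.natDegree_eq_card_roots, LinearMap.charpoly_natDegree]
  rw [← hcard, ← Multiset.toFinset_sum_count_eq]
  exact_mod_cast h

omit [FiniteDimensional ℂ V] in
theorem eq_zero_of_isNilpotent {f : Module.End ℂ V} (hf : IsNilpotent f) {v : V} (hv : v ≠ 0)
    {c : ℂ} (h : f v = c • v) : c = 0 := by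
  obtain ⟨k, hk⟩ := hf
  have hpow : ∀ k : ℕ, (f ^ k) v = c ^ k • v := fun k => by
    induction k with
    | zero => simp
    | succ k ih => rw [pow_succ', Module.End.mul_apply, ih, map_smul, h, smul_smul, pow_succ]
  have := hpow k
  rw [hk, LinearMap.zero_apply] at this
  exact eq_zero_of_pow_eq_zero ((smul_eq_zero.1 this.symm).resolve_right hv)

end Eigen

section Local
variable {B : Type*} [Ring B] [Algebra ℂ B] (η : B →ₐ[ℂ] ℂ)

theorem isUnit_of_ne_zero (hnil : ∀ b, η b = 0 → IsNilpotent b) {b : B} (hb : η b ≠ 0) :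
    IsUnit b := by
  have h1 : IsNilpotent (b - algebraMap ℂ B (η b)) := hnil _ (by simp)
  have h2 : IsUnit (algebraMap ℂ B (η b)) := (IsUnit.mk0 _ hb).map _
  have := h1.isUnit_add_left_of_commute h2 (Algebra.commutes _ _).symm
  rwa [add_sub_cancel] at this

/-- Conjugation by a unit of a local algebra is unipotent. -/
theorem eq_one_of_conj [Module.Finite ℂ B] (hnil : ∀ b, η b = 0 → IsNilpotent b) {w b : B} (hw : η w ≠ 0)
    (hb : b ≠ 0) {c : ℂ} (h : w * b = c • (b * w)) : c = 1 := by
  obtain ⟨n, hww⟩ : ∃ n, w = n + algebraMap ℂ B (η w) := ⟨_, (sub_add_cancel _ _).symm⟩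
  have h1 : IsNilpotent n := hnil _ (by simpa using congrArg η hww)
  have h2 : IsNilpotent (LinearMap.mulLeft ℂ n) := by
    obtain ⟨k, hk⟩ := h1
    exact ⟨k, by rw [LinearMap.pow_mulLeft, hk, LinearMap.mulLeft_zero_eq_zero]⟩
  have h3 : IsNilpotent (c • LinearMap.mulRight ℂ n) := by
    obtain ⟨k, hk⟩ := h1
    exact ⟨k, by rw [smul_pow, LinearMap.pow_mulRight, hk, LinearMap.mulRight_zero_eq_zero, smul_zero]⟩
  have hcomm : Commute (LinearMap.mulLeft ℂ n) (c • LinearMap.mulRight ℂ n) :=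
    (LinearMap.commute_mulLeft_right n n).smul_right c
  have h4 := eq_zero_of_isNilpotent (hcomm.isNilpotent_sub h2 h3) hb (c := (c - 1) * η w) (by
    rw [hww] at h
    simp only [add_mul, mul_add, Algebra.algebraMap_eq_smul_one, mul_smul_comm, smul_mul_assoc,
      one_mul, mul_one, smul_add, smul_smul] at h
    simp only [LinearMap.sub_apply, LinearMap.smul_apply, LinearMap.mulLeft_apply,
      LinearMap.mulRight_apply]
    rw [sub_mul, sub_smul, one_mul, sub_eq_sub_iff_add_eq_add, h, add_comm])
  exact sub_eq_zero.1 ((mul_eq_zero.1 h4).resolve_right hw)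

/-- The functionals vanishing on `1` and on the square of the augmentation ideal. -/
def tangent : Submodule ℂ (Module.Dual ℂ B) where
  carrier := {y | y 1 = 0 ∧ ∀ a b, η a = 0 → η b = 0 → y (a * b) = 0}
  add_mem' {y z} hy hz := ⟨by simp [hy.1, hz.1], fun a b ha hb => by
    simp [hy.2 a b ha hb, hz.2 a b ha hb]⟩
  zero_mem' := ⟨rfl, fun _ _ _ _ => rfl⟩
  smul_mem' c y hy := ⟨by simp [hy.1], fun a b ha hb => by simp [hy.2 a b ha hb]⟩

variable {η} in
theorem apply_mul_of_mem_tangent {y : Module.Dual ℂ B} (hy : y ∈ tangent η) (a b : B) :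
    y (a * b) = η a * y b + y a * η b := by
  have h1 := hy.2 (a - algebraMap ℂ B (η a)) (b - algebraMap ℂ B (η b)) (by simp) (by simp)
  have h2 := hy.1
  simp only [sub_mul, mul_sub, Algebra.algebraMap_eq_smul_one, mul_smul_comm, smul_mul_assoc,
      one_mul, mul_one, map_sub, map_smul, h2, smul_eq_mul, mul_zero] at h1
  linear_combination h1

theorem mem_jacobson_of_nil (hnil : ∀ b, η b = 0 → IsNilpotent b) {b : B} (hb : η b = 0) :
    b ∈ Ring.jacobson B := by
  rw [← Ideal.jacobson_bot, Ideal.mem_jacobson_iff]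
  intro y
  have h1 : IsNilpotent (y * b) := hnil _ (by simp [hb])
  obtain ⟨z, hz⟩ := h1.isUnit_one_add.exists_left_inv
  refine ⟨z, ?_⟩
  rw [Ideal.mem_bot, sub_eq_zero, ← hz]
  noncomm_ring

theorem tangent_ne_bot [Module.Finite ℂ B] (hnil : ∀ b, η b = 0 → IsNilpotent b)
    (hdim : 1 < Module.finrank ℂ B) : tangent η ≠ ⊥ := by
  intro hbot
  set I : Ideal B := RingHom.ker η with hI
  let P : Submodule ℂ B := Submodule.span ℂ {x | ∃ a b, η a = 0 ∧ η b = 0 ∧ x = a * b}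
  have htop : P ⊔ Submodule.span ℂ {1} = ⊤ := by
    by_contra hne
    obtain ⟨y, hy0, hy⟩ := Submodule.exists_le_ker_of_lt_top _ (lt_top_iff_ne_top.2 hne)
    refine hy0 ((Submodule.eq_bot_iff _).1 hbot y ⟨?_, fun a b ha hb => ?_⟩)
    · exact hy (Submodule.mem_sup_right (Submodule.mem_span_singleton_self 1))
    · exact hy (Submodule.mem_sup_left (Submodule.subset_span ⟨a, b, ha, hb, rfl⟩))
  have hP : ∀ x ∈ P, η x = 0 ∧ x ∈ Ring.jacobson B • I := fun x hx => by
    induction hx using Submodule.span_induction with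
    | mem x hx =>
      obtain ⟨a, b, ha, hb, rfl⟩ := hx
      exact ⟨by simp [ha], Submodule.smul_mem_smul (mem_jacobson_of_nil η hnil ha) hb⟩
    | zero => exact ⟨map_zero _, zero_mem _⟩
    | add x y _ _ hx hy => exact ⟨by rw [map_add, hx.1, hy.1, add_zero], add_mem hx.2 hy.2⟩
    | smul c x _ hx =>
      refine ⟨by rw [map_smul, hx.1, smul_zero], ?_⟩
      rw [Algebra.smul_def]
      exact Ideal.mul_mem_left _ _ hx.2
  have hle : I ≤ Ring.jacobson B • I := fun m hm => by
    have hm' : m ∈ P ⊔ Submodule.span ℂ {1} := htop ▸ Submodule.mem_top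
    obtain ⟨s, hs, t, ht, rfl⟩ := Submodule.mem_sup.1 hm'
    obtain ⟨c, rfl⟩ := Submodule.mem_span_singleton.1 ht
    have h0 : η (s + c • 1) = 0 := hm
    rw [map_add, (hP s hs).1, map_smul, map_one, zero_add, smul_eq_mul, mul_one] at h0
    rw [h0, zero_smul, add_zero]
    exact (hP s hs).2
  have : IsNoetherianRing B := IsNoetherianRing.of_finite ℂ B
  have h0 := Submodule.FG.eq_bot_of_le_jacobson_smul (IsNoetherian.noetherian I) hle
  have hinj : Function.Injective η := (injective_iff_map_eq_zero η).2 fun x hx =>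
    (Submodule.eq_bot_iff _).1 h0 x hx
  have := LinearMap.finrank_le_finrank_of_injective (f := η.toLinearMap) hinj
  rw [Module.finrank_self] at this
  omega

end Local

end

/-! ### Coinvariants of a character -/

section

section Fix
variable {A : Type*} [Ring A] [HopfAlgebra ℂ A] (χ : A →ₐ[ℂ] ℂ)

/-- The coinvariants of a one-dimensional representation. -/
noncomputable def fix : Subalgebra ℂ A := AlgHom.equalizer (tau χ) (AlgHom.id ℂ A)

theorem mem_fix {a : A} : a ∈ fix χ ↔ tau χ a = a := Iff.rfl

theorem tau_pow_eq_of_mem_fix {a : A} (ha : a ∈ fix χ) (j : ℕ) : (tau χ ^ j) a = a := by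
  induction j with
  | zero => rfl
  | succ j ih => rw [pow_succ', AlgHom.mul_apply, ih]; exact ha

theorem tau_pow_eigen {c : ℂ} {a : A} (ha : tau χ a = c • a) (j : ℕ) :
    (tau χ ^ j) a = c ^ j • a := by
  induction j with
  | zero => simp
  | succ j ih => rw [pow_succ', AlgHom.mul_apply, ih, map_smul, ha, smul_smul, pow_succ]

noncomputable def fixCounit : fix χ →ₐ[ℂ] ℂ := (ε : A →ₐ[ℂ] ℂ).comp (fix χ).val

theorem fixCounit_apply (b : fix χ) : fixCounit χ b = ε (b : A) := rfl

theorem isNilpotent_fix (hnil : ∀ a : A, (∀ j : ℕ, (ε ((tau χ ^ j) a) : ℂ) = 0) → IsNilpotent a)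
    (b : fix χ) (hb : fixCounit χ b = 0) : IsNilpotent b := by
  obtain ⟨k, hk⟩ := hnil b fun j => by rw [tau_pow_eq_of_mem_fix χ b.2]; exact hb
  exact ⟨k, Subtype.ext hk⟩

theorem ell_mem_fix {a : A} (ha : a ∈ fix χ) : ell χ a ∈ fix χ := by
  rw [mem_fix, tau_ell, (mem_fix χ).1 ha]

noncomputable def fixEll : fix χ →ₗ[ℂ] fix χ :=
  ((ell χ).toLinearMap ∘ₗ (fix χ).val.toLinearMap).codRestrict (Subalgebra.toSubmodule (fix χ))
    fun b => ell_mem_fix χ b.2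

theorem coe_fixEll (b : fix χ) : (fixEll χ b : A) = ell χ b := rfl

theorem fixCounit_fixEll (b : fix χ) : fixCounit χ (fixEll χ b) = fixCounit χ b := by
  rw [fixCounit_apply, coe_fixEll, ε_ell, ← ε_tau, (mem_fix χ).1 b.2, fixCounit_apply]

theorem fixEll_mul (a b : fix χ) : fixEll χ (a * b) = fixEll χ a * fixEll χ b :=
  Subtype.ext (map_mul (ell χ) (a : A) b)

theorem fixEll_one : fixEll χ 1 = 1 := Subtype.ext (map_one (ell χ))

theorem sw_tau {M : Type*} [AddCommGroup M] [Module ℂ M] {f : A → A → M} (x : A)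
    (hl : ∀ b, IsLin (fun a => f a b) := by fun_prop)
    (hr : ∀ a, IsLin (fun b => f a b) := by fun_prop) :
    sw f (tau χ x) = sw (fun a b => f a (tau χ b)) x := by
  have hb : IsBilin f := ⟨hl, hr⟩
  rw [tau_apply, map_sw (L := fun y => sw f y)]
  have h1 : ∀ a b : A, sw f (χ b • a) = sw (fun u v => χ b • f u v) a := fun a b => by
    rw [← sw_smul]
    exact (show IsLin (fun y => sw f y) by fun_prop).map_smul _ _
  have h2 : ∀ a b : A, f a (tau χ b) = sw (fun u v => χ v • f a u) b := fun a b => by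
    rw [tau_apply, map_sw (L := fun y => f a y) (hL := hr a)]
    exact sw_congr (fun u v => (hr a).map_smul _ _) _
  rw [sw_congr h1, sw_congr h2, sw_coassoc (T := fun u v b => χ b • f u v)]

variable [Module.Finite ℂ A]

/-- The coinvariants admit an averaging projection. -/
theorem exists_proj : ∃ E : A →ₗ[ℂ] fix χ, (∀ b : fix χ, E b = b) ∧
    (∀ a, E (ell χ a) = fixEll χ (E a)) ∧
    (∀ (f : A → A → A), (∀ b, IsLin (fun a => f a b)) → (∀ a, IsLin (fun b => f a b)) →
      ∀ b : fix χ, sw (fun u v => f u (E v)) (b : A) = sw f (b : A)) ∧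
    orderOf (tau χ) * Module.finrank ℂ (fix χ) = Module.finrank ℂ A := by
  obtain ⟨E, hE, hEs, hfix, hrank⟩ := average (orderOf_tau_pos χ) (toLinearMap_tau_pow_order χ)
    (fun j h0 h1 => trace_tau_pow_eq_zero χ h0 h1)
  set N := orderOf (tau χ)
  have hN : (N : ℂ) ≠ 0 := by exact_mod_cast (orderOf_tau_pos χ).ne'
  have hpow : ∀ (j : ℕ) a, ((tau χ).toLinearMap ^ j) a = (tau χ ^ j) a := fun j a => by
    rw [show (tau χ).toLinearMap ^ j = (tau χ ^ j).toLinearMap from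
      (map_pow AlgHom.toEnd (tau χ) j).symm]
    rfl
  have happ : ∀ a, E a = (N : ℂ)⁻¹ • ∑ j ∈ Finset.range N, (tau χ ^ j) a := fun a => by
    rw [hEs, LinearMap.smul_apply, LinearMap.sum_apply]
    simp only [hpow]
  have hmem : ∀ a, E a ∈ fix χ := fun a => (hfix _).1 (by
    rw [← Module.End.mul_apply, hE.eq])
  refine ⟨E.codRestrict (Subalgebra.toSubmodule (fix χ)) hmem,
    fun b => Subtype.ext ((hfix _).2 b.2), fun a => Subtype.ext ?_, fun f hl hr b => ?_, ?_⟩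
  · have h1 : ∀ j : ℕ, (tau χ ^ j) (ell χ a) = ell χ ((tau χ ^ j) a) := fun j => by
      induction j with
      | zero => rfl
      | succ j ih => rw [pow_succ', AlgHom.mul_apply, ih, tau_ell, AlgHom.mul_apply]
    change E (ell χ a) = ell χ (E a)
    rw [happ, happ, map_smul, map_sum]
    simp only [h1]
  · change sw (fun u v => f u (E v)) (b : A) = _
    have h1 : ∀ j : ℕ, sw (fun u v => f u ((tau χ ^ j) v)) (b : A) = sw f (b : A) := fun j => by
      induction j with
      | zero => rfl
      | succ j ih =>
        have h2 := sw_tau χ (f := fun u v => f u ((tau χ ^ j) v)) (b : A)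
          (fun v => hl _) (fun u => (hr u).comp' (by fun_prop))
        rw [(mem_fix χ).1 b.2, ih] at h2
        rw [h2]
        exact sw_congr (fun u v => by rw [pow_succ, AlgHom.mul_apply]) _
    have h2 : ∀ u v, f u (E v) = (N : ℂ)⁻¹ • ∑ j ∈ Finset.range N, f u ((tau χ ^ j) v) :=
      fun u v => by rw [happ, (hr u).map_smul, (hr u).map_sum]
    rw [sw_congr h2, ← sw_smul, ← sum_sw, Finset.sum_congr rfl fun j _ => h1 j, Finset.sum_const,
      Finset.card_range, ← Nat.cast_smul_eq_nsmul ℂ, smul_smul, inv_mul_cancel₀ hN, one_smul]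
  · rw [← hrank]
    have : LinearMap.range E = Subalgebra.toSubmodule (fix χ) := by
      ext a
      exact ⟨fun ⟨b, hb⟩ => hb ▸ hmem b, fun ha => ⟨a, (hfix a).2 ha⟩⟩
    rw [this]
    rfl

theorem exists_eigenfunctional (hnil : ∀ b, fixCounit χ b = 0 → IsNilpotent b)
    (hdim : 1 < Module.finrank ℂ (fix χ)) :
    ∃ z ∈ tangent (fixCounit χ), z ≠ 0 ∧ ∃ c : ℂ, ∀ b, z (fixEll χ b) = c * z b := by
  let T : Module.End ℂ (Module.Dual ℂ (fix χ)) := (fixEll χ).dualMap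
  have hT : ∀ z ∈ tangent (fixCounit χ), T z ∈ tangent (fixCounit χ) := fun z hz =>
    ⟨by rw [LinearMap.dualMap_apply, fixEll_one]; exact hz.1, fun a b ha hb => by
      rw [LinearMap.dualMap_apply, fixEll_mul]
      exact hz.2 _ _ (by rwa [fixCounit_fixEll]) (by rwa [fixCounit_fixEll])⟩
  have : Nontrivial (tangent (fixCounit χ)) :=
    Submodule.nontrivial_iff_ne_bot.2 (tangent_ne_bot _ hnil hdim)
  obtain ⟨c, hc⟩ := Module.End.exists_eigenvalue (T.restrict hT)
  obtain ⟨z, hz⟩ := hc.exists_hasEigenvector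
  refine ⟨z, z.2, fun h => hz.2 (Subtype.ext h), c, fun b => ?_⟩
  exact LinearMap.congr_fun (congrArg Subtype.val hz.apply_eq_smul) b

end Fix

end

/-! ### Derivations of coinvariants -/

section

section Basic
variable {A : Type*} [Ring A] [HopfAlgebra ℂ A] (χ : A →ₐ[ℂ] ℂ)

theorem sw_add {M : Type*} [AddCommGroup M] [Module ℂ M] (f g : A → A → M) (x : A) :
    sw (fun a b => f a b + g a b) x = sw f x + sw g x := by
  simp [sw, Finset.sum_add_distrib]

theorem exists_derivation [Module.Finite ℂ A] {z : Module.Dual ℂ (fix χ)}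
    (hz : z ∈ tangent (fixCounit χ)) {c : ℂ} (hc : ∀ b, z (fixEll χ b) = c * z b) :
    ∃ d : A →ₗ[ℂ] A, (∀ a, tau χ (d a) = c • d a) ∧ (∀ b : fix χ, ε (d b) = z b) ∧
      ∀ a b : fix χ, d (a * b) = a * d b + d a * b := by
  obtain ⟨E, hE, hEell, hsw, -⟩ := exists_proj χ
  have hlin : IsLin (fun a : A => sw (fun u v => z (E v) • u) a) := by fun_prop
  have hd : ∀ a, hlin.mk' a = sw (fun u v => z (E v) • u) a := fun a => rfl
  refine ⟨hlin.mk', fun a => ?_, fun b => ?_, fun a b => ?_⟩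
  · rw [hd, map_sw (L := fun y => tau χ y)]
    have h1 : ∀ u v : A, tau χ (z (E v) • u) = sw (fun s t => z (E v) • χ t • s) u :=
      fun u v => by rw [map_smul, tau_apply, sw_smul]
    have h2 : ∀ s w : A, c • (z (E w) • s) = sw (fun t v => z (E v) • χ t • s) w := fun s w => by
      rw [smul_smul, ← hc, ← hEell, ell_apply, map_sw (L := fun y => z (E y) • s)]
      exact sw_congr (fun t v => by simp [mul_smul, smul_comm (χ t)]) _
    rw [sw_congr h1, sw_smul, sw_congr h2, sw_coassoc (T := fun s t v => z (E v) • χ t • s)]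
  · rw [hd, map_sw (L := fun y => (ε y : ℂ))]
    have h1 : ∀ u v : A, (ε (z (E v) • u) : ℂ) = ε u • z (E v) := fun u v => by
      simp [mul_comm]
    rw [sw_congr h1, sw_counit_left' (f := fun v => z (E v)), hE]
  · have hX : ∀ b : fix χ, sw (fun u v => fixCounit χ (E v) • u) (b : A) = b := fun b =>
      (hsw (fun u v => (ε v : ℂ) • u) (fun v => by fun_prop) (fun u => by fun_prop) b).trans
        (sw_counit_right' (f := fun u => u) (b : A))
    rw [hd, sw_mul,
      ← hsw (fun u v => sw (fun u' v' => z (E (v * v')) • (u * u')) (b : A))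
        (fun v => by fun_prop) (fun u => by fun_prop) a]
    have h1 : ∀ u v : A, sw (fun u' v' => z (E (E v * v')) • (u * u')) (b : A) =
        fixCounit χ (E v) • (u * hlin.mk' b) + z (E v) • (u * b) := fun u v => by
      rw [← hsw (fun u' v' => z (E (E v * v')) • (u * u')) (fun v => by fun_prop)
        (fun u => by fun_prop) b]
      have h2 : ∀ u' v' : A, z (E (E v * E v')) • (u * u') =
          fixCounit χ (E v) • (u * (z (E v') • u')) + z (E v) • (u * (fixCounit χ (E v') • u')) :=
        fun u' v' => by
          rw [← Subalgebra.coe_mul, hE, apply_mul_of_mem_tangent hz, add_smul, mul_smul, mul_smul,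
            mul_smul_comm, mul_smul_comm]
      have h3 : fixCounit χ (E v) • (u * hlin.mk' b) =
          sw (fun u' v' => fixCounit χ (E v) • (u * (z (E v') • u'))) (b : A) := by
        rw [hd, map_sw (L := fun y => fixCounit χ (E v) • (u * y))]
      have h4 : z (E v) • (u * b) =
          sw (fun u' v' => z (E v) • (u * (fixCounit χ (E v') • u'))) (b : A) := by
        conv_lhs => rw [← hX b]
        rw [map_sw (L := fun y => z (E v) • (u * y))]
      rw [sw_congr h2, h3, h4, sw_add]
    have h3 : a * hlin.mk' b = sw (fun u v => fixCounit χ (E v) • (u * hlin.mk' b)) (a : A) := by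
      conv_lhs => rw [← hX a]
      rw [map_sw (L := fun y => y * hlin.mk' b)]
      exact sw_congr (fun u v => smul_mul_assoc _ _ _) _
    have h4 : hlin.mk' a * b = sw (fun u v => z (E v) • (u * b)) (a : A) := by
      rw [hd, map_sw (L := fun y : A => y * (b : A))]
      exact sw_congr (fun u v => smul_mul_assoc _ _ _) _
    rw [sw_congr h1, sw_add, h3, h4]

/-- A nontrivial one-dimensional representation whose powers detect nilpotency has order dividing
the dimension of its coinvariants. -/
theorem dvd_finrank_fix [Module.Finite ℂ A] (hr : (orderOf (tau χ)).Prime)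
    (hnil : ∀ a : A, (∀ j : ℕ, (ε ((tau χ ^ j) a) : ℂ) = 0) → IsNilpotent a)
    (hdim : 1 < Module.finrank ℂ (fix χ)) : orderOf (tau χ) ∣ Module.finrank ℂ (fix χ) := by
  have hnilB := isNilpotent_fix χ hnil
  obtain ⟨z, hz, hz0, c, hc⟩ := exists_eigenfunctional χ hnilB hdim
  obtain ⟨d, hdτ, hdε, hd⟩ := exists_derivation χ hz hc
  obtain ⟨a, ha⟩ : ∃ a, z a ≠ 0 := by
    by_contra! h
    exact hz0 (LinearMap.ext h)
  set r := orderOf (tau χ)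
  set δ := d a with hδ
  have hεδ : (ε δ : ℂ) ≠ 0 := by rwa [hδ, hdε]
  have hδ0 : δ ≠ 0 := fun h => hεδ (by rw [h, map_zero])
  have hcr : c ^ r = 1 := by
    have h := tau_pow_eigen χ (hdτ a) r
    rw [pow_orderOf_eq_one, AlgHom.one_apply, ← hδ] at h
    exact smul_left_injective ℂ hδ0 ((h.symm.trans (one_smul ℂ δ).symm))
  have hc0 : c ≠ 0 := fun h => by simp [h, hr.ne_zero] at hcr
  have hmem : δ ^ r ∈ fix χ := by
    rw [mem_fix, map_pow, hdτ, smul_pow, hcr, one_smul]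
  set w : fix χ := ⟨δ ^ r, hmem⟩
  have hw : fixCounit χ w ≠ 0 := by
    rw [fixCounit_apply, map_pow]
    exact pow_ne_zero _ hεδ
  have hunit : IsUnit δ := by
    rw [← isUnit_pow_iff hr.ne_zero]
    exact (isUnit_of_ne_zero _ hnilB hw).map (fix χ).val
  obtain ⟨γ, hγ1, hγ2⟩ : ∃ γ, δ * γ = 1 ∧ γ * δ = 1 :=
    ⟨_, hunit.mul_val_inv, hunit.val_inv_mul⟩
  have hτγ : tau χ γ = c⁻¹ • γ := by
    have h := congrArg (tau χ) hγ2
    rw [map_mul, hdτ, map_one, mul_smul_comm] at h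
    calc tau χ γ = tau χ γ * (δ * γ) := by rw [hγ1, mul_one]
      _ = c⁻¹ • ((c • (tau χ γ * δ)) * γ) := by
        rw [smul_mul_assoc, smul_smul, inv_mul_cancel₀ hc0, one_smul, mul_assoc]
      _ = c⁻¹ • γ := by rw [h, one_mul]
  have hsmul : ∀ x y : A, (c • x) * (c⁻¹ • y) = x * y := fun x y => by
    rw [smul_mul_smul_comm, mul_inv_cancel₀ hc0, one_smul]
  let D : Module.End ℂ (fix χ) :=
    (LinearMap.mulRight ℂ γ ∘ₗ d ∘ₗ (fix χ).val.toLinearMap).codRestrict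
      (Subalgebra.toSubmodule (fix χ)) fun b => by
        change tau χ (d b * γ) = d b * γ
        rw [map_mul, hdτ, hτγ, hsmul]
  have hD : ∀ b, (D b : A) = d b * γ := fun b => rfl
  let κ : Module.End ℂ (fix χ) :=
    (LinearMap.mulRight ℂ γ ∘ₗ LinearMap.mulLeft ℂ δ ∘ₗ (fix χ).val.toLinearMap).codRestrict
      (Subalgebra.toSubmodule (fix χ)) fun b => by
        change tau χ (δ * b * γ) = δ * b * γ
        rw [map_mul, map_mul, hdτ, hτγ, (mem_fix χ).1 b.2, smul_mul_assoc, hsmul]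
  have hκ : ∀ b, (κ b : A) = δ * b * γ := fun b => rfl
  have hcomm : D * LinearMap.mulLeft ℂ a - LinearMap.mulLeft ℂ a * D = κ := by
    ext b
    simp only [LinearMap.sub_apply, Module.End.mul_apply, LinearMap.mulLeft_apply,
      AddSubgroupClass.coe_sub, Subalgebra.coe_mul, hD, hκ, hd]
    rw [add_mul, mul_assoc (a : A), add_sub_cancel_left]
  have htr : LinearMap.trace ℂ _ κ = 0 := by
    rw [← hcomm, map_sub, LinearMap.trace_mul_comm, sub_self]
  refine dvd_finrank_of_eigenvalues hr (fun μ hμ => ?_) htr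
  obtain ⟨b, hb⟩ := hμ.exists_hasEigenvector
  have h1 : δ * (b : A) = μ • ((b : A) * δ) := by
    have h := congrArg Subtype.val hb.apply_eq_smul
    rw [hκ] at h
    calc δ * (b : A) = δ * b * γ * δ := by rw [mul_assoc, hγ2, mul_one]
      _ = _ := by rw [h]; exact smul_mul_assoc _ _ _
  have h2 : ∀ k : ℕ, δ ^ k * (b : A) = μ ^ k • ((b : A) * δ ^ k) := fun k => by
    induction k with
    | zero => simp
    | succ k ih =>
      rw [pow_succ', mul_assoc, ih, mul_smul_comm, ← mul_assoc, h1, smul_mul_assoc, smul_smul,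
        pow_succ, mul_assoc, ← pow_succ']
  exact eq_one_of_conj _ hnilB hw hb.2 (b := b) (Subtype.ext (h2 r))

end Basic

end

/-! ### Hopf algebras of dimension `p * q` -/

section

theorem Datum.isNilpotent_of_forall {A : Type*} [Ring A] [HopfAlgebra ℂ A] [Module.Finite ℂ A]
    (D : Datum A) (horb : ∀ i, i ∈ orb D.π D.r D.R.triv) (a : A)
    (ha : ∀ j : ℕ, (ε ((tau D.χ ^ j) a) : ℂ) = 0) : IsNilpotent a := by
  refine D.R.nil a fun i => ?_
  obtain ⟨j, rfl⟩ := exists_of_mem_orb (horb i)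
  have hn : D.R.n ((D.π ^ j) D.R.triv) = 1 := by
    rw [pow_invariant D.n_π, D.R.n_triv]
  have hch : D.R.ch ((D.π ^ j) D.R.triv) a = 0 := by
    rw [D.ch_π_pow, D.R.ch_triv, ha]
  rw [Reps.ch_apply] at hch
  have : Unique (Fin (D.R.n ((D.π ^ j) D.R.triv))) := hn ▸ inferInstanceAs (Unique (Fin 1))
  ext u v
  rw [Matrix.trace, Fintype.sum_unique, Matrix.diag_apply] at hch
  rw [Subsingleton.elim u default, Subsingleton.elim v default, hch, Matrix.zero_apply]

theorem Datum.false_of_finrank {A : Type*} [Ring A] [HopfAlgebra ℂ A] [Module.Finite ℂ A]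
    (D : Datum A) {p q : ℕ} (hq : q.Prime) (hpodd : Odd p) (hqodd : Odd q) (hpq : p < q)
    (hq2 : q ≤ 2 * p + 1) (hdim : Module.finrank ℂ A = p * q) (hr : D.r = p ∨ D.r = q) : False := by
  rcases hr with rfl | rfl
  · have hnil := D.isNilpotent_of_forall (D.mem_orb_triv hqodd hpq hq2 hdim)
    obtain ⟨-, -, -, -, h⟩ := exists_proj D.χ
    rw [D.ord, hdim] at h
    have hfix := Nat.eq_of_mul_eq_mul_left D.hr.pos h
    have hdvd := dvd_finrank_fix D.χ (D.ord.symm ▸ D.hr) hnil (hfix ▸ hq.one_lt)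
    rw [hfix, D.ord, Nat.prime_dvd_prime_iff_eq D.hr hq] at hdvd
    exact hpq.ne hdvd
  · exact D.false_of_order_large hpodd hpq hdim

section Main
variable {A : Type*} [Ring A] [HopfAlgebra ℂ A] [Module.Finite ℂ A]

omit [Module.Finite ℂ A] in
theorem Frob.isSemisimpleRing_of_ε_ne (F : Frob A) (h : (ε F.Λ : ℂ) ≠ 0) : IsSemisimpleRing A :=
  isSemisimpleRing_of_integral (y := (ε F.Λ : ℂ)⁻¹ • F.Λ)
    (fun a => by rw [mul_smul_comm, F.mul_Λ, smul_comm])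
    (by rw [map_smul, smul_eq_mul, inv_mul_cancel₀ h])

theorem Frob.false_of_unimodular (F : Frob A) (hε : (ε F.Λ : ℂ) = 0) (hodd : Odd (Module.finrank ℂ A))
    (hg : F.g = 1) (hα : tau F.α = 1) : False := by
  have hS := F.antipode_pow_eq_one (r := 1) (by rw [hg, one_pow]) (by rw [hα, one_pow])
  have hσ : F.sigma.toLinearMap * F.sigma.toLinearMap = (1 : Module.End ℂ A) := by
    ext x
    have h := LinearMap.congr_fun hS (F.sigma (F.sigma x))
    change S (S (S (S (F.sigma (F.sigma x))))) = F.sigma (F.sigma x) at h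
    rw [F.S2_sigma, F.S2_sigma] at h
    exact h.symm
  have ht := F.trace_sigma_tau_mul_eq_zero hε ε 1
  rw [tau_counit, LinearMap.mulRight_one] at ht
  change LinearMap.trace ℂ A F.sigma.toLinearMap = 0 at ht
  obtain ⟨a, -, ha, -⟩ := exists_trace_involution hσ
  rw [ht] at ha
  have h2 : Module.finrank ℂ A = 2 * a := by
    have : (Module.finrank ℂ A : ℂ) = 2 * a := by linear_combination ha
    exact_mod_cast this
  exact (Nat.not_even_iff_odd.2 hodd) (h2 ▸ even_two_mul a)

/-- The datum attached to a non-semisimple Hopf algebra with nontrivial distinguished character. -/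
theorem Frob.exists_datum (F : Frob A) (hε : (ε F.Λ : ℂ) = 0) {r : ℕ} (hr : r.Prime) (hodd : Odd r)
    (χ : A →ₐ[ℂ] ℂ) (hχ : orderOf (tau χ) = r) (hS : (S : Module.End ℂ A) ^ (4 * r) = 1) :
    ∃ D : Datum A, D.r = r := by
  obtain ⟨R⟩ := nonempty_reps A
  exact ⟨⟨F, R, χ, r, hr, hodd, hχ, hS, hε⟩, rfl⟩

theorem Frob.exists_datum_dual (F : Frob A) (hg : F.g ≠ 1) {r : ℕ} (hr : r.Prime) (hodd : Odd r)
    (hgr : orderOf F.g = r) (hS : (S : Module.End ℂ A) ^ (4 * r) = 1) :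
    ∃ D : Datum (HDual A), D.r = r := by
  have : Module.Finite ℂ (HDual A) := dualFinite
  have : Nontrivial (HDual A) := Module.nontrivial_of_finrank_pos (R := ℂ) (by
    rw [finrank_dual]
    have : Nontrivial A := ⟨_, _, hg⟩
    exact Module.finrank_pos)
  obtain ⟨F'⟩ := nonempty_frob (HDual A)
  refine F'.exists_datum (F.dual_integral_eq_zero hg F'.mul_Λ) hr hodd
    (evalChar F.isGroupLikeElem_g) ((orderOf_tau_evalChar _).trans hgr) ?_
  refine LinearMap.ext fun f => HDual.ext fun x => ?_
  rw [dual_S_pow_apply, hS]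
  rfl

end Main

section PQ
variable {A : Type*} [Ring A] [HopfAlgebra ℂ A] [Module.Finite ℂ A] {p q : ℕ}

theorem eq_of_dvd_mul (hp : p.Prime) (hq : q.Prime) {n : ℕ} (h : n ∣ p * q) :
    n = 1 ∨ n = p ∨ n = q ∨ n = p * q := by
  obtain ⟨a, b, ha, hb, rfl⟩ := (Nat.dvd_mul).1 h
  rcases (Nat.dvd_prime hp).1 ha with rfl | rfl <;> rcases (Nat.dvd_prime hq).1 hb with rfl | rfl <;>
    simp

omit [Module.Finite ℂ A] in
/-- A character takes the value `1` on a grouplike element of coprime order. -/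
theorem char_eq_one_of_coprime {g : A} (hg : IsGroupLikeElem ℂ g) (χ : A →ₐ[ℂ] ℂ)
    (h : (orderOf g).Coprime (orderOf (tau χ))) : χ g = 1 := by
  have h1 : χ g ^ orderOf g = 1 := by rw [← map_pow, pow_orderOf_eq_one, map_one]
  have h3 : ∀ k : ℕ, (tau χ ^ k) g = χ g ^ k • g := tau_pow_eigen χ (tau_groupLike χ hg)
  have h2 : χ g ^ orderOf (tau χ) = 1 := by
    have h4 := congrArg (ε : A →ₐ[ℂ] ℂ) (h3 (orderOf (tau χ)))
    rw [pow_orderOf_eq_one, AlgHom.one_apply, map_smul] at h4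
    have h5 : (ε g : ℂ) = 1 := hg.counit_eq_one
    rw [h5, smul_eq_mul, mul_one] at h4
    exact h4.symm
  exact orderOf_eq_one_iff.1 (Nat.eq_one_of_dvd_coprimes h (orderOf_dvd_of_pow_eq_one h1)
    (orderOf_dvd_of_pow_eq_one h2))

theorem isSemisimpleRing_of_finrank (hp : p.Prime) (hq : q.Prime) (hpodd : Odd p) (hqodd : Odd q)
    (hpq : p < q) (hq2 : q ≤ 2 * p + 1) (hdim : Module.finrank ℂ A = p * q) :
    IsSemisimpleRing A := by
  have : Nontrivial A := Module.nontrivial_of_finrank_pos (R := ℂ) (by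
    rw [hdim]; exact Nat.mul_pos hp.pos hq.pos)
  obtain ⟨F⟩ := nonempty_frob A
  by_cases hε : (ε F.Λ : ℂ) = 0
  swap
  · exact F.isSemisimpleRing_of_ε_ne hε
  have hgl := F.isGroupLikeElem_g
  have of_orders : ∀ g : A, IsGroupLikeElem ℂ g → ∀ χ : A →ₐ[ℂ] ℂ, χ g = 1 →
      orderOf g * orderOf (tau χ) = p * q → IsSemisimpleRing A := fun g hg χ h1 h2 => by
    obtain ⟨y, hy, hy1⟩ := exists_integral_of_orders hg χ h1 (h2.trans hdim.symm)
    exact isSemisimpleRing_of_integral hy hy1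
  have hg1 : orderOf F.g = p * q → IsSemisimpleRing A := fun h =>
    of_orders F.g hgl ε hgl.counit_eq_one (by rw [tau_counit, orderOf_one, mul_one, h])
  have hα1 : orderOf (tau F.α) = p * q → IsSemisimpleRing A := fun h =>
    of_orders 1 .one F.α (map_one _) (by rw [orderOf_one, one_mul, h])
  have hcop : p.Coprime q := (Nat.coprime_primes hp hq).2 hpq.ne
  have dualdim : Module.finrank ℂ (HDual A) = p * q := finrank_dual.trans hdim
  have single : ∀ r, (r = p ∨ r = q) → F.g ^ r = 1 → tau F.α ^ r = 1 →
      (orderOf F.g = r ∨ orderOf (tau F.α) = r) → False := fun r hr h1 h2 h3 => by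
    have hrp : r.Prime := by rcases hr with rfl | rfl <;> assumption
    have hro : Odd r := by rcases hr with rfl | rfl <;> assumption
    have hS := F.antipode_pow_eq_one h1 h2
    rcases h3 with h3 | h3
    · obtain ⟨D, rfl⟩ := F.exists_datum_dual (fun h => hrp.ne_one (by rw [← h3, h, orderOf_one]))
        hrp hro h3 hS
      exact D.false_of_finrank hq hpodd hqodd hpq hq2 dualdim hr
    · obtain ⟨D, rfl⟩ := F.exists_datum hε hrp hro F.α h3 hS
      exact D.false_of_finrank hq hpodd hqodd hpq hq2 hdim hr
  have pow_of {M : Type _} [Monoid M] {x : M} {r : ℕ} (h : orderOf x = r) : x ^ r = 1 :=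
    h ▸ pow_orderOf_eq_one x
  have pow_of_one {M : Type _} [Monoid M] {x : M} (r : ℕ) (h : orderOf x = 1) : x ^ r = 1 := by
    rw [orderOf_eq_one_iff.1 h, one_pow]
  rcases eq_of_dvd_mul hp hq (hdim ▸ orderOf_groupLike_dvd hgl) with hg | hg | hg | hg
  · rcases eq_of_dvd_mul hp hq (hdim ▸ orderOf_tau_dvd F.α) with hα | hα | hα | hα
    · exact (F.false_of_unimodular hε (hdim ▸ hpodd.mul hqodd) (orderOf_eq_one_iff.1 hg)
        (orderOf_eq_one_iff.1 hα)).elim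
    · exact (single p (.inl rfl) (pow_of_one p hg) (pow_of hα) (.inr hα)).elim
    · exact (single q (.inr rfl) (pow_of_one q hg) (pow_of hα) (.inr hα)).elim
    · exact hα1 hα
  · rcases eq_of_dvd_mul hp hq (hdim ▸ orderOf_tau_dvd F.α) with hα | hα | hα | hα
    · exact (single p (.inl rfl) (pow_of hg) (pow_of_one p hα) (.inl hg)).elim
    · exact (single p (.inl rfl) (pow_of hg) (pow_of hα) (.inr hα)).elim
    · exact of_orders F.g hgl F.α (char_eq_one_of_coprime hgl _ (by rwa [hg, hα])) (by rw [hg, hα])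
    · exact hα1 hα
  · rcases eq_of_dvd_mul hp hq (hdim ▸ orderOf_tau_dvd F.α) with hα | hα | hα | hα
    · exact (single q (.inr rfl) (pow_of hg) (pow_of_one q hα) (.inl hg)).elim
    · exact of_orders F.g hgl F.α (char_eq_one_of_coprime hgl _ (by rw [hg, hα]; exact hcop.symm))
        (by rw [hg, hα, mul_comm])
    · exact (single q (.inr rfl) (pow_of hg) (pow_of hα) (.inr hα)).elim
    · exact hα1 hα
  · exact hg1 hg

end PQ

end

end HopfPQ

theorem hopf_dim_pq_semisimple (p q : ℕ) (hp : p.Prime) (hq : q.Prime)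
    (hpodd : Odd p) (hqodd : Odd q) (hpq : p < q) (hq2p : q ≤ 2 * p + 1)
    (H : Type) [Ring H] [HopfAlgebra ℂ H]
    (hdim : Module.finrank ℂ H = p * q) :
    IsSemisimpleRing H := by
  have : Module.Finite ℂ H := Module.finite_of_finrank_pos (by
    rw [hdim]; exact Nat.mul_pos hp.pos hq.pos)
  exact HopfPQ.isSemisimpleRing_of_finrank hp hq hpodd hqodd hpq hq2p hdim
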